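/- Let d ≥ 1, 1 < p < ∞, and let 1 ≤ p_0 ≤ d be an integer. There exists a constant M_0 = M_0(d,p,p_0) > 0 with the following property: for every λ > 0 and every Borel measurable, locally bounded map c : ℝ → ℝ^{d×d} with c(t) symmetric non-negative definite for all t and satisfying Σ_{i,j=1}^d c_{ij}(t) ξ_i ξ_j ≥ λ Σ_{j=1}^{p_0} ξ_j^2 for all t ∈ ℝ, ξ ∈ ℝ^d, every u ∈ C_0^∞(ℝ^{d+1}), and all i,j ∈ {1,…,p_0}, one has ‖∂_{x_i x_j}^2 u‖_{L^p(ℝ^{d+1})} ≤ (M_0/λ) ‖∂_t u + Lu‖_{L^p(ℝ^{d+1})}, where Lu(t,x) = Σ_{i,j=1}^d c_{ij}(t) ∂_{x_i x_j}^2 u(t,x). -/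

import Mathlib

open MeasureTheory ENNReal

/-- Time derivative `∂ₜ u` of `u : ℝ × ℝᵈ → ℝ` (time is the first coordinate). -/
noncomputable def ptime {d : ℕ} (u : ℝ × (Fin d → ℝ) → ℝ) (z : ℝ × (Fin d → ℝ)) : ℝ :=
  deriv (fun s => u (s, z.2)) z.1

/-- Spatial partial derivative `∂_{xᵢ} u` of `u : ℝ × ℝᵈ → ℝ`. -/
noncomputable def pspace {d : ℕ} (i : Fin d) (u : ℝ × (Fin d → ℝ) → ℝ)
    (z : ℝ × (Fin d → ℝ)) : ℝ :=
  fderiv ℝ (fun y => u (z.1, y)) z.2 (Pi.single i 1)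

/-- Second spatial partial derivative `∂²_{xᵢxⱼ} u` of `u : ℝ × ℝᵈ → ℝ`. -/
noncomputable def pspace2 {d : ℕ} (i j : Fin d) (u : ℝ × (Fin d → ℝ) → ℝ) :
    ℝ × (Fin d → ℝ) → ℝ :=
  pspace i (pspace j u)

namespace ParabolicLp
open scoped BigOperators

/-- The one-dimensional heat kernel, the fundamental solution of `∂ₛ g = ∂²_y g`. -/
noncomputable def heat (s y : ℝ) : ℝ := Real.exp (-(y ^ 2 / (4 * s))) / √(4 * Real.pi * s)

/-- The second space derivative of the heat kernel, which is also its time derivative. -/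
noncomputable def heat2 (s y : ℝ) : ℝ := heat s y * (y ^ 2 / (4 * s ^ 2) - 1 / (2 * s))

lemma measurable_heat : Measurable (fun z : ℝ × ℝ => heat z.1 z.2) := by
  unfold heat; fun_prop

lemma measurable_heat2 : Measurable (fun z : ℝ × ℝ => heat2 z.1 z.2) := by
  unfold heat2
  exact measurable_heat.mul (by fun_prop)

lemma heat_nonneg (s y : ℝ) : 0 ≤ heat s y := by unfold heat; positivity

lemma hasDerivAt_heat_space {s : ℝ} (hs : 0 < s) (y : ℝ) :
    HasDerivAt (heat s) (heat s y * (-(y / (2 * s)))) y := by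
  unfold heat
  have h := (((hasDerivAt_id y).pow 2).div_const (4 * s)).neg.exp.div_const √(4 * Real.pi * s)
  refine h.congr_deriv ?_
  simp only [id, Pi.pow_apply, Pi.neg_apply]
  field_simp
  ring

lemma hasDerivAt_heat_time {s : ℝ} (hs : 0 < s) (y : ℝ) :
    HasDerivAt (fun s => heat s y) (heat2 s y) s := by
  have hp := Real.pi_pos
  have h0 : 0 < 4 * Real.pi * s := by positivity
  have h1 : HasDerivAt (fun s : ℝ => √(4 * Real.pi * s)) (4 * Real.pi / (2 * √(4 * Real.pi * s))) s := by
    have := ((hasDerivAt_id s).const_mul (4 * Real.pi)).sqrt (by simpa using h0.ne')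
    simpa using this
  have h2 : HasDerivAt (fun s : ℝ => -(y ^ 2 / (4 * s))) (y ^ 2 / (4 * s ^ 2)) s := by
    have := ((hasDerivAt_const s (y ^ 2)).div ((hasDerivAt_id s).const_mul 4) (by simpa using hs.ne')).neg
    refine this.congr_deriv ?_
    simp only [id]
    field_simp
    ring
  refine (h2.exp.div h1 (Real.sqrt_pos.2 h0).ne').congr_deriv ?_
  have h3 : √(4 * Real.pi * s) ^ 2 = 4 * Real.pi * s := Real.sq_sqrt h0.le
  have h4 : √(4 * Real.pi * s) ≠ 0 := (Real.sqrt_pos.2 h0).ne'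
  unfold heat2 heat
  generalize √(4 * Real.pi * s) = r at h3 h4 ⊢
  have h5 : s = r ^ 2 / (4 * Real.pi) := by field_simp; linarith
  generalize Real.exp (-(y ^ 2 / (4 * s))) = e
  subst h5
  field_simp

lemma hasDerivAt_heat_space_deriv {s : ℝ} (hs : 0 < s) (y : ℝ) :
    HasDerivAt (fun y => heat s y * (-(y / (2 * s)))) (heat2 s y) y := by
  refine ((hasDerivAt_heat_space hs y).mul (((hasDerivAt_id y).div_const (2 * s)).neg)).congr_deriv ?_
  unfold heat2
  simp only [id, Pi.neg_apply]
  field_simp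
  ring

lemma hasDerivAt_heat2_space {s : ℝ} (hs : 0 < s) (y : ℝ) :
    HasDerivAt (heat2 s) (heat s y * (-(y ^ 3 / (8 * s ^ 3)) + 3 * y / (4 * s ^ 2))) y := by
  refine ((hasDerivAt_heat_space hs y).mul
    ((((hasDerivAt_id y).pow 2).div_const (4 * s ^ 2)).sub_const (1 / (2 * s)))).congr_deriv ?_
  simp only [id, Pi.pow_apply]
  field_simp
  ring

lemma hasDerivAt_heat2_time {s : ℝ} (hs : 0 < s) (y : ℝ) :
    HasDerivAt (fun s => heat2 s y)
      (heat s y * (y ^ 4 / (16 * s ^ 4) - 3 * y ^ 2 / (4 * s ^ 3) + 3 / (4 * s ^ 2))) s := by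
  have h1 : HasDerivAt (fun s : ℝ => y ^ 2 / (4 * s ^ 2) - 1 / (2 * s))
      (-(y ^ 2 / (2 * s ^ 3)) + 1 / (2 * s ^ 2)) s := by
    have := ((hasDerivAt_const s (y ^ 2)).div (((hasDerivAt_id s).pow 2).const_mul 4)
      (by simpa using hs.ne')).sub ((hasDerivAt_const s (1 : ℝ)).div ((hasDerivAt_id s).const_mul 2)
      (by simpa using hs.ne'))
    refine this.congr_deriv ?_
    simp only [id, Pi.pow_apply]
    field_simp
    ring
  refine ((hasDerivAt_heat_time hs y).mul h1).congr_deriv ?_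
  unfold heat2
  field_simp
  ring

lemma poly_mul_exp_neg_le {u : ℝ} (hu : 0 ≤ u) {a b c d e : ℝ} (ha : 0 ≤ a) (hb : 0 ≤ b)
    (hc : 0 ≤ c) (hd : 0 ≤ d) (he : 0 ≤ e) :
    (a + b * u + c * u ^ 2 + d * u ^ 3 + e * u ^ 4) * Real.exp (-u)
      ≤ a + b + 2 * c + 6 * d + 24 * e := by
  have h0 := Real.pow_div_factorial_le_exp u hu 0
  have h1 := Real.pow_div_factorial_le_exp u hu 1
  have h2 := Real.pow_div_factorial_le_exp u hu 2
  have h3 := Real.pow_div_factorial_le_exp u hu 3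
  have h4 := Real.pow_div_factorial_le_exp u hu 4
  norm_num [Nat.factorial] at h0 h1 h2 h3 h4
  rw [Real.exp_neg, ← div_eq_mul_inv, div_le_iff₀ (Real.exp_pos _)]
  have e0 := Real.one_le_exp hu
  nlinarith [mul_le_mul_of_nonneg_left e0 ha, mul_le_mul_of_nonneg_left h1 hb,
    mul_le_mul_of_nonneg_left h2 hc, mul_le_mul_of_nonneg_left h3 hd,
    mul_le_mul_of_nonneg_left h4 he]

lemma heat_le {s : ℝ} (hs : 0 < s) (y : ℝ) :
    heat s y ≤ Real.exp (-(y ^ 2 / (4 * s))) / √s := by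
  unfold heat
  gcongr
  nlinarith [Real.pi_gt_three]

lemma heat_bound {s : ℝ} (hs : 0 < s) (y : ℝ) : heat s y ≤ 41 * (√s * s) / (s + y ^ 2) ^ 2 := by
  refine (heat_le hs y).trans ?_
  have hr := Real.sqrt_pos.2 hs
  set u := y ^ 2 / (4 * s) with hu
  have hu0 : 0 ≤ u := by positivity
  have hy : y ^ 2 = 4 * s * u := by rw [hu]; field_simp
  have := poly_mul_exp_neg_le hu0 (a := 1) (b := 8) (c := 16) (d := 0) (e := 0)
    (by norm_num) (by norm_num) (by norm_num) (by norm_num) (by norm_num)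
  rw [hy, div_le_div_iff₀ hr (by positivity)]
  have h2 : √s * √s = s := Real.mul_self_sqrt hs.le
  have : Real.exp (-u) * (s + 4 * s * u) ^ 2 = s ^ 2 *
    ((1 + 8 * u + 16 * u ^ 2 + 0 * u ^ 3 + 0 * u ^ 4) * Real.exp (-u)) := by ring
  rw [this]
  calc _ ≤ s ^ 2 * (1 + 8 + 2 * 16 + 6 * 0 + 24 * 0) := by gcongr
    _ = 41 * (√s * √s * s) := by rw [h2]; ring
    _ = _ := by ring

lemma abs_heat2_le {s : ℝ} (hs : 0 < s) (y : ℝ) :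
    |heat2 s y| ≤ 134 * √s / (s + y ^ 2) ^ 2 := by
  have hr := Real.sqrt_pos.2 hs
  have h1 := heat_le hs y
  set u := y ^ 2 / (4 * s) with hu
  have hu0 : 0 ≤ u := by positivity
  have hy : y ^ 2 = 4 * s * u := by rw [hu]; field_simp
  have := poly_mul_exp_neg_le hu0 (a := 1/2) (b := 5) (c := 16) (d := 16) (e := 0)
    (by norm_num) (by norm_num) (by norm_num) (by norm_num) (by norm_num)
  have h2 : √s * √s = s := Real.mul_self_sqrt hs.le
  have h3 : |y ^ 2 / (4 * s ^ 2) - 1 / (2 * s)| ≤ (u + 1 / 2) / s := by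
    have : y ^ 2 / (4 * s ^ 2) - 1 / (2 * s) = (u - 1 / 2) / s := by rw [hy]; field_simp
    rw [this, abs_div, abs_of_pos hs]
    gcongr
    rw [abs_le]; constructor <;> linarith
  unfold heat2
  rw [abs_mul, abs_of_nonneg (heat_nonneg s y)]
  calc _ ≤ Real.exp (-u) / √s * ((u + 1 / 2) / s) := by gcongr
    _ ≤ _ := by
      rw [hy, div_mul_div_comm, div_le_div_iff₀ (by positivity) (by positivity)]
      have : Real.exp (-u) * (u + 1 / 2) * (s + 4 * s * u) ^ 2 = s ^ 2 *
        ((1/2 + 5 * u + 16 * u ^ 2 + 16 * u ^ 3 + 0 * u ^ 4) * Real.exp (-u)) := by ring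
      rw [this]
      calc _ ≤ s ^ 2 * (1/2 + 5 + 2 * 16 + 6 * 16 + 24 * 0) := by gcongr
        _ ≤ 134 * (√s * √s * s) := by rw [h2]; nlinarith
        _ = _ := by ring

lemma abs_heat2_space_deriv_le {s : ℝ} (hs : 0 < s) (y : ℝ) :
    |heat s y * (-(y ^ 3 / (8 * s ^ 3)) + 3 * y / (4 * s ^ 2))| ≤ 61 / (s * (s + y ^ 2)) := by
  have hr := Real.sqrt_pos.2 hs
  have h1 := heat_le hs y
  set u := y ^ 2 / (4 * s) with hu
  have hu0 : 0 ≤ u := by positivity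
  have hy : y ^ 2 = 4 * s * u := by rw [hu]; field_simp
  have := poly_mul_exp_neg_le hu0 (a := 3/2) (b := 17/2) (c := 12) (d := 4) (e := 0)
    (by norm_num) (by norm_num) (by norm_num) (by norm_num) (by norm_num)
  have h2 : √s * √s = s := Real.mul_self_sqrt hs.le
  have hya : |y| ≤ √s * (1 + u) := by
    refine abs_le_of_sq_le_sq ?_ (by positivity)
    rw [hy, mul_pow, sq √s, h2]
    nlinarith [sq_nonneg (1 - u)]
  have h3 : |-(y ^ 3 / (8 * s ^ 3)) + 3 * y / (4 * s ^ 2)| ≤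
      √s * (1 + u) * ((u + 3 / 2) / (s ^ 2)) := by
    have : -(y ^ 3 / (8 * s ^ 3)) + 3 * y / (4 * s ^ 2) = y * ((3 / 2 - u) / (2 * s ^ 2)) := by
      rw [pow_succ, hy]; field_simp; ring
    rw [this, abs_mul]
    gcongr
    rw [abs_div, abs_of_pos (by positivity : 0 < 2 * s ^ 2)]
    gcongr
    · rw [abs_le]; constructor <;> linarith
    · nlinarith
  rw [abs_mul, abs_of_nonneg (heat_nonneg s y)]
  calc _ ≤ Real.exp (-u) / √s * (√s * (1 + u) * ((u + 3 / 2) / (s ^ 2))) := by gcongr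
    _ = Real.exp (-u) * (1 + u) * (u + 3 / 2) / s ^ 2 := by field_simp
    _ ≤ _ := by
      rw [hy, div_le_div_iff₀ (by positivity) (by positivity)]
      have : Real.exp (-u) * (1 + u) * (u + 3 / 2) * (s * (s + 4 * s * u)) = s ^ 2 *
        ((3/2 + 17/2 * u + 11 * u ^ 2 + 4 * u ^ 3 + 0 * u ^ 4) * Real.exp (-u)) := by ring
      rw [this]
      calc _ ≤ s ^ 2 * ((3/2 + 17/2 * u + 12 * u ^ 2 + 4 * u ^ 3 + 0 * u ^ 4) * Real.exp (-u)) := by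
            gcongr; norm_num
        _ ≤ s ^ 2 * (3/2 + 17/2 + 2 * 12 + 6 * 4 + 24 * 0) := by gcongr
        _ ≤ _ := by nlinarith

lemma abs_heat2_time_deriv_le {s : ℝ} (hs : 0 < s) (y : ℝ) :
    |heat s y * (y ^ 4 / (16 * s ^ 4) - 3 * y ^ 2 / (4 * s ^ 3) + 3 / (4 * s ^ 2))|
      ≤ 60 / (√s * s * (s + y ^ 2)) := by
  have hr := Real.sqrt_pos.2 hs
  have h1 := heat_le hs y
  set u := y ^ 2 / (4 * s) with hu
  have hu0 : 0 ≤ u := by positivity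
  have hy : y ^ 2 = 4 * s * u := by rw [hu]; field_simp
  have := poly_mul_exp_neg_le hu0 (a := 3/4) (b := 6) (c := 13) (d := 4) (e := 0)
    (by norm_num) (by norm_num) (by norm_num) (by norm_num) (by norm_num)
  have h3 : |y ^ 4 / (16 * s ^ 4) - 3 * y ^ 2 / (4 * s ^ 3) + 3 / (4 * s ^ 2)|
      ≤ (u ^ 2 + 3 * u + 3 / 4) / s ^ 2 := by
    have : y ^ 4 / (16 * s ^ 4) - 3 * y ^ 2 / (4 * s ^ 3) + 3 / (4 * s ^ 2)
      = (u ^ 2 - 3 * u + 3 / 4) / s ^ 2 := by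
      rw [show y ^ 4 = (y ^ 2) ^ 2 by ring, hy]; field_simp
      ring
    rw [this, abs_div, abs_of_pos (by positivity : 0 < s ^ 2)]
    gcongr
    rw [abs_le]; constructor <;> nlinarith
  rw [abs_mul, abs_of_nonneg (heat_nonneg s y)]
  calc _ ≤ Real.exp (-u) / √s * ((u ^ 2 + 3 * u + 3 / 4) / s ^ 2) := by gcongr
    _ ≤ _ := by
      rw [hy, div_mul_div_comm, div_le_div_iff₀ (by positivity) (by positivity)]
      have : Real.exp (-u) * (u ^ 2 + 3 * u + 3 / 4) * (√s * s * (s + 4 * s * u)) = √s * s ^ 2 *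
        ((3/4 + 6 * u + 13 * u ^ 2 + 4 * u ^ 3 + 0 * u ^ 4) * Real.exp (-u)) := by ring
      rw [this]
      calc _ ≤ √s * s ^ 2 * (3/4 + 6 + 2 * 13 + 6 * 4 + 24 * 0) := by gcongr
        _ ≤ √s * s ^ 2 * 60 := by gcongr; norm_num
        _ = _ := by ring

lemma integral_heat {s : ℝ} (hs : 0 < s) : ∫ y, heat s y = 1 := by
  have h := integral_gaussian (1 / (4 * s))
  unfold heat
  rw [integral_div]
  have h1 : ∀ y : ℝ, Real.exp (-(y ^ 2 / (4 * s))) = Real.exp (-(1 / (4 * s)) * y ^ 2) := by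
    intro y; congr 1; ring
  simp_rw [h1]
  rw [h, show Real.pi / (1 / (4 * s)) = 4 * Real.pi * s by field_simp]
  exact div_self (Real.sqrt_pos.2 (by positivity)).ne'

lemma integrable_heat {s : ℝ} (hs : 0 < s) : Integrable (heat s) :=
  Integrable.of_integral_ne_zero (by rw [integral_heat hs]; exact one_ne_zero)

lemma integrable_one_div_add_sq {a : ℝ} (ha : 0 < a) : Integrable fun y : ℝ =>
    1 / (a ^ 2 + y ^ 2) := by
  have h := (integrable_inv_one_add_sq.comp_div ha.ne').const_mul (1 / a ^ 2)
  refine h.congr (Filter.Eventually.of_forall fun y => ?_)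
  simp only
  field_simp

lemma integral_one_div_add_sq {a : ℝ} (ha : 0 < a) : ∫ y : ℝ,
    1 / (a ^ 2 + y ^ 2) = Real.pi / a := by
  have h := integral_univ_inv_one_add_sq
  have h2 := Measure.integral_comp_div (fun y : ℝ => (1 + y ^ 2)⁻¹) a
  rw [h, abs_of_pos ha] at h2
  have : ∀ y : ℝ, 1 / (a ^ 2 + y ^ 2) = 1 / a ^ 2 * (1 + (y / a) ^ 2)⁻¹ := by
    intro y; field_simp
  simp_rw [this]
  rw [integral_const_mul, h2, smul_eq_mul]
  field_simp

lemma lintegral_one_div_add_sq {a : ℝ} (ha : 0 < a) :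
    ∫⁻ y : ℝ, ENNReal.ofReal (1 / (a ^ 2 + y ^ 2)) = ENNReal.ofReal (Real.pi / a) := by
  rw [← integral_one_div_add_sq ha, ofReal_integral_eq_lintegral_ofReal
    (integrable_one_div_add_sq ha) (Filter.Eventually.of_forall fun y => by positivity)]

/-- The correlation `z ↦ ∫ K(w) f(z + w) dw`. -/
noncomputable def corr (K f : ℝ × ℝ → ℝ) (z : ℝ × ℝ) : ℝ := ∫ w, K w * f (z + w)

lemma lintegral_mul_rpow_le {α : Type*} [MeasurableSpace α] (μ : Measure α) {p : ℝ} (hp : 1 ≤ p)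
    {k h : α → ℝ≥0∞} (hk : Measurable k) (hh : Measurable h) :
    (∫⁻ a, k a * h a ∂μ) ^ p ≤ (∫⁻ a, k a ∂μ) ^ (p - 1) * ∫⁻ a, k a * h a ^ p ∂μ := by
  have hp0 : 0 < p := by linarith
  rcases hp.eq_or_lt with rfl | hp1
  · simp
  have hq := Real.HolderConjugate.conjExponent hp1
  set q := Real.conjExponent p
  set ν := μ.withDensity k
  have h1 : ∫⁻ a, k a * h a ∂μ = ∫⁻ a, h a ∂ν := by
    rw [lintegral_withDensity_eq_lintegral_mul μ hk hh]; rfl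
  have h2 : ∫⁻ a, k a * h a ^ p ∂μ = ∫⁻ a, h a ^ p ∂ν := by
    rw [lintegral_withDensity_eq_lintegral_mul μ hk (hh.pow_const p)]; rfl
  have h3 : ∫⁻ a, k a ∂μ = ∫⁻ _, 1 ∂ν := by
    rw [lintegral_withDensity_eq_lintegral_mul μ hk measurable_const]; simp
  rw [h1, h2, h3]
  have := ENNReal.lintegral_mul_le_Lp_mul_Lq ν hq hh.aemeasurable
    (aemeasurable_const (b := (1 : ℝ≥0∞)))
  simp only [Pi.mul_apply, mul_one, ENNReal.one_rpow] at this
  calc (∫⁻ a, h a ∂ν) ^ p ≤ ((∫⁻ a, h a ^ p ∂ν) ^ (1 / p) * (∫⁻ _, 1 ∂ν) ^ (1 / q)) ^ p := by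
        gcongr
    _ = (∫⁻ _, 1 ∂ν) ^ (p - 1) * ∫⁻ a, h a ^ p ∂ν := by
        rw [ENNReal.mul_rpow_of_nonneg _ _ hp0.le, ← ENNReal.rpow_mul, ← ENNReal.rpow_mul,
          one_div_mul_cancel hp0.ne', ENNReal.rpow_one, mul_comm]
        congr 2
        have := hq.inv_add_inv_eq_one
        have h4 : 1 / q = 1 - p⁻¹ := by rw [one_div]; linarith
        rw [h4]; field_simp

lemma lintegral_abs_corr_rpow_le {p : ℝ} (hp : 1 ≤ p) {K f : ℝ × ℝ → ℝ} (hK : Measurable K)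
    (hf : Measurable f) :
    ∫⁻ z, (∫⁻ w, ‖K w‖ₑ * ‖f (z + w)‖ₑ) ^ p ≤ (∫⁻ w, ‖K w‖ₑ) ^ p * ∫⁻ z, ‖f z‖ₑ ^ p := by
  have hp0 : 0 < p := by linarith
  calc ∫⁻ z, (∫⁻ w, ‖K w‖ₑ * ‖f (z + w)‖ₑ) ^ p
      ≤ ∫⁻ z, (∫⁻ w, ‖K w‖ₑ) ^ (p - 1) * ∫⁻ w, ‖K w‖ₑ * ‖f (z + w)‖ₑ ^ p := by
        refine lintegral_mono fun z => ?_
        exact lintegral_mul_rpow_le _ hp hK.enorm (by fun_prop)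
    _ = (∫⁻ w, ‖K w‖ₑ) ^ (p - 1) * ∫⁻ w, ∫⁻ z, ‖K w‖ₑ * ‖f (z + w)‖ₑ ^ p := by
        rw [lintegral_const_mul _ (by fun_prop), lintegral_lintegral_swap (by fun_prop)]
    _ = (∫⁻ w, ‖K w‖ₑ) ^ (p - 1) * ((∫⁻ w, ‖K w‖ₑ) * ∫⁻ z, ‖f z‖ₑ ^ p) := by
        congr 1
        rw [← lintegral_mul_const _ (by fun_prop)]
        refine lintegral_congr fun w => ?_
        rw [lintegral_const_mul _ (by fun_prop)]
        congr 1
        exact lintegral_add_right_eq_self (fun z => ‖f z‖ₑ ^ p) w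
    _ = _ := by
        rw [← mul_assoc]
        congr 1
        nth_rewrite 2 [← ENNReal.rpow_one (∫⁻ w, ‖K w‖ₑ)]
        rw [← ENNReal.rpow_add_of_nonneg _ _ (by linarith) zero_le_one]
        congr 1; ring

lemma enorm_corr_le (K f : ℝ × ℝ → ℝ) (z : ℝ × ℝ) :
    ‖corr K f z‖ₑ ≤ ∫⁻ w, ‖K w‖ₑ * ‖f (z + w)‖ₑ := by
  refine (enorm_integral_le_lintegral_enorm _).trans_eq ?_
  simp only [enorm_mul]

lemma measurable_corr {K f : ℝ × ℝ → ℝ} (hK : Measurable K) (hf : Measurable f) :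
    Measurable (corr K f) := by
  have : StronglyMeasurable fun q : (ℝ × ℝ) × (ℝ × ℝ) => K q.2 * f (q.1 + q.2) :=
    Measurable.stronglyMeasurable (by fun_prop)
  exact this.integral_prod_right.measurable

lemma eLpNorm_eq_rpow {α : Type*} [MeasurableSpace α] (μ : Measure α) {p : ℝ} (hp : 0 < p)
    {E : Type*} [NormedAddCommGroup E] (f : α → E) :
    eLpNorm f (ENNReal.ofReal p) μ = (∫⁻ a, ‖f a‖ₑ ^ p ∂μ) ^ (1 / p) := by
  rw [eLpNorm_eq_lintegral_rpow_enorm_toReal (by simpa using hp) ENNReal.ofReal_ne_top,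
    ENNReal.toReal_ofReal hp.le]

lemma eLpNorm_le_mul_iff {α β : Type*} [MeasurableSpace α] [MeasurableSpace β] {μ : Measure α}
    {ν : Measure β} {p : ℝ} (hp : 0 < p) {E F : Type*} [NormedAddCommGroup E]
    [NormedAddCommGroup F] (f : α → E) (g : β → F) (C : ℝ≥0∞) :
    eLpNorm f (ENNReal.ofReal p) μ ≤ C * eLpNorm g (ENNReal.ofReal p) ν ↔
      ∫⁻ a, ‖f a‖ₑ ^ p ∂μ ≤ C ^ p * ∫⁻ a, ‖g a‖ₑ ^ p ∂ν := by
  rw [eLpNorm_eq_rpow _ hp, eLpNorm_eq_rpow _ hp]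
  rw [← ENNReal.rpow_le_rpow_iff hp, ENNReal.mul_rpow_of_nonneg _ _ hp.le, ← ENNReal.rpow_mul,
    ← ENNReal.rpow_mul, one_div_mul_cancel hp.ne', ENNReal.rpow_one, ENNReal.rpow_one]

lemma eLpNorm_corr_le {p : ℝ} (hp : 1 ≤ p) {K f : ℝ × ℝ → ℝ} (hK : Measurable K)
    (hf : Measurable f) :
    eLpNorm (corr K f) (ENNReal.ofReal p) volume
      ≤ (∫⁻ w, ‖K w‖ₑ) * eLpNorm f (ENNReal.ofReal p) volume := by
  rw [eLpNorm_le_mul_iff (by linarith)]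
  refine le_trans (lintegral_mono fun z => ?_) (lintegral_abs_corr_rpow_le hp hK hf)
  gcongr
  exact enorm_corr_le K f z

/-- A bound on smooth compactly supported functions extends to the whole Lebesgue space. -/
lemma eLpNorm_corr_le_of_dense {p : ℝ} (hp : 1 ≤ p) {K : ℝ × ℝ → ℝ} (hK : Measurable K)
    (hKi : Integrable K) (C : ℝ≥0∞) (hC0 : C ≠ 0) (hC : C ≠ ∞)
    (h : ∀ g : ℝ × ℝ → ℝ, ContDiff ℝ (⊤ : ℕ∞) g → HasCompactSupport g →
      eLpNorm (corr K g) (ENNReal.ofReal p) volume ≤ C * eLpNorm g (ENNReal.ofReal p) volume)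
    {f : ℝ × ℝ → ℝ} (hf : Measurable f) :
    eLpNorm (corr K f) (ENNReal.ofReal p) volume ≤ C * eLpNorm f (ENNReal.ofReal p) volume := by
  have hp0 : 0 < p := by linarith
  by_cases hfp : eLpNorm f (ENNReal.ofReal p) volume = ∞
  · rw [hfp, ENNReal.mul_top hC0]; exact le_top
  have hfL : MemLp f (ENNReal.ofReal p) volume := ⟨hf.aestronglyMeasurable, lt_top_iff_ne_top.2 hfp⟩
  have h1p : 1 ≤ ENNReal.ofReal p := by simpa using hp
  have hk : ∫⁻ w, ‖K w‖ₑ ≠ ∞ := hKi.2.ne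
  set k := ∫⁻ w, ‖K w‖ₑ
  have key : ∀ ε : ℝ, 0 < ε → eLpNorm (corr K f) (ENNReal.ofReal p) volume
      ≤ C * eLpNorm f (ENNReal.ofReal p) volume + (C + k) * ENNReal.ofReal ε := by
    intro ε hε
    obtain ⟨g, hg1, hg2, hg3⟩ := hfL.exist_eLpNorm_sub_le ENNReal.ofReal_ne_top h1p hε
    have hgm : Measurable g := hg2.continuous.measurable
    set r : ℝ × ℝ → ℝ≥0∞ := fun z => ∫⁻ w, ‖K w‖ₑ * ‖(f - g) (z + w)‖ₑ
    have hrm : Measurable r := by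
      have : Measurable (f - g) := hf.sub hgm
      exact Measurable.lintegral_prod_right' (f := fun q : (ℝ × ℝ) × (ℝ × ℝ) =>
        ‖K q.2‖ₑ * ‖(f - g) (q.1 + q.2)‖ₑ) (by fun_prop)
    have hpt : ∀ z, ‖corr K f z‖ₑ ≤ ‖corr K g z‖ₑ + r z := by
      intro z
      by_cases hi : Integrable (fun w => K w * f (z + w))
      · have hgi : Integrable (fun w => K w * g (z + w)) := by
          obtain ⟨B, hB⟩ := hg2.continuous.bounded_above_of_compact_support hg1
          refine hKi.mul_bdd (c := B) (by fun_prop) (Filter.Eventually.of_forall fun w => hB _)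
        have : corr K f z = corr K g z + corr K (f - g) z := by
          unfold corr
          rw [← integral_add hgi]
          · congr 1; ext w; simp; ring
          · convert! hi.sub hgi using 1
            ext w; simp; ring
        rw [this]
        refine (enorm_add_le _ _).trans ?_
        gcongr
        exact enorm_corr_le _ _ _
      · have : corr K f z = 0 := integral_undef hi
        simp [this]
    have hr : (∫⁻ z, r z ^ p) ^ (1 / p) ≤ k * ENNReal.ofReal ε := by
      have h2 := lintegral_abs_corr_rpow_le hp hK (hf.sub hgm)
      calc (∫⁻ z, r z ^ p) ^ (1 / p) ≤ (k ^ p * ∫⁻ z, ‖(f - g) z‖ₑ ^ p) ^ (1 / p) := by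
            gcongr
        _ = k * eLpNorm (f - g) (ENNReal.ofReal p) volume := by
            rw [eLpNorm_eq_rpow _ hp0, ENNReal.mul_rpow_of_nonneg _ _ (by positivity),
              ← ENNReal.rpow_mul, mul_one_div_cancel hp0.ne', ENNReal.rpow_one]
        _ ≤ _ := by gcongr
    calc eLpNorm (corr K f) (ENNReal.ofReal p) volume
        ≤ (∫⁻ z, (‖corr K g z‖ₑ + r z) ^ p) ^ (1 / p) := by
          rw [eLpNorm_eq_rpow _ hp0]
          gcongr
          exact hpt _
      _ ≤ (∫⁻ z, ‖corr K g z‖ₑ ^ p) ^ (1 / p) + (∫⁻ z, r z ^ p) ^ (1 / p) :=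
          ENNReal.lintegral_Lp_add_le (measurable_corr hK hgm).enorm.aemeasurable
            hrm.aemeasurable hp
      _ ≤ C * eLpNorm g (ENNReal.ofReal p) volume + k * ENNReal.ofReal ε := by
          gcongr
          rw [← eLpNorm_eq_rpow _ hp0]
          exact h g hg2 hg1
      _ ≤ C * (eLpNorm f (ENNReal.ofReal p) volume + ENNReal.ofReal ε) + k * ENNReal.ofReal ε := by
          gcongr
          have : g = f - (f - g) := by ext; simp
          calc eLpNorm g (ENNReal.ofReal p) volume
              = eLpNorm (f - (f - g)) (ENNReal.ofReal p) volume := by rw [← this]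
            _ ≤ _ := (eLpNorm_sub_le hf.aestronglyMeasurable
                (hf.sub hgm).aestronglyMeasurable h1p).trans (by gcongr)
      _ = _ := by ring
  have hCk : C + k ≠ ∞ := ENNReal.add_ne_top.2 ⟨hC, hk⟩
  refine ENNReal.le_of_forall_pos_le_add fun δ hδ _ => ?_
  have hd : 0 < (δ : ℝ) / ((C + k).toReal + 1) := by positivity
  refine (key _ hd).trans ?_
  gcongr
  rw [← ENNReal.ofReal_toReal hCk, ← ENNReal.ofReal_mul ENNReal.toReal_nonneg,
    ← ENNReal.ofReal_coe_nnreal]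
  apply ENNReal.ofReal_le_ofReal
  rw [ENNReal.toReal_ofReal ENNReal.toReal_nonneg]
  have : (0:ℝ) ≤ (C + k).toReal := ENNReal.toReal_nonneg
  rw [mul_div_assoc', div_le_iff₀ (by positivity)]
  nlinarith [δ.coe_nonneg]

section TestFunctions

variable {E : Type*} [NormedAddCommGroup E] [NormedSpace ℝ E]

/-- The directional derivative of `φ` along `e`, as a function of the point. -/
noncomputable def D (e : E) (φ : E → ℝ) (z : E) : ℝ := fderiv ℝ φ z e

/-- Smooth compactly supported real functions. -/
structure IsTest (φ : E → ℝ) : Prop where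
  contDiff : ContDiff ℝ (⊤ : ℕ∞) φ
  hasCompactSupport : HasCompactSupport φ

namespace IsTest

variable {φ ψ : E → ℝ}

lemma D (h : IsTest φ) (e : E) : IsTest (D e φ) where
  contDiff := (h.contDiff.fderiv_right (m := (⊤ : ℕ∞)) (by simp)).clm_apply contDiff_const
  hasCompactSupport := h.hasCompactSupport.fderiv_apply (𝕜 := ℝ) e

lemma differentiable (h : IsTest φ) : Differentiable ℝ φ := h.contDiff.differentiable (by simp)

lemma continuous (h : IsTest φ) : Continuous φ := h.contDiff.continuous

lemma add (h : IsTest φ) (h' : IsTest ψ) : IsTest (fun z => φ z + ψ z) :=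
  ⟨h.contDiff.add h'.contDiff, h.hasCompactSupport.add h'.hasCompactSupport⟩

lemma const_mul (h : IsTest φ) (c : ℝ) : IsTest (fun z => c * φ z) :=
  ⟨contDiff_const.mul h.contDiff, h.hasCompactSupport.mul_left⟩

lemma exists_bound (h : IsTest φ) : ∃ B : ℝ, 0 ≤ B ∧ ∀ z, |φ z| ≤ B := by
  obtain ⟨B, hB⟩ := h.continuous.bounded_above_of_compact_support h.hasCompactSupport
  exact ⟨B, (norm_nonneg _).trans (hB 0), hB⟩

lemma hasDerivAt_line (h : IsTest φ) (P a : E) (s : ℝ) :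
    HasDerivAt (fun s : ℝ => φ (P + s • a)) (ParabolicLp.D a φ (P + s • a)) s := by
  have h1 : HasDerivAt (fun s : ℝ => P + s • a) a s := by
    simpa using ((hasDerivAt_id s).smul_const a).const_add P
  exact (h.differentiable _).hasFDerivAt.comp_hasDerivAt s h1

lemma comp_add (h : IsTest φ) (w : E) : IsTest (fun z => φ (z + w)) :=
  ⟨h.contDiff.comp (contDiff_id.add contDiff_const),
    h.hasCompactSupport.comp_homeomorph (Homeomorph.addRight w)⟩

end IsTest

lemma D_comm {φ : E → ℝ} (h : IsTest φ) (a b : E) : D a (D b φ) = D b (D a φ) := by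
  ext z
  have h1 : ∀ e : E, ∀ z, HasFDerivAt (D e φ)
      ((ContinuousLinearMap.apply ℝ ℝ e).comp (fderiv ℝ (fderiv ℝ φ) z)) z := by
    intro e z
    have : DifferentiableAt ℝ (fderiv ℝ φ) z :=
      ((h.contDiff.fderiv_right (m := (⊤ : ℕ∞)) (by simp)).differentiable (by simp)) z
    exact (ContinuousLinearMap.apply ℝ ℝ e).hasFDerivAt.comp z this.hasFDerivAt
  have h2 := second_derivative_symmetric (f := φ) (f' := fderiv ℝ φ)
    (f'' := fderiv ℝ (fderiv ℝ φ) z) (x := z)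
    (fun y => (h.differentiable y).hasFDerivAt)
    (((h.contDiff.fderiv_right (m := (⊤ : ℕ∞)) (by simp)).differentiable (by simp)) z).hasFDerivAt
    a b
  change fderiv ℝ (D b φ) z a = fderiv ℝ (D a φ) z b
  rw [(h1 b z).fderiv, (h1 a z).fderiv]
  simpa using h2

/-- The one-dimensional heat semigroup acting along the direction `b`. -/
noncomputable def heatAvg (b : E) (s : ℝ) (φ : E → ℝ) (P : E) : ℝ :=
  ∫ y, heat s y * φ (P + y • b)

lemma integrable_heat_mul {s : ℝ} (hs : 0 < s) {g : ℝ → ℝ} (hg : AEStronglyMeasurable g) {B : ℝ}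
    (hB : ∀ y, |g y| ≤ B) : Integrable fun y => heat s y * g y :=
  (integrable_heat hs).mul_bdd hg (Filter.Eventually.of_forall hB)

lemma abs_integral_heat_mul_le {s : ℝ} (hs : 0 < s) {g : ℝ → ℝ} {B : ℝ}
    (hB : ∀ y, |g y| ≤ B) : |∫ y, heat s y * g y| ≤ B := by
  have h := norm_integral_le_of_norm_le (f := fun y => heat s y * g y)
    ((integrable_heat hs).mul_const B) (Filter.Eventually.of_forall fun y => by
      rw [norm_mul, Real.norm_of_nonneg (heat_nonneg s y)]
      exact mul_le_mul_of_nonneg_left (hB y) (heat_nonneg s y))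
  rwa [integral_mul_const, integral_heat hs, one_mul] at h

lemma abs_heatAvg_le {s : ℝ} (hs : 0 < s) (b : E) {φ : E → ℝ} {B : ℝ} (hB : ∀ z, |φ z| ≤ B)
    (P : E) : |heatAvg b s φ P| ≤ B :=
  abs_integral_heat_mul_le hs fun _ => hB _

lemma abs_heat2_le' {s : ℝ} (hs : 0 < s) (y : ℝ) :
    |heat2 s y| ≤ 134 / √s * (1 / (s + y ^ 2)) := by
  refine (abs_heat2_le hs y).trans ?_
  have hr := Real.sqrt_pos.2 hs
  have h2 := Real.sq_sqrt hs.le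
  rw [div_mul_div_comm, mul_one, div_le_div_iff₀ (by positivity) (by positivity)]
  nlinarith [mul_nonneg (by positivity : 0 ≤ (s + y ^ 2)) (sq_nonneg y)]

lemma heat_bound' {s : ℝ} (hs : 0 < s) (y : ℝ) :
    heat s y ≤ 41 * √s * (1 / (s + y ^ 2)) := by
  refine (heat_bound hs y).trans ?_
  have hr := Real.sqrt_pos.2 hs
  rw [mul_one_div, div_le_div_iff₀ (by positivity) (by positivity)]
  nlinarith [mul_nonneg (mul_nonneg (by positivity : 0 ≤ (s + y ^ 2)) (sq_nonneg y)) hr.le]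

lemma integrable_one_div_add {s : ℝ} (hs : 0 < s) : Integrable fun y : ℝ => 1 / (s + y ^ 2) := by
  simpa [Real.sq_sqrt hs.le] using integrable_one_div_add_sq (Real.sqrt_pos.2 hs)

lemma measurable_heat_right (s : ℝ) : Measurable (heat s) := by
  unfold heat; fun_prop

lemma measurable_heat2_right (s : ℝ) : Measurable (heat2 s) :=
  (measurable_heat_right s).mul (by fun_prop)

lemma integrable_heat2 {s : ℝ} (hs : 0 < s) : Integrable (heat2 s) :=
  ((integrable_one_div_add hs).const_mul (134 / √s)).mono' (measurable_heat2_right s).aestronglyMeasurable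
    (Filter.Eventually.of_forall fun y => abs_heat2_le' hs y)

lemma integrable_heat_deriv {s : ℝ} (hs : 0 < s) :
    Integrable (fun y => heat s y * (-(y / (2 * s)))) := by
  have hr := Real.sqrt_pos.2 hs
  refine ((integrable_one_div_add hs).const_mul (41 / 2)).mono'
    ((measurable_heat_right s).mul (by fun_prop)).aestronglyMeasurable
    (Filter.Eventually.of_forall fun y => ?_)
  rw [norm_mul, Real.norm_of_nonneg (heat_nonneg s y), Real.norm_eq_abs, abs_neg, abs_div,
    abs_of_pos (by positivity : 0 < 2 * s)]
  have h2 := Real.sq_sqrt hs.le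
  calc heat s y * (|y| / (2 * s)) ≤ 41 * (√s * s) / (s + y ^ 2) ^ 2 * (|y| / (2 * s)) := by
        gcongr; exact heat_bound hs y
    _ = 41 / 2 * ((√s * |y|) / (s + y ^ 2) ^ 2) := by field_simp
    _ ≤ 41 / 2 * (1 / (s + y ^ 2)) := by
        refine mul_le_mul_of_nonneg_left ?_ (by norm_num)
        rw [div_le_div_iff₀ (by positivity) (by positivity)]
        have : √s * |y| ≤ s + y ^ 2 := by nlinarith [sq_nonneg (√s - |y|), sq_abs y, abs_nonneg y, sq_nonneg (√s), sq_nonneg y]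
        nlinarith [(by positivity : 0 ≤ s + y ^ 2)]

/-- Two integrations by parts move the derivatives of the kernel to the function. -/
lemma integral_heat2_mul {s : ℝ} (hs : 0 < s) (b : E) {φ : E → ℝ} (hφ : IsTest φ) (P : E) :
    ∫ y, heat2 s y * φ (P + y • b) = heatAvg b s (D b (D b φ)) P := by
  have hφ1 := hφ.D b
  have hφ2 := hφ1.D b
  obtain ⟨B, -, hB⟩ := hφ.exists_bound
  obtain ⟨B1, -, hB1⟩ := hφ1.exists_bound
  obtain ⟨B2, -, hB2⟩ := hφ2.exists_bound
  have hc : ∀ {ψ : E → ℝ}, IsTest ψ → AEStronglyMeasurable (fun y : ℝ => ψ (P + y • b)) := by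
    intro ψ hψ
    have := hψ.continuous
    exact Continuous.aestronglyMeasurable (by fun_prop)
  have hev : ∀ {ψ : E → ℝ} {B : ℝ}, (∀ z, |ψ z| ≤ B) → ∀ᵐ y : ℝ, ‖ψ (P + y • b)‖ ≤ B :=
    fun h => Filter.Eventually.of_forall fun y => h _
  have i1 := integral_mul_deriv_eq_deriv_mul_of_integrable
    (u := fun y => φ (P + y • b)) (v := fun y => heat s y * (-(y / (2 * s))))
    (fun y _ => hφ.hasDerivAt_line P b y) (fun y _ => hasDerivAt_heat_space_deriv hs y)
    ((integrable_heat2 hs).bdd_mul (hc hφ) (hev hB))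
    ((integrable_heat_deriv hs).bdd_mul (hc hφ1) (hev hB1))
    ((integrable_heat_deriv hs).bdd_mul (hc hφ) (hev hB))
  have i2 := integral_mul_deriv_eq_deriv_mul_of_integrable
    (u := fun y => D b φ (P + y • b)) (v := heat s)
    (fun y _ => hφ1.hasDerivAt_line P b y) (fun y _ => hasDerivAt_heat_space hs y)
    ((integrable_heat_deriv hs).bdd_mul (hc hφ1) (hev hB1))
    ((integrable_heat hs).bdd_mul (hc hφ2) (hev hB2))
    ((integrable_heat hs).bdd_mul (hc hφ1) (hev hB1))
  unfold heatAvg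
  simp_rw [mul_comm (heat2 s _), mul_comm (heat s _)]
  rw [i1, i2, neg_neg]

lemma heatAvg_add {s : ℝ} (hs : 0 < s) (b : E) {φ ψ : E → ℝ} (hφ : IsTest φ) (hψ : IsTest ψ)
    (P : E) : heatAvg b s (fun z => φ z + ψ z) P = heatAvg b s φ P + heatAvg b s ψ P := by
  obtain ⟨B, -, hB⟩ := hφ.exists_bound
  obtain ⟨B', -, hB'⟩ := hψ.exists_bound
  have h1 := hφ.continuous
  have h2 := hψ.continuous
  unfold heatAvg
  rw [← integral_add (integrable_heat_mul hs (Continuous.aestronglyMeasurable (by fun_prop))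
    fun y => hB _) (integrable_heat_mul hs (Continuous.aestronglyMeasurable (by fun_prop))
    fun y => hB' _)]
  simp only [mul_add]

lemma hasDerivAt_heatAvg {s : ℝ} (hs : 0 < s) (a b : E) {φ : E → ℝ} (hφ : IsTest φ) (P : E) :
    HasDerivAt (fun s => heatAvg b s φ (P + s • a))
      (heatAvg b s (fun z => D b (D b φ) z + D a φ z) (P + s • a)) s := by
  have hφ1 := hφ.D a
  obtain ⟨B, hB0, hB⟩ := hφ.exists_bound
  obtain ⟨B1, hB10, hB1⟩ := hφ1.exists_bound
  have hc := hφ.continuous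
  have hc1 := hφ1.continuous
  have hs2 : 0 < s / 2 := by positivity
  have hr := Real.sqrt_pos.2 hs2
  have key := hasDerivAt_integral_of_dominated_loc_of_deriv_le (μ := volume) (x₀ := s)
    (s := Metric.ball s (s / 2))
    (F := fun s y => heat s y * φ (P + s • a + y • b))
    (F' := fun s y => heat2 s y * φ (P + s • a + y • b) + heat s y * D a φ (P + s • a + y • b))
    (bound := fun y => (134 / √(s / 2) * B + 41 * √(2 * s) * B1) * (1 / (s / 2 + y ^ 2)))
    (Metric.ball_mem_nhds s hs2)
    (Filter.Eventually.of_forall fun r => ((measurable_heat_right r).mul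
      (Continuous.measurable (by fun_prop))).aestronglyMeasurable)
    (integrable_heat_mul hs (Continuous.aestronglyMeasurable (by fun_prop)) fun y => hB _)
    (((measurable_heat2_right s).mul (Continuous.measurable (by fun_prop))).add
      ((measurable_heat_right s).mul (Continuous.measurable (by fun_prop)))).aestronglyMeasurable
    (Filter.Eventually.of_forall fun y r hr => ?_)
    ((integrable_one_div_add hs2).const_mul _)
    (Filter.Eventually.of_forall fun y r hr => ?_)
  · have h2 := key.2
    have : (∫ y, (heat2 s y * φ (P + s • a + y • b) + heat s y * D a φ (P + s • a + y • b)))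
        = heatAvg b s (fun z => D b (D b φ) z + D a φ z) (P + s • a) := by
      rw [heatAvg_add hs b ((hφ.D b).D b) hφ1, ← integral_heat2_mul hs b hφ]
      rw [integral_add]
      · rfl
      · exact (integrable_heat2 hs).mul_bdd (Continuous.aestronglyMeasurable (by fun_prop))
          (Filter.Eventually.of_forall fun y => hB _)
      · exact integrable_heat_mul hs (Continuous.aestronglyMeasurable (by fun_prop)) fun y => hB1 _
    rw [this] at h2
    exact h2
  · rw [Metric.mem_ball, Real.dist_eq, abs_lt] at hr
    have hr0 : s / 2 ≤ r := by linarith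
    have hrp : 0 < r := by linarith
    have e1 := abs_heat2_le' hrp y
    have e2 := heat_bound' hrp y
    have e3 : 134 / √r * (1 / (r + y ^ 2)) ≤ 134 / √(s / 2) * (1 / (s / 2 + y ^ 2)) := by gcongr
    have e4 : 41 * √r * (1 / (r + y ^ 2)) ≤ 41 * √(2 * s) * (1 / (s / 2 + y ^ 2)) := by
      gcongr
      linarith
    rw [add_mul]
    refine (norm_add_le _ _).trans (add_le_add ?_ ?_)
    · rw [norm_mul, mul_right_comm]
      exact mul_le_mul (e1.trans e3) (hB _) (norm_nonneg _) (by positivity)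
    · rw [norm_mul, mul_right_comm, Real.norm_of_nonneg (heat_nonneg _ _)]
      exact mul_le_mul (e2.trans e4) (hB1 _) (norm_nonneg _) (by positivity)
  · rw [Metric.mem_ball, Real.dist_eq, abs_lt] at hr
    have hrp : 0 < r := by linarith
    have h1 := hasDerivAt_heat_time hrp y
    have h2 := hφ.hasDerivAt_line (P + y • b) a r
    have := h1.mul h2
    simp only [add_right_comm P (_ • a)]
    exact this

lemma heatAvg_sub_eq {s₁ s₂ : ℝ} (hs : 0 < s₁) (h12 : s₁ ≤ s₂) (a b : E) {φ : E → ℝ}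
    (hφ : IsTest φ) (P : E) :
    heatAvg b s₂ φ (P + s₂ • a) - heatAvg b s₁ φ (P + s₁ • a)
      = ∫ s in s₁..s₂, heatAvg b s (fun z => D b (D b φ) z + D a φ z) (P + s • a) := by
  have hψ := ((hφ.D b).D b).add (hφ.D a)
  have hpos : ∀ s ∈ Set.uIcc s₁ s₂, 0 < s := by
    intro s h
    rw [Set.uIcc_of_le h12] at h
    exact hs.trans_le h.1
  rw [intervalIntegral.integral_eq_sub_of_hasDerivAt (f := fun s => heatAvg b s φ (P + s • a))
    (fun s h => hasDerivAt_heatAvg (hpos s h) a b hφ P)]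
  refine ContinuousOn.intervalIntegrable fun s h => ?_
  exact (hasDerivAt_heatAvg (hpos s h) a b hψ P).continuousAt.continuousWithinAt

end TestFunctions

/-- Truncation of a kernel to times in `(ε, R]`. -/
noncomputable def trunc (ε R : ℝ) (k : ℝ → ℝ → ℝ) (w : ℝ × ℝ) : ℝ :=
  if w.1 ∈ Set.Ioc ε R then k w.1 w.2 else 0

lemma measurable_trunc (ε R : ℝ) {k : ℝ → ℝ → ℝ} (hk : Measurable fun z : ℝ × ℝ => k z.1 z.2) :
    Measurable (trunc ε R k) :=
  Measurable.ite (measurable_fst measurableSet_Ioc) hk measurable_const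

lemma integrable_trunc {ε R C : ℝ} (hε : 0 < ε) {k : ℝ → ℝ → ℝ}
    (hk : Measurable fun z : ℝ × ℝ => k z.1 z.2)
    (hC : ∀ s ∈ Set.Ioc ε R, ∀ y, |k s y| ≤ C * (1 / (ε + y ^ 2))) :
    Integrable (trunc ε R k) := by
  have h1 : Integrable (Set.indicator (Set.Ioc ε R) fun _ => C) :=
    (integrable_indicator_iff measurableSet_Ioc).2 (by simp)
  refine (h1.mul_prod (integrable_one_div_add hε)).mono'
    (measurable_trunc ε R hk).aestronglyMeasurable (Filter.Eventually.of_forall fun w => ?_)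
  unfold trunc
  split_ifs with h
  · simpa [h] using hC _ h w.2
  · simp [h]

lemma integrable_trunc_heat {ε : ℝ} (hε : 0 < ε) (R : ℝ) : Integrable (trunc ε R heat) := by
  refine integrable_trunc (C := 41 * √R) hε measurable_heat fun s hs y => ?_
  have h0 : 0 < s := hε.trans hs.1
  rw [abs_of_nonneg (heat_nonneg s y)]
  refine (heat_bound' h0 y).trans ?_
  have := hs.1.le
  have := hs.2
  gcongr

lemma integrable_trunc_heat2 {ε : ℝ} (hε : 0 < ε) (R : ℝ) : Integrable (trunc ε R heat2) := by
  refine integrable_trunc (C := 134 / √ε) hε measurable_heat2 fun s hs y => ?_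
  have h0 : 0 < s := hε.trans hs.1
  refine (abs_heat2_le' h0 y).trans ?_
  have := hs.1.le
  have := Real.sqrt_pos.2 hε
  gcongr

lemma corr_trunc {ε R : ℝ} (hεR : ε ≤ R) {k : ℝ → ℝ → ℝ} (hk : Integrable (trunc ε R k))
    {f : ℝ × ℝ → ℝ} (hf : IsTest f) (z : ℝ × ℝ) :
    corr (trunc ε R k) f z
      = ∫ s in ε..R, ∫ y, k s y * f (z + s • (1, 0) + y • (0, 1)) := by
  obtain ⟨B, -, hB⟩ := hf.exists_bound
  have hc := hf.continuous
  have hi : Integrable fun w => trunc ε R k w * f (z + w) :=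
    hk.mul_bdd (Continuous.aestronglyMeasurable (by fun_prop))
      (Filter.Eventually.of_forall fun y => hB _)
  unfold corr
  rw [Measure.volume_eq_prod] at hi ⊢
  rw [integral_prod _ hi, intervalIntegral.integral_of_le hεR,
      ← integral_indicator measurableSet_Ioc]
  congr 1
  ext s
  by_cases hs : s ∈ Set.Ioc ε R
  · rw [Set.indicator_of_mem hs]
    congr 1; ext y
    simp [trunc, hs, add_assoc]
  · rw [Set.indicator_of_notMem hs]
    simp [trunc, hs]

lemma lintegral_enorm_heat {s : ℝ} (hs : 0 < s) : ∫⁻ y, ‖heat s y‖ₑ = 1 := by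
  simp_rw [Real.enorm_of_nonneg (heat_nonneg s _)]
  rw [← ofReal_integral_eq_lintegral_ofReal (integrable_heat hs)
    (Filter.Eventually.of_forall (heat_nonneg s)), integral_heat hs, ENNReal.ofReal_one]

lemma measurable_heatAvg (s : ℝ) {f : ℝ × ℝ → ℝ} (hf : Measurable f) (b : ℝ × ℝ) :
    Measurable (heatAvg b s f) := by
  have h := measurable_heat_right s
  have : StronglyMeasurable fun q : (ℝ × ℝ) × ℝ => heat s q.2 * f (q.1 + q.2 • b) :=
    Measurable.stronglyMeasurable (by fun_prop)
  exact this.integral_prod_right.measurable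

lemma eLpNorm_heatAvg_le {p : ℝ} (hp : 1 ≤ p) {s : ℝ} (hs : 0 < s) {f : ℝ × ℝ → ℝ}
    (hf : Measurable f) (a b : ℝ × ℝ) :
    eLpNorm (fun z => heatAvg b s f (z + a)) (ENNReal.ofReal p) volume
      ≤ eLpNorm f (ENNReal.ofReal p) volume := by
  have hm := measurable_heat_right s
  have h1 := eLpNorm_le_mul_iff (μ := (volume : Measure (ℝ × ℝ))) (ν := volume) (p := p)
    (by linarith) (fun z => heatAvg b s f (z + a)) f 1
  rw [one_mul, ENNReal.one_rpow, one_mul] at h1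
  rw [h1]
  calc ∫⁻ z, ‖heatAvg b s f (z + a)‖ₑ ^ p
      ≤ ∫⁻ z, (∫⁻ y, ‖heat s y‖ₑ * ‖f (z + a + y • b)‖ₑ) ^ p := by
        gcongr with z
        refine (enorm_integral_le_lintegral_enorm _).trans_eq ?_
        simp only [enorm_mul]
    _ ≤ ∫⁻ z, ∫⁻ y, ‖heat s y‖ₑ * ‖f (z + a + y • b)‖ₑ ^ p := by
        refine lintegral_mono fun z => ?_
        refine (lintegral_mul_rpow_le _ hp hm.enorm (by fun_prop)).trans ?_
        rw [lintegral_enorm_heat hs, ENNReal.one_rpow, one_mul]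
    _ = ∫⁻ y, ∫⁻ z, ‖heat s y‖ₑ * ‖f (z + a + y • b)‖ₑ ^ p :=
        lintegral_lintegral_swap (by fun_prop)
    _ = ∫⁻ y, ‖heat s y‖ₑ * ∫⁻ z, ‖f z‖ₑ ^ p := by
        refine lintegral_congr fun y => ?_
        rw [lintegral_const_mul _ (by fun_prop)]
        congr 1
        simp_rw [add_assoc]
        exact lintegral_add_right_eq_self (fun z => ‖f z‖ₑ ^ p) (a + y • b)
    _ = _ := by
        rw [lintegral_mul_const _ hm.enorm, lintegral_enorm_heat hs, one_mul]

lemma IsTest.memLp {f : ℝ × ℝ → ℝ} (hf : IsTest f) (p : ℝ≥0∞) : MemLp f p volume :=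
  hf.continuous.memLp_of_hasCompactSupport hf.hasCompactSupport

lemma memLp_corr {p : ℝ} (hp : 1 ≤ p) {K f : ℝ × ℝ → ℝ} (hK : Measurable K) (hKi : Integrable K)
    (hf : Measurable f) (hfp : MemLp f (ENNReal.ofReal p) volume) :
    MemLp (corr K f) (ENNReal.ofReal p) volume :=
  ⟨(measurable_corr hK hf).aestronglyMeasurable,
    (eLpNorm_corr_le hp hK hf).trans_lt (ENNReal.mul_lt_top hKi.2 hfp.2)⟩

/-- Correlations with a common kernel are orthogonal when the cross-correlation of the functions is
antisymmetric. -/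
lemma integral_corr_mul_corr_eq_zero {H g h : ℝ × ℝ → ℝ} (hH : Measurable H) (hHi : Integrable H)
    (hg : IsTest g) (hh : IsTest h)
    (hanti : ∀ w₁ w₂, ∫ z, g (z + w₁) * h (z + w₂) = -∫ z, g (z + w₂) * h (z + w₁)) :
    ∫ z, corr H g z * corr H h z = 0 := by
  obtain ⟨B, hB0, hB⟩ := hg.exists_bound
  have hgc := hg.continuous
  have hhc := hh.continuous
  have hgm := hgc.measurable
  have hhm := hhc.measurable
  have hhi : Integrable h := hhc.integrable_of_hasCompactSupport hh.hasCompactSupport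
  have hHH : Integrable (fun q : (ℝ × ℝ) × (ℝ × ℝ) => H q.1 * H q.2) := hHi.mul_prod hHi
  let F : (ℝ × ℝ) → (ℝ × ℝ) × (ℝ × ℝ) → ℝ := fun z q =>
    (H q.1 * g (z + q.1)) * (H q.2 * h (z + q.2))
  have hFm : Measurable (Function.uncurry F) := by
    change Measurable fun x : (ℝ × ℝ) × (ℝ × ℝ) × (ℝ × ℝ) => F x.1 x.2
    fun_prop
  have hle : ∀ q z, ‖F z q‖ ≤ |H q.1 * H q.2| * B * ‖h (z + q.2)‖ := by
    intro q z
    have := hB (z + q.1)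
    simp only [F, Real.norm_eq_abs, abs_mul]
    calc |H q.1| * |g (z + q.1)| * (|H q.2| * |h (z + q.2)|)
        ≤ |H q.1| * B * (|H q.2| * |h (z + q.2)|) := by gcongr
      _ = _ := by ring
  have hFi : Integrable (Function.uncurry F) (volume.prod volume) := by
    rw [integrable_prod_iff' hFm.aestronglyMeasurable]
    have hq : ∀ q, Integrable (fun z => F z q) := fun q =>
      ((hhi.comp_add_right q.2).norm.const_mul (|H q.1 * H q.2| * B)).mono'
        (by fun_prop) (Filter.Eventually.of_forall fun z => hle q z)
    refine ⟨Filter.Eventually.of_forall hq, ?_⟩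
    refine (hHH.abs.mul_const (B * ∫ z, ‖h z‖)).mono' ?_ (Filter.Eventually.of_forall fun q => ?_)
    · exact (hFm.norm.stronglyMeasurable.integral_prod_left'
        (f := fun x : (ℝ × ℝ) × (ℝ × ℝ) × (ℝ × ℝ) => ‖F x.1 x.2‖)).aestronglyMeasurable
    · rw [Real.norm_of_nonneg (integral_nonneg fun z => norm_nonneg _)]
      calc ∫ z, ‖F z q‖ ≤ ∫ z, |H q.1 * H q.2| * B * ‖h (z + q.2)‖ :=
            integral_mono (hq q).norm ((hhi.comp_add_right q.2).norm.const_mul _) (hle q)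
        _ = |H q.1 * H q.2| * (B * ∫ z, ‖h z‖) := by
            rw [integral_const_mul, integral_add_right_eq_self (fun z => ‖h z‖), mul_assoc]
  have h1 : ∫ z, corr H g z * corr H h z = ∫ q, ∫ z, F z q := by
    rw [← integral_integral_swap hFi]
    congr 1; ext z
    exact (integral_prod_mul (fun w => H w * g (z + w)) (fun w => H w * h (z + w))).symm
  have h2 : ∫ q, ∫ z, F z q = ∫ q : (ℝ × ℝ) × (ℝ × ℝ), ∫ z, F z q.swap :=
    (integral_prod_swap (μ := (volume : Measure (ℝ × ℝ))) (ν := (volume : Measure (ℝ × ℝ)))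
      (fun q => ∫ z, F z q)).symm
  have h3 : ∫ q : (ℝ × ℝ) × (ℝ × ℝ), ∫ z, F z q.swap = -∫ q, ∫ z, F z q := by
    rw [← integral_neg]
    congr 1; ext q
    have e : ∀ q z, F z q = (H q.1 * H q.2) * (g (z + q.1) * h (z + q.2)) := by
      intro q z; simp only [F]; ring
    simp_rw [e, integral_const_mul, hanti q.1 q.2]
    simp only [Prod.fst_swap, Prod.snd_swap]
    ring
  linarith

lemma lintegral_enorm_rpow_two {α : Type*} [MeasurableSpace α] {μ : Measure α} {f : α → ℝ}
    (hf : MemLp f 2 μ) :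
    ∫⁻ a, ‖f a‖ₑ ^ (2 : ℝ) ∂μ = ENNReal.ofReal (∫ a, f a ^ 2 ∂μ) := by
  rw [ofReal_integral_eq_lintegral_ofReal hf.integrable_sq
    (Filter.Eventually.of_forall fun a => sq_nonneg _)]
  refine lintegral_congr fun a => ?_
  rw [← ofReal_norm, ENNReal.ofReal_rpow_of_nonneg (norm_nonneg _) (by norm_num)]
  congr 1
  rw [Real.rpow_two, Real.norm_eq_abs, sq_abs]

lemma integral_mul_D_comp_add {g h : ℝ × ℝ → ℝ} (hg : IsTest g) (hh : IsTest h) (e w₁ w₂ : ℝ × ℝ) :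
    ∫ z, g (z + w₁) * D e h (z + w₂) = -∫ z, D e g (z + w₁) * h (z + w₂) := by
  have key := integral_mul_fderiv_eq_neg_fderiv_mul_of_integrable (μ := (volume : Measure (ℝ × ℝ)))
    (f := fun z => g (z + w₁)) (g := fun z => h (z + w₂)) (v := e)
  have hgw := hg.comp_add w₁
  have hhw := hh.comp_add w₂
  have e1 : ∀ z, fderiv ℝ (fun z => g (z + w₁)) z e = D e g (z + w₁) := by
    intro z; simp [D, fderiv_comp_add_right]
  have e2 : ∀ z, fderiv ℝ (fun z => h (z + w₂)) z e = D e h (z + w₂) := by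
    intro z; simp [D, fderiv_comp_add_right]
  have c1 := hgw.continuous
  have c2 := hhw.continuous
  have c3 := ((hg.D e).comp_add w₁).continuous
  have c4 := ((hh.D e).comp_add w₂).continuous
  simp_rw [e1, e2] at key
  refine key ?_ ?_ ?_ (fun z _ => hgw.differentiable z) (fun z _ => hhw.differentiable z)
  · exact (c3.mul c2).integrable_of_hasCompactSupport hhw.hasCompactSupport.mul_left
  · exact (c1.mul c4).integrable_of_hasCompactSupport hgw.hasCompactSupport.mul_right
  · exact (c1.mul c2).integrable_of_hasCompactSupport hgw.hasCompactSupport.mul_right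

lemma eLpNorm_corr_heat2_two_le {ε R : ℝ} (hε : 0 < ε) (hεR : ε ≤ R) {f : ℝ × ℝ → ℝ}
    (hf : IsTest f) :
    eLpNorm (corr (trunc ε R heat2) f) (ENNReal.ofReal 2) volume
      ≤ 2 * eLpNorm f (ENNReal.ofReal 2) volume := by
  set a : ℝ × ℝ := (1, 0)
  set b : ℝ × ℝ := (0, 1)
  have hH := measurable_trunc ε R measurable_heat
  have hHi := integrable_trunc_heat hε R
  have hK := measurable_trunc ε R measurable_heat2
  have hKi := integrable_trunc_heat2 hε R
  have hft := hf.D a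
  have hfx := (hf.D b)
  have hfxx := hfx.D b
  set T := corr (trunc ε R heat2) f
  set U := corr (trunc ε R heat) (D a f)
  set G : ℝ × ℝ → ℝ := fun z => heatAvg b R f (z + R • a) - heatAvg b ε f (z + ε • a) with hG
  have hpos : ∀ s ∈ Set.uIcc ε R, 0 < s := by
    intro s h
    rw [Set.uIcc_of_le hεR] at h
    exact hε.trans_le h.1
  have hT : T = corr (trunc ε R heat) (D b (D b f)) := by
    ext z
    simp only [T]
    rw [corr_trunc hεR hKi hf, corr_trunc hεR hHi hfxx]
    exact intervalIntegral.integral_congr fun s hs => integral_heat2_mul (hpos s hs) b hf _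
  have hTU : ∀ z, T z + U z = G z := by
    intro z
    simp only [hG, hT, U]
    rw [heatAvg_sub_eq hε hεR a b hf, corr_trunc hεR hHi hfxx, corr_trunc hεR hHi hft,
      ← intervalIntegral.integral_add]
    · exact intervalIntegral.integral_congr fun s hs => (heatAvg_add (hpos s hs) b hfxx hft _).symm
    · exact ContinuousOn.intervalIntegrable fun s h =>
        (hasDerivAt_heatAvg (hpos s h) a b hfxx z).continuousAt.continuousWithinAt
    · exact ContinuousOn.intervalIntegrable fun s h =>
        (hasDerivAt_heatAvg (hpos s h) a b hft z).continuousAt.continuousWithinAt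
  have orth : ∫ z, U z * T z = 0 := by
    rw [hT]
    refine integral_corr_mul_corr_eq_zero hH hHi hft hfxx fun w₁ w₂ => ?_
    have i1 := integral_mul_D_comp_add hft hfx b w₁ w₂
    have i2 := integral_mul_D_comp_add (hft.D b) hf b w₁ w₂
    have i3 := integral_mul_D_comp_add (hfxx) hf a w₁ w₂
    have e1 : D b (D b (D a f)) = D a (D b (D b f)) := by
      rw [D_comm hf b a, D_comm hfx b a]
    rw [i1, i2, e1, neg_neg]
    rw [← neg_eq_iff_eq_neg] at i3
    rw [← i3]
    congr 2; ext z; ring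
  have h2 : ENNReal.ofReal 2 = 2 := by simp
  have hT2 : MemLp T 2 volume := by
    rw [← h2]; exact memLp_corr one_le_two hK hKi hf.continuous.measurable (hf.memLp _)
  have hU2 : MemLp U 2 volume := by
    rw [← h2]; exact memLp_corr one_le_two hH hHi hft.continuous.measurable (hft.memLp _)
  have hG2 : MemLp G 2 volume := by
    refine (hT2.add hU2).ae_eq (Filter.Eventually.of_forall fun z => ?_)
    exact hTU z
  have hle : ∫ z, T z ^ 2 ≤ ∫ z, G z ^ 2 := by
    have hi : Integrable fun z => U z * T z := hU2.integrable_mul hT2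
    have : ∫ z, G z ^ 2 = (∫ z, T z ^ 2) + 2 * (∫ z, U z * T z) + ∫ z, U z ^ 2 := by
      rw [← integral_const_mul, ← integral_add hT2.integrable_sq (hi.const_mul 2)]
      rw [← integral_add (f := fun z => T z ^ 2 + 2 * (U z * T z))
        (hT2.integrable_sq.add (hi.const_mul 2)) hU2.integrable_sq]
      congr 1; ext z
      rw [← hTU z]; ring
    rw [this, orth]
    have : 0 ≤ ∫ z, U z ^ 2 := integral_nonneg fun z => sq_nonneg _
    linarith
  have hfm := hf.continuous.measurable
  calc eLpNorm T (ENNReal.ofReal 2) volume ≤ eLpNorm G (ENNReal.ofReal 2) volume := by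
        have := eLpNorm_le_mul_iff (μ := (volume : Measure (ℝ × ℝ))) (ν := volume) (p := 2)
          (by norm_num) T G 1
        rw [one_mul, ENNReal.one_rpow, one_mul] at this
        rw [this, lintegral_enorm_rpow_two hT2, lintegral_enorm_rpow_two hG2]
        exact ENNReal.ofReal_le_ofReal hle
    _ ≤ eLpNorm (fun z => heatAvg b R f (z + R • a)) (ENNReal.ofReal 2) volume
        + eLpNorm (fun z => heatAvg b ε f (z + ε • a)) (ENNReal.ofReal 2) volume :=
        eLpNorm_sub_le ((measurable_heatAvg R hfm b).comp (by fun_prop)).aestronglyMeasurable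
          ((measurable_heatAvg ε hfm b).comp (by fun_prop)).aestronglyMeasurable (by simp)
    _ ≤ _ := by
        rw [two_mul]
        exact add_le_add (eLpNorm_heatAvg_le one_le_two (hε.trans_le hεR) hfm _ _)
          (eLpNorm_heatAvg_le one_le_two hε hfm _ _)

lemma add_sq_shift_le {s y θ : ℝ} (h : θ ^ 2 ≤ s) : s + y ^ 2 ≤ 3 * (s + (y + θ) ^ 2) := by
  nlinarith [sq_nonneg (y + 2 * θ), sq_nonneg (y + θ), sq_nonneg θ]

lemma abs_heat2_sub_space_le {s ℓ y θ : ℝ} (hℓ : 0 < ℓ) (hs : ℓ ^ 2 ≤ s) (hθ : 0 ≤ θ)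
    (hθ' : θ ≤ ℓ) : |heat2 s (y + θ) - heat2 s y| ≤ 183 * ℓ / (s * (s + y ^ 2)) := by
  have hs0 : 0 < s := by nlinarith
  have h := Convex.norm_image_sub_le_of_norm_hasDerivWithin_le (f := heat2 s)
    (f' := fun y => heat s y * (-(y ^ 3 / (8 * s ^ 3)) + 3 * y / (4 * s ^ 2)))
    (s := Set.Icc y (y + θ)) (x := y) (y := y + θ) (C := 183 / (s * (s + y ^ 2)))
    (fun x _ => (hasDerivAt_heat2_space hs0 x).hasDerivWithinAt) ?_ (convex_Icc _ _)
    ⟨le_rfl, by linarith⟩ ⟨by linarith, le_rfl⟩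
  · rw [Real.norm_eq_abs, add_sub_cancel_left, Real.norm_of_nonneg hθ] at h
    refine h.trans ?_
    calc 183 / (s * (s + y ^ 2)) * θ ≤ 183 / (s * (s + y ^ 2)) * ℓ := by gcongr
      _ = _ := by ring
  · intro x hx
    refine (abs_heat2_space_deriv_le hs0 x).trans ?_
    have h1 : (x - y) ^ 2 ≤ s := by nlinarith [hx.1, hx.2]
    have h2 := add_sq_shift_le (y := y) h1
    rw [add_sub_cancel] at h2
    rw [div_le_div_iff₀ (by positivity) (by positivity)]
    nlinarith [mul_le_mul_of_nonneg_left h2 hs0.le]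

lemma abs_heat2_sub_time_le {s ℓ y τ : ℝ} (hℓ : 0 < ℓ) (hs : ℓ ^ 2 ≤ s) (hτ : 0 ≤ τ)
    (hτ' : τ ≤ ℓ ^ 2) : |heat2 (s + τ) y - heat2 s y| ≤ 60 * ℓ / (s * (s + y ^ 2)) := by
  have hs0 : 0 < s := by nlinarith
  have hr := Real.sqrt_pos.2 hs0
  have hle : ℓ ≤ √s := Real.le_sqrt_of_sq_le hs
  have h := Convex.norm_image_sub_le_of_norm_hasDerivWithin_le (f := fun s => heat2 s y)
    (f' := fun s => heat s y * (y ^ 4 / (16 * s ^ 4) - 3 * y ^ 2 / (4 * s ^ 3) + 3 / (4 * s ^ 2)))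
    (s := Set.Icc s (s + τ)) (x := s) (y := s + τ) (C := 60 / (√s * s * (s + y ^ 2)))
    (fun x hx => (hasDerivAt_heat2_time (hs0.trans_le hx.1) y).hasDerivWithinAt) ?_ (convex_Icc _ _)
    ⟨le_rfl, by linarith⟩ ⟨by linarith, le_rfl⟩
  · rw [Real.norm_eq_abs, add_sub_cancel_left, Real.norm_of_nonneg hτ] at h
    refine h.trans ?_
    calc 60 / (√s * s * (s + y ^ 2)) * τ ≤ 60 / (√s * s * (s + y ^ 2)) * (ℓ * √s) := by
          gcongr
          nlinarith
      _ = _ := by field_simp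
  · intro x hx
    have hx0 := hs0.trans_le hx.1
    have hx1 := hx.1
    refine (abs_heat2_time_deriv_le hx0 y).trans ?_
    gcongr

lemma abs_heat2_le_of_far {σ η ℓ y : ℝ} (hℓ : 0 < ℓ) (hσ : 0 < σ) (hσ' : σ ≤ 2 * ℓ ^ 2)
    (hy : 2 * ℓ ≤ |y|) (hη : |y| / 2 ≤ |η|) : |heat2 σ η| ≤ 1005 / (ℓ * (ℓ ^ 2 + y ^ 2)) := by
  have hr : √σ ≤ 3 / 2 * ℓ := Real.sqrt_le_iff.2 ⟨by positivity, by nlinarith⟩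
  have h1 : y ^ 2 ≤ 4 * η ^ 2 := by
    rw [← sq_abs y, ← sq_abs η]
    nlinarith [abs_nonneg y]
  have h2 : 4 * ℓ ^ 2 ≤ y ^ 2 := by rw [← sq_abs y]; nlinarith
  have h3 : ℓ ^ 2 + y ^ 2 ≤ 5 * (σ + η ^ 2) := by nlinarith
  have h4 : ℓ ^ 2 ≤ σ + η ^ 2 := by nlinarith
  have h5 : 0 < σ + η ^ 2 := by positivity
  refine (abs_heat2_le hσ η).trans ?_
  calc 134 * √σ / (σ + η ^ 2) ^ 2 ≤ 134 * (3 / 2 * ℓ) / (σ + η ^ 2) ^ 2 := by gcongr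
    _ ≤ 1005 / (ℓ * (ℓ ^ 2 + y ^ 2)) := by
      rw [div_le_div_iff₀ (by positivity) (by positivity)]
      nlinarith [mul_le_mul h4 h3 (by positivity) h5.le]

/-- A majorant for the oscillation of the truncated kernel away from the diagonal. -/
noncomputable def oscBound (ε R ℓ τ : ℝ) (ζ : ℝ × ℝ) : ℝ :=
  (if ℓ ^ 2 ≤ ζ.1 then 363 * ℓ / (ζ.1 * (ζ.1 + ζ.2 ^ 2)) else 0)
    + (if ζ.1 ∈ Set.Icc (-ℓ ^ 2) (ℓ ^ 2) ∪ (Set.Icc (ε - τ) ε ∪ Set.Icc (R - τ) R)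
      then 2010 / (ℓ * (ℓ ^ 2 + ζ.2 ^ 2)) else 0)

lemma abs_trunc_heat2_sub_le {ε R ℓ τ θ : ℝ} (hε : 0 < ε) (hℓ : 0 < ℓ) (hτ : 0 ≤ τ)
    (hτ' : τ ≤ ℓ ^ 2) (hθ : 0 ≤ θ) (hθ' : θ ≤ ℓ) {ζ : ℝ × ℝ}
    (hζ : ζ ∉ Set.Ico (-ℓ ^ 2) (ℓ ^ 2) ×ˢ Set.Ioo (-(2 * ℓ)) (2 * ℓ)) :
    |trunc ε R heat2 (ζ + (τ, θ)) - trunc ε R heat2 ζ| ≤ oscBound ε R ℓ τ ζ := by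
  obtain ⟨s, y⟩ := ζ
  have n1 : 0 ≤ (if s ∈ Set.Icc (-ℓ ^ 2) (ℓ ^ 2) ∪ (Set.Icc (ε - τ) ε ∪ Set.Icc (R - τ) R)
      then 2010 / (ℓ * (ℓ ^ 2 + y ^ 2)) else 0) := by split_ifs <;> positivity
  simp only [oscBound, trunc, Prod.mk_add_mk]
  rcases le_or_gt (ℓ ^ 2) s with hs | hs
  · have hs0 : 0 < s := by nlinarith
    rw [if_pos hs]
    have hA : 0 ≤ 363 * ℓ / (s * (s + y ^ 2)) := by positivity
    have hle : ℓ ≤ √s := Real.le_sqrt_of_sq_le hs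
    have hr := Real.sqrt_pos.2 hs0
    have hsh := add_sq_shift_le (s := s) (y := y) (θ := θ) (by nlinarith)
    have b1 : |heat2 s y| ≤ 2010 / (ℓ * (ℓ ^ 2 + y ^ 2)) := by
      refine (abs_heat2_le' hs0 y).trans ?_
      rw [div_mul_div_comm, mul_one]
      gcongr
      norm_num
    have b2 : |heat2 (s + τ) (y + θ)| ≤ 2010 / (ℓ * (ℓ ^ 2 + y ^ 2)) := by
      refine (abs_heat2_le' (by linarith) _).trans ?_
      rw [div_mul_div_comm, mul_one]
      have e1 : √s ≤ √(s + τ) := by gcongr; linarith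
      have e2 : 0 < √(s + τ) := hr.trans_le e1
      have e3 : 0 < s + τ + (y + θ) ^ 2 := by positivity
      have e4 : ℓ * (ℓ ^ 2 + y ^ 2) ≤ √(s + τ) * (3 * (s + τ + (y + θ) ^ 2)) := by
        gcongr
        · linarith
        · linarith
      rw [div_le_div_iff₀ (by positivity) (by positivity)]
      nlinarith
    by_cases h1 : s + τ ∈ Set.Ioc ε R <;> by_cases h2 : s ∈ Set.Ioc ε R
    · rw [if_pos h1, if_pos h2]
      have c1 := abs_heat2_sub_space_le (y := y) hℓ hs hθ hθ'
      have c2 := abs_heat2_sub_time_le (y := y + θ) hℓ hs hτ hτ'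
      have c3 : 60 * ℓ / (s * (s + (y + θ) ^ 2)) ≤ 180 * ℓ / (s * (s + y ^ 2)) := by
        rw [div_le_div_iff₀ (by positivity) (by positivity)]
        nlinarith [mul_le_mul_of_nonneg_left hsh (by positivity : 0 ≤ 60 * ℓ * s)]
      have c4 : 183 * ℓ / (s * (s + y ^ 2)) + 180 * ℓ / (s * (s + y ^ 2))
          = 363 * ℓ / (s * (s + y ^ 2)) := by ring
      have c5 := abs_sub_le (heat2 (s + τ) (y + θ)) (heat2 s (y + θ)) (heat2 s y)
      linarith
    · rw [if_pos h1, if_neg h2, sub_zero, if_pos]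
      · linarith
      · right; left
        simp only [Set.mem_Ioc, not_and_or, not_lt, not_le, Set.mem_Icc] at *
        rcases h2 with h2 | h2
        · constructor <;> linarith
        · linarith
    · rw [if_neg h1, if_pos h2, zero_sub, abs_neg, if_pos]
      · linarith
      · right; right
        simp only [Set.mem_Ioc, not_and_or, not_lt, not_le, Set.mem_Icc] at *
        rcases h1 with h1 | h1
        · linarith
        · constructor <;> linarith
    · rw [if_neg h1, if_neg h2, sub_zero, abs_zero]; linarith
  · rw [if_neg (not_le.2 hs), zero_add]
    rcases lt_or_ge s (-ℓ ^ 2) with hs2 | hs2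
    · rw [if_neg (fun h => by linarith [h.1]), if_neg (fun h => by nlinarith [h.1]), sub_zero,
        abs_zero]
      exact n1
    · have hy : 2 * ℓ ≤ |y| := by
        by_contra! hy
        exact hζ ⟨⟨hs2, hs⟩, abs_lt.1 hy⟩
      have hy' : |y| / 2 ≤ |y + θ| := by
        have := abs_sub_abs_le_abs_sub y (-θ)
        rw [abs_neg, abs_of_nonneg hθ, sub_neg_eq_add] at this
        linarith
      rw [if_pos (c := s ∈ Set.Icc (-ℓ ^ 2) (ℓ ^ 2) ∪ (Set.Icc (ε - τ) ε ∪ Set.Icc (R - τ) R))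
        (Or.inl ⟨hs2, hs.le⟩)]
      have b1 : |if s + τ ∈ Set.Ioc ε R then heat2 (s + τ) (y + θ) else 0|
          ≤ 1005 / (ℓ * (ℓ ^ 2 + y ^ 2)) := by
        split_ifs with h
        · exact abs_heat2_le_of_far hℓ (hε.trans h.1) (by linarith) hy hy'
        · rw [abs_zero]; positivity
      have b2 : |if s ∈ Set.Ioc ε R then heat2 s y else 0| ≤ 1005 / (ℓ * (ℓ ^ 2 + y ^ 2)) := by
        split_ifs with h
        · exact abs_heat2_le_of_far hℓ (hε.trans h.1) (by nlinarith) hy (by linarith [abs_nonneg y])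
        · rw [abs_zero]; positivity
      refine (abs_sub _ _).trans ?_
      have : (2010 : ℝ) / (ℓ * (ℓ ^ 2 + y ^ 2))
        = 1005 / (ℓ * (ℓ ^ 2 + y ^ 2)) + 1005 / (ℓ * (ℓ ^ 2 + y ^ 2)) := by ring
      linarith

lemma lintegral_Ici_rpow {ℓ : ℝ} (hℓ : 0 < ℓ) :
    ∫⁻ s in Set.Ici (ℓ ^ 2), ENNReal.ofReal (1 / (s * √s)) = ENNReal.ofReal (2 / ℓ) := by
  have h2 : 0 < ℓ ^ 2 := by positivity
  have e : ∀ s ∈ Set.Ioi (ℓ ^ 2), s ^ (-(3 / 2) : ℝ) = 1 / (s * √s) := by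
    intro s hs
    have hs0 : 0 < s := h2.trans hs
    rw [Real.sqrt_eq_rpow, Real.rpow_neg hs0.le, ← Real.rpow_one_add' hs0.le (by norm_num), one_div]
    norm_num
  have h3 : (-(3 / 2) : ℝ) < -1 := by norm_num
  rw [setLIntegral_congr Ioi_ae_eq_Ici.symm]
  have e' : ∫⁻ s in Set.Ioi (ℓ ^ 2), ENNReal.ofReal (1 / (s * √s))
      = ∫⁻ s in Set.Ioi (ℓ ^ 2), ENNReal.ofReal (s ^ (-(3 / 2) : ℝ)) :=
    setLIntegral_congr_fun measurableSet_Ioi fun s hs => by rw [e s hs]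
  rw [e', ← ofReal_integral_eq_lintegral_ofReal (integrableOn_Ioi_rpow_of_lt h3 h2)
    ((ae_restrict_iff' measurableSet_Ioi).2 (Filter.Eventually.of_forall fun s hs =>
      Real.rpow_nonneg (h2.trans hs).le _)), integral_Ioi_rpow_of_lt h3 h2]
  congr 1
  rw [← Real.rpow_natCast, ← Real.rpow_mul hℓ.le]
  norm_num
  rw [Real.rpow_neg_one]
  ring

lemma lintegral_oscBound_le {ε R ℓ τ : ℝ} (hℓ : 0 < ℓ) (hτ : 0 ≤ τ)
    (hτ' : τ ≤ ℓ ^ 2) :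
    ∫⁻ ζ, ENNReal.ofReal (oscBound ε R ℓ τ ζ) ≤ ENNReal.ofReal (8766 * Real.pi) := by
  set S := Set.Icc (-ℓ ^ 2) (ℓ ^ 2) ∪ (Set.Icc (ε - τ) ε ∪ Set.Icc (R - τ) R)
  have hSm : MeasurableSet S := by measurability
  have hSv : volume S ≤ ENNReal.ofReal (4 * ℓ ^ 2) := by
    refine (measure_union_le _ _).trans ((add_le_add le_rfl (measure_union_le _ _)).trans ?_)
    simp only [Real.volume_Icc]
    rw [← ENNReal.ofReal_add (by linarith) (by linarith),
        ← ENNReal.ofReal_add (by nlinarith) (by linarith)]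
    apply ENNReal.ofReal_le_ofReal
    linarith
  have hpi := Real.pi_pos
  have i1 : ∀ s : ℝ, ∫⁻ y : ℝ, ENNReal.ofReal (if ℓ ^ 2 ≤ s then 363 * ℓ / (s * (s + y ^ 2)) else 0)
      = (Set.Ici (ℓ ^ 2)).indicator (fun s => ENNReal.ofReal (363 * ℓ * Real.pi)
        * ENNReal.ofReal (1 / (s * √s))) s := by
    intro s
    by_cases hs : ℓ ^ 2 ≤ s
    · have hs0 : 0 < s := by nlinarith
      rw [Set.indicator_of_mem (Set.mem_Ici.2 hs)]
      simp only [if_pos hs]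
      have : ∀ y : ℝ, ENNReal.ofReal (363 * ℓ / (s * (s + y ^ 2)))
          = ENNReal.ofReal (363 * ℓ / s) * ENNReal.ofReal (1 / ((√s) ^ 2 + y ^ 2)) := by
        intro y
        rw [← ENNReal.ofReal_mul (by positivity), Real.sq_sqrt hs0.le]
        congr 1
        field_simp
      simp_rw [this]
      rw [lintegral_const_mul _ (by fun_prop), lintegral_one_div_add_sq (Real.sqrt_pos.2 hs0),
        ← ENNReal.ofReal_mul (by positivity), ← ENNReal.ofReal_mul (by positivity)]
      congr 1
      have := Real.sqrt_pos.2 hs0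
      field_simp
    · rw [Set.indicator_of_notMem (fun h => hs (Set.mem_Ici.1 h))]
      simp [if_neg hs]
  have i2 : ∀ s : ℝ, ∫⁻ y : ℝ, ENNReal.ofReal (if s ∈ S then 2010 / (ℓ * (ℓ ^ 2 + y ^ 2)) else 0)
      = S.indicator (fun _ => ENNReal.ofReal (2010 * Real.pi / ℓ ^ 2)) s := by
    intro s
    by_cases hs : s ∈ S
    · rw [Set.indicator_of_mem hs]
      simp only [if_pos hs]
      have : ∀ y : ℝ, ENNReal.ofReal (2010 / (ℓ * (ℓ ^ 2 + y ^ 2)))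
          = ENNReal.ofReal (2010 / ℓ) * ENNReal.ofReal (1 / (ℓ ^ 2 + y ^ 2)) := by
        intro y
        rw [← ENNReal.ofReal_mul (by positivity)]
        congr 1
        field_simp
      simp_rw [this]
      rw [lintegral_const_mul _ (by fun_prop), lintegral_one_div_add_sq hℓ,
        ← ENNReal.ofReal_mul (by positivity)]
      congr 1
      field_simp
    · rw [Set.indicator_of_notMem hs]
      simp [if_neg hs]
  have m1 : Measurable fun ζ : ℝ × ℝ => ENNReal.ofReal
      (if ℓ ^ 2 ≤ ζ.1 then 363 * ℓ / (ζ.1 * (ζ.1 + ζ.2 ^ 2)) else 0) := by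
    refine ENNReal.measurable_ofReal.comp (Measurable.ite ?_ (by fun_prop) measurable_const)
    exact measurable_fst measurableSet_Ici
  have m2 : Measurable fun ζ : ℝ × ℝ => ENNReal.ofReal
      (if ζ.1 ∈ S then 2010 / (ℓ * (ℓ ^ 2 + ζ.2 ^ 2)) else 0) := by
    refine ENNReal.measurable_ofReal.comp (Measurable.ite ?_ (by fun_prop) measurable_const)
    exact measurable_fst hSm
  calc ∫⁻ ζ, ENNReal.ofReal (oscBound ε R ℓ τ ζ)
      ≤ ∫⁻ ζ : ℝ × ℝ, (ENNReal.ofReal (if ℓ ^ 2 ≤ ζ.1 then 363 * ℓ / (ζ.1 * (ζ.1 + ζ.2 ^ 2)) else 0)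
        + ENNReal.ofReal (if ζ.1 ∈ S then 2010 / (ℓ * (ℓ ^ 2 + ζ.2 ^ 2)) else 0)) :=
        lintegral_mono fun ζ => ENNReal.ofReal_add_le
    _ = ENNReal.ofReal (363 * ℓ * Real.pi) * ENNReal.ofReal (2 / ℓ)
        + ENNReal.ofReal (2010 * Real.pi / ℓ ^ 2) * volume S := by
        rw [lintegral_add_left m1, Measure.volume_eq_prod, lintegral_prod _ m1.aemeasurable,
          lintegral_prod _ m2.aemeasurable]
        simp only [i1, i2]
        rw [lintegral_indicator measurableSet_Ici, lintegral_const_mul _ (by fun_prop),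
          lintegral_Ici_rpow hℓ, lintegral_indicator hSm, setLIntegral_const]
    _ ≤ ENNReal.ofReal (363 * ℓ * Real.pi) * ENNReal.ofReal (2 / ℓ)
        + ENNReal.ofReal (2010 * Real.pi / ℓ ^ 2) * ENNReal.ofReal (4 * ℓ ^ 2) := by gcongr
    _ = _ := by
        rw [← ENNReal.ofReal_mul (by positivity), ← ENNReal.ofReal_mul (by positivity),
          ← ENNReal.ofReal_add (by positivity) (by positivity)]
        congr 1
        field_simp
        ring

lemma lintegral_trunc_heat2_sub_le {ε R ℓ τ θ : ℝ} (hε : 0 < ε) (hℓ : 0 < ℓ) (hτ : 0 ≤ τ)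
    (hτ' : τ ≤ ℓ ^ 2) (hθ : 0 ≤ θ) (hθ' : θ ≤ ℓ) :
    ∫⁻ ζ in (Set.Ico (-ℓ ^ 2) (ℓ ^ 2) ×ˢ Set.Ioo (-(2 * ℓ)) (2 * ℓ))ᶜ,
      ‖trunc ε R heat2 (ζ + (τ, θ)) - trunc ε R heat2 ζ‖ₑ ≤ ENNReal.ofReal (8766 * Real.pi) := by
  refine le_trans ?_ (lintegral_oscBound_le (ε := ε) (R := R) hℓ hτ hτ')
  refine le_trans ?_ (setLIntegral_le_lintegral
    (Set.Ico (-ℓ ^ 2) (ℓ ^ 2) ×ˢ Set.Ioo (-(2 * ℓ)) (2 * ℓ))ᶜ _)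
  refine setLIntegral_mono' (measurableSet_Ico.prod measurableSet_Ioo).compl fun ζ hζ => ?_
  rw [← ofReal_norm]
  exact ENNReal.ofReal_le_ofReal (abs_trunc_heat2_sub_le hε hℓ hτ hτ' hθ hθ' hζ)

/-- Side length of the dyadic cells of generation `n`. -/
noncomputable def side (n : ℤ) : ℝ := (2 : ℝ) ^ (-n)

/-- The parabolic dyadic cell `q` of generation `q.1`. -/
def cell (q : ℤ × ℤ × ℤ) : Set (ℝ × ℝ) :=
  Set.Ico (q.2.1 * side q.1 ^ 2) ((q.2.1 + 1) * side q.1 ^ 2)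
    ×ˢ Set.Ico (q.2.2 * side q.1) ((q.2.2 + 1) * side q.1)

/-- The parabolic dyadic cell of generation `n` containing the point `z`. -/
noncomputable def cellAt (n : ℤ) (z : ℝ × ℝ) : ℤ × ℤ × ℤ :=
  (n, ⌊z.1 / side n ^ 2⌋, ⌊z.2 / side n⌋)

lemma side_pos (n : ℤ) : 0 < side n := by unfold side; positivity

lemma side_sub_natCast (n : ℤ) (k : ℕ) : side (n - k) = side n * 2 ^ k := by
  unfold side
  rw [neg_sub, sub_eq_neg_add, zpow_add₀ two_ne_zero, zpow_natCast]

lemma mem_Ico_iff_floor {x s : ℝ} (hs : 0 < s) (k : ℤ) :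
    x ∈ Set.Ico (k * s) ((k + 1) * s) ↔ ⌊x / s⌋ = k := by
  rw [Int.floor_eq_iff, le_div_iff₀ hs, div_lt_iff₀ hs]; rfl

lemma mem_cell_iff {q : ℤ × ℤ × ℤ} {z : ℝ × ℝ} : z ∈ cell q ↔ cellAt q.1 z = q := by
  have h := side_pos q.1
  rw [cell, Set.mem_prod, mem_Ico_iff_floor (by positivity), mem_Ico_iff_floor h]
  obtain ⟨n, i, j⟩ := q
  simp [cellAt]

lemma mem_cell_cellAt (n : ℤ) (z : ℝ × ℝ) : z ∈ cell (cellAt n z) := mem_cell_iff.2 rfl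

lemma measurableSet_cell (q : ℤ × ℤ × ℤ) : MeasurableSet (cell q) :=
  measurableSet_Ico.prod measurableSet_Ico

lemma volume_cell (q : ℤ × ℤ × ℤ) : volume (cell q) = ENNReal.ofReal (side q.1 ^ 3) := by
  have h := side_pos q.1
  rw [cell, Measure.volume_eq_prod, Measure.prod_prod, Real.volume_Ico, Real.volume_Ico,
    ← ENNReal.ofReal_mul (by nlinarith [sq_nonneg (side q.1)])]
  congr 1; ring

lemma cellAt_eq_of_le {m n : ℤ} (hmn : m ≤ n) {z z' : ℝ × ℝ} (h : cellAt n z = cellAt n z') :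
    cellAt m z = cellAt m z' := by
  obtain ⟨k, hk⟩ := Int.le.dest hmn
  obtain rfl : m = n - k := by omega
  have e1 : ∀ x : ℝ, x / side (n - k) ^ 2 = x / side n ^ 2 / ((4 ^ k : ℕ) : ℝ) := by
    intro x
    rw [side_sub_natCast, div_div, mul_pow, ← pow_mul, mul_comm k 2, pow_mul]
    norm_num
  have e2 : ∀ x : ℝ, x / side (n - k) = x / side n / ((2 ^ k : ℕ) : ℝ) := by
    intro x
    rw [side_sub_natCast, div_div]
    norm_num
  simp only [cellAt, Prod.mk.injEq, true_and] at h ⊢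
  simp only [e1, e2, Int.floor_div_natCast, h.1, h.2, and_self]

lemma cell_subset_of_le {m : ℤ} {q : ℤ × ℤ × ℤ} (hm : m ≤ q.1) {z : ℝ × ℝ} (hz : z ∈ cell q) :
    cell q ⊆ cell (cellAt m z) := by
  intro z' hz'
  rw [mem_cell_iff] at hz hz' ⊢
  exact cellAt_eq_of_le hm (hz'.trans hz.symm)

lemma dist_le_side {q : ℤ × ℤ × ℤ} (hq : 0 ≤ q.1) {z z' : ℝ × ℝ} (hz : z ∈ cell q)
    (hz' : z' ∈ cell q) : dist z z' ≤ side q.1 := by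
  have h := side_pos q.1
  have h1 : side q.1 ≤ 1 := by
    unfold side
    exact zpow_le_one_of_nonpos₀ one_le_two (by omega)
  obtain ⟨⟨a1, a2⟩, a3, a4⟩ := hz
  obtain ⟨⟨b1, b2⟩, b3, b4⟩ := hz'
  rw [Prod.dist_eq, Real.dist_eq, Real.dist_eq]
  refine max_le (abs_le.2 ⟨?_, ?_⟩) (abs_le.2 ⟨?_, ?_⟩) <;> nlinarith

/-- Finite Calderón–Zygmund selection of parabolic dyadic cells at height `α`. -/
theorem exists_selected_cells {f : ℝ × ℝ → ℝ} (hf : IsTest f) {α : ℝ} (hα : 0 < α) :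
    ∃ S : Finset (ℤ × ℤ × ℤ),
      (S : Set (ℤ × ℤ × ℤ)).PairwiseDisjoint cell ∧
      (∀ q ∈ S, ∫⁻ z in cell q, ‖f z‖ₑ ≤ ENNReal.ofReal (8 * α) * volume (cell q)) ∧
      (∀ q ∈ S, ENNReal.ofReal α * volume (cell q) ≤ ∫⁻ z in cell q, ‖f z‖ₑ) ∧
      ∀ z, (∀ q ∈ S, z ∉ cell q) → |f z| ≤ 2 * α := by
  have hfi : Integrable f := hf.continuous.integrable_of_hasCompactSupport hf.hasCompactSupport
  have hI : ∫⁻ z, ‖f z‖ₑ ≠ ∞ := hfi.2.ne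
  obtain ⟨L, hL⟩ := (hf.contDiff.of_le (by simp)).lipschitzWith_of_hasCompactSupport (𝕂 := ℝ)
    (n := 1) hf.hasCompactSupport one_ne_zero
  obtain ⟨N, hN⟩ : ∃ N : ℕ, L * side N ≤ α := by
    obtain ⟨N, hN⟩ := exists_pow_lt_of_lt_one (div_pos hα (by positivity : (0 : ℝ) < L + 1))
      (by norm_num : (1 / 2 : ℝ) < 1)
    refine ⟨N, ?_⟩
    have : side N = (1 / 2) ^ N := by simp [side]
    rw [this]
    rw [lt_div_iff₀ (by positivity)] at hN
    have : (0 : ℝ) < (1 / 2) ^ N := by positivity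
    nlinarith
  let Big : ℤ × ℤ × ℤ → Prop := fun q =>
    q.1 ≤ N ∧ ENNReal.ofReal α * volume (cell q) < ∫⁻ z in cell q, ‖f z‖ₑ
  let Sel : Set (ℤ × ℤ × ℤ) := {q | Big q ∧ ∀ m < q.1, ∀ z ∈ cell q, ¬Big (cellAt m z)}
  have hdisj : Sel.PairwiseDisjoint cell := by
    intro q hq q' hq' hne
    rw [Function.onFun, Set.disjoint_left]
    intro z hz hz'
    have e := mem_cell_iff.1 hz
    have e' := mem_cell_iff.1 hz'
    rcases lt_trichotomy q.1 q'.1 with h | h | h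
    · exact hq'.2 _ h z hz' (e ▸ hq.1)
    · exact hne (by rw [← e, ← e', h])
    · exact hq.2 _ h z hz (e' ▸ hq'.1)
  have hbdd : ∃ b : ℤ, ∀ q, Big q → b ≤ q.1 := by
    obtain ⟨k, hk⟩ := exists_nat_gt ((∫⁻ z, ‖f z‖ₑ).toReal / α)
    refine ⟨-k, fun q hq => ?_⟩
    by_contra! hlt
    refine absurd hq.2 (not_lt.2 ?_)
    refine (setLIntegral_le_lintegral _ _).trans ?_
    rw [volume_cell, ← ENNReal.ofReal_mul hα.le, ← ENNReal.ofReal_toReal hI]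
    apply ENNReal.ofReal_le_ofReal
    have h1 : (k : ℝ) ≤ side q.1 := by
      have : side (-k) ≤ side q.1 := by
        unfold side
        exact zpow_le_zpow_right₀ one_le_two (by omega)
      refine le_trans ?_ this
      have h3 : (k : ℝ) < 2 ^ k := by exact_mod_cast Nat.lt_two_pow_self
      simpa [side] using h3.le
    have h0 := side_pos q.1
    have h2 : (1:ℝ) ≤ side q.1 := by
      unfold side
      exact one_le_zpow₀ one_le_two (by omega)
    rw [div_lt_iff₀ hα] at hk
    nlinarith [mul_nonneg (sub_nonneg.2 h2) h0.le,
        mul_nonneg (mul_nonneg (sub_nonneg.2 h2) h0.le) h0.le]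
  have hcover : ∀ n z, Big (cellAt n z) → ∃ q ∈ Sel, z ∈ cell q := by
    intro n z hn
    obtain ⟨b, hb⟩ := hbdd
    obtain ⟨n₀, h0, hmin⟩ := Int.exists_least_of_bdd (P := fun n => Big (cellAt n z))
      ⟨b, fun m hm => hb _ hm⟩ ⟨n, hn⟩
    refine ⟨cellAt n₀ z, ⟨h0, fun m hm z' hz' hbig => ?_⟩, mem_cell_cellAt _ _⟩
    have e : cellAt m z' = cellAt m z := cellAt_eq_of_le (n := n₀) hm.le (mem_cell_iff.1 hz')
    rw [e] at hbig
    exact absurd (hmin m hbig) (not_le.2 hm)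
  have hcount : Countable Sel := inferInstance
  have hfin : Sel.Finite := by
    have hsum : ENNReal.ofReal α * ∑' q : Sel, volume (cell q) ≠ ∞ := by
      refine ne_top_of_le_ne_top hI ?_
      rw [← ENNReal.tsum_mul_left]
      calc ∑' q : Sel, ENNReal.ofReal α * volume (cell q)
          ≤ ∑' q : Sel, ∫⁻ z in cell q, ‖f z‖ₑ := ENNReal.tsum_le_tsum fun q => q.2.1.2.le
        _ = ∫⁻ z in ⋃ q : Sel, cell q, ‖f z‖ₑ := by
            rw [lintegral_iUnion (fun q => measurableSet_cell _)]
            intro q q' hne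
            exact hdisj q.2 q'.2 (fun h => hne (Subtype.ext h))
        _ ≤ _ := setLIntegral_le_lintegral _ _
    have hsum' : ∑' q : Sel, volume (cell q) ≠ ∞ := by
      intro h
      rw [h, ENNReal.mul_top (by simpa using hα)] at hsum
      exact hsum rfl
    have hε : ENNReal.ofReal (side N ^ 3) ≠ 0 := by
      have := side_pos N
      simp only [ne_eq, ENNReal.ofReal_eq_zero, not_le]
      positivity
    have := ENNReal.finite_const_le_of_tsum_ne_top hsum' hε
    have huniv : {q : Sel | ENNReal.ofReal (side N ^ 3) ≤ volume (cell q)} = Set.univ := by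
      refine Set.eq_univ_of_forall fun q => ?_
      simp only [Set.mem_ofPred_eq, volume_cell]
      apply ENNReal.ofReal_le_ofReal
      have h1 : side N ≤ side (q : ℤ × ℤ × ℤ).1 := by
        unfold side
        exact zpow_le_zpow_right₀ one_le_two (by have := q.2.1.1; omega)
      have := side_pos N
      gcongr
    rw [huniv, Set.finite_univ_iff] at this
    exact Set.toFinite Sel
  refine ⟨hfin.toFinset, by simpa using hdisj, fun q hq => ?_, fun q hq => ?_, fun z hz => ?_⟩
  · rw [Set.Finite.mem_toFinset] at hq
    have hs := side_pos q.1
    have hz : ((q.2.1 : ℝ) * side q.1 ^ 2, (q.2.2 : ℝ) * side q.1) ∈ cell q :=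
      ⟨⟨le_rfl, by nlinarith [sq_pos_of_pos hs]⟩, le_rfl, by nlinarith⟩
    have hnot := hq.2 (q.1 - 1) (by omega) _ hz
    have hle : (q.1 - 1 : ℤ) ≤ N := by have := hq.1.1; omega
    have h1 : ∫⁻ z in cell (cellAt (q.1 - 1) ((q.2.1 : ℝ) * side q.1 ^ 2, (q.2.2 : ℝ) * side q.1)),
        ‖f z‖ₑ ≤ ENNReal.ofReal α * volume (cell (cellAt (q.1 - 1)
          ((q.2.1 : ℝ) * side q.1 ^ 2, (q.2.2 : ℝ) * side q.1))) := by
      by_contra! hcon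
      exact hnot ⟨hle, hcon⟩
    refine (lintegral_mono_set (cell_subset_of_le (by omega) hz)).trans (h1.trans_eq ?_)
    rw [volume_cell, volume_cell, ← ENNReal.ofReal_mul hα.le, ← ENNReal.ofReal_mul (by positivity)]
    have := side_sub_natCast q.1 1
    simp only [cellAt]
    push_cast at this
    rw [this]
    congr 1; ring
  · rw [Set.Finite.mem_toFinset] at hq
    exact hq.1.2.le
  · have hnb : ¬Big (cellAt N z) := by
      intro hb
      obtain ⟨q, hq, hzq⟩ := hcover N z hb
      exact hz q (by simpa using hq) hzq
    by_contra! hgt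
    have hle : ∫⁻ z in cell (cellAt N z), ‖f z‖ₑ ≤
        ENNReal.ofReal α * volume (cell (cellAt N z)) := by
      by_contra! hcon
      exact hnb ⟨le_rfl, hcon⟩
    have hlow : ∀ z' ∈ cell (cellAt N z), ENNReal.ofReal (|f z| - α) ≤ ‖f z'‖ₑ := by
      intro z' hz'
      have h1 := hL.dist_le_mul z z'
      have h2 : dist z z' ≤ side N := dist_le_side (by simp [cellAt]) (mem_cell_cellAt N z) hz'
      rw [Real.dist_eq] at h1
      rw [← ofReal_norm]
      apply ENNReal.ofReal_le_ofReal
      have h3 := abs_sub_abs_le_abs_sub (f z) (f z')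
      have h4 : (L : ℝ) * dist z z' ≤ L * side N := by gcongr
      rw [Real.norm_eq_abs]
      linarith
    have hlow' := setLIntegral_mono' (μ := volume) (measurableSet_cell (cellAt N z)) hlow
    rw [setLIntegral_const] at hlow'
    have := hlow'.trans hle
    have hv := side_pos N
    rw [volume_cell, ← ENNReal.ofReal_mul hα.le, ← ENNReal.ofReal_mul (by linarith),
      ENNReal.ofReal_le_ofReal_iff (by positivity)] at this
    have h5 : (0 : ℝ) < side (cellAt N z).1 ^ 3 := by
      simp only [cellAt]; positivity
    have := le_of_mul_le_mul_right this h5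
    linarith

/-- Kernels that are bounded on `L²` and satisfy the parabolic Hörmander condition. -/
structure IsCZKernel (K : ℝ × ℝ → ℝ) (A : ℝ≥0∞) : Prop where
  measurable : Measurable K
  integrable : Integrable K
  eLpNorm_two_le : ∀ f, IsTest f →
    eLpNorm (corr K f) (ENNReal.ofReal 2) volume ≤ 2 * eLpNorm f (ENNReal.ofReal 2) volume
  lintegral_sub_le : ∀ ℓ τ θ : ℝ, 0 < ℓ → 0 ≤ τ → τ ≤ ℓ ^ 2 → 0 ≤ θ → θ ≤ ℓ →
    ∫⁻ ζ in (Set.Ico (-ℓ ^ 2) (ℓ ^ 2) ×ˢ Set.Ioo (-(2 * ℓ)) (2 * ℓ))ᶜ,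
      ‖K (ζ + (τ, θ)) - K ζ‖ₑ ≤ A

/-- The lower left corner of a cell. -/
noncomputable def corner (q : ℤ × ℤ × ℤ) : ℝ × ℝ := (q.2.1 * side q.1 ^ 2, q.2.2 * side q.1)

/-- The complement of this set sees a mean zero function on the cell as small. -/
def bigCell (q : ℤ × ℤ × ℤ) : Set (ℝ × ℝ) :=
  {z | corner q - z ∈ Set.Ico (-side q.1 ^ 2) (side q.1 ^ 2) ×ˢ Set.Ioo (-(2 * side q.1)) (2 * side q.1)}

lemma measurableSet_bigCell (q : ℤ × ℤ × ℤ) : MeasurableSet (bigCell q) := by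
  have h : Measurable fun z : ℝ × ℝ => corner q - z := by fun_prop
  exact h (measurableSet_Ico.prod measurableSet_Ioo)

lemma volume_bigCell (q : ℤ × ℤ × ℤ) : volume (bigCell q) = 8 * volume (cell q) := by
  have h := (Measure.measurePreserving_sub_left (volume : Measure (ℝ × ℝ)) (corner q)).measure_preimage
    (s := Set.Ico (-side q.1 ^ 2) (side q.1 ^ 2) ×ˢ Set.Ioo (-(2 * side q.1)) (2 * side q.1))
    (measurableSet_Ico.prod measurableSet_Ioo).nullMeasurableSet
  have hs := side_pos q.1
  refine h.trans ?_
  rw [Measure.volume_eq_prod, Measure.prod_prod, ← Measure.volume_eq_prod, volume_cell,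
    Real.volume_Ico, Real.volume_Ioo,
    ← ENNReal.ofReal_mul (by nlinarith)]
  rw [show (8 : ℝ≥0∞) = ENNReal.ofReal 8 by simp, ← ENNReal.ofReal_mul (by norm_num)]
  congr 1; ring

lemma integrable_kernel_mul {K h : ℝ × ℝ → ℝ} (hKi : Integrable K) (hh : Measurable h) {B : ℝ}
    (hB : ∀ z, |h z| ≤ B) (z : ℝ × ℝ) : Integrable fun w => K w * h (z + w) :=
  hKi.mul_bdd (c := B) (hh.comp (measurable_const_add z)).aestronglyMeasurable (Filter.Eventually.of_forall fun _ => hB _)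

lemma IsCZKernel.lintegral_corr_compl_le {K : ℝ × ℝ → ℝ} {A : ℝ≥0∞} (hK : IsCZKernel K A)
    (q : ℤ × ℤ × ℤ) {b : ℝ × ℝ → ℝ} (hb : Measurable b) {B : ℝ} (hB : ∀ z, |b z| ≤ B)
    (hbs : ∀ z, z ∉ cell q → b z = 0) (hb0 : ∫ z, b z = 0) (hbi : Integrable b) :
    ∫⁻ z in (bigCell q)ᶜ, ‖corr K b z‖ₑ ≤ A * ∫⁻ z, ‖b z‖ₑ := by
  have hKm := hK.measurable
  have hs := side_pos q.1
  have hpt : ∀ z, ‖corr K b z‖ₑ ≤ ∫⁻ w, ‖K (w - z) - K (corner q - z)‖ₑ * ‖b w‖ₑ := by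
    intro z
    have hi : Integrable fun w => K (w - z) * b w := by
      have := (integrable_kernel_mul hK.integrable hb hB z).comp_sub_right z
      refine this.congr (Filter.Eventually.of_forall fun w => ?_)
      simp
    have e : corr K b z = ∫ w, (K (w - z) - K (corner q - z)) * b w := by
      simp_rw [sub_mul]
      rw [integral_sub hi (hbi.const_mul _), integral_const_mul, hb0, mul_zero, sub_zero]
      rw [← integral_add_left_eq_self _ z]
      simp [corr]
    rw [e]
    refine (enorm_integral_le_lintegral_enorm _).trans_eq ?_
    simp only [enorm_mul]
  calc ∫⁻ z in (bigCell q)ᶜ, ‖corr K b z‖ₑ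
      ≤ ∫⁻ z in (bigCell q)ᶜ, ∫⁻ w, ‖K (w - z) - K (corner q - z)‖ₑ * ‖b w‖ₑ :=
        lintegral_mono hpt
    _ = ∫⁻ w, ∫⁻ z in (bigCell q)ᶜ, ‖K (w - z) - K (corner q - z)‖ₑ * ‖b w‖ₑ := by
        rw [lintegral_lintegral_swap]
        have : Measurable fun x : (ℝ × ℝ) × (ℝ × ℝ) =>
          ‖K (x.2 - x.1) - K (corner q - x.1)‖ₑ * ‖b x.2‖ₑ := by fun_prop
        exact this.aemeasurable
    _ ≤ ∫⁻ w, A * ‖b w‖ₑ := by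
        refine lintegral_mono fun w => ?_
        by_cases hw : w ∈ cell q
        · rw [lintegral_mul_const _ (by fun_prop)]
          gcongr
          have h1 : w - corner q = ((w - corner q).1, (w - corner q).2) := rfl
          simp only [cell, Set.mem_prod, Set.mem_Ico] at hw
          have h2 := hK.lintegral_sub_le (side q.1) (w - corner q).1 (w - corner q).2 hs
            (by simp [corner]; linarith) (by simp [corner]; linarith)
            (by simp [corner]; linarith) (by simp [corner]; linarith)
          refine le_trans (le_of_eq ?_) h2
          rw [← lintegral_indicator (measurableSet_bigCell q).compl,
            ← lintegral_indicator (measurableSet_Ico.prod measurableSet_Ioo).compl,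
            ← lintegral_sub_left_eq_self _ (corner q)]
          refine lintegral_congr fun z => ?_
          simp only [Set.indicator, Set.mem_compl_iff, bigCell, Set.mem_ofPred_eq]
          have h3 : corner q - (corner q - z) = z := by ext <;> simp
          rw [← h1, h3, show w - (corner q - z) = z + (w - corner q) by abel]
        · simp [hbs w hw]
    _ = A * ∫⁻ z, ‖b z‖ₑ := lintegral_const_mul _ (by fun_prop)

lemma volume_cell_ne_top (q : ℤ × ℤ × ℤ) : volume (cell q) ≠ ∞ := by
  rw [volume_cell]; exact ofReal_ne_top

/-- The average over a cell. -/
noncomputable def cellMean (f : ℝ × ℝ → ℝ) (q : ℤ × ℤ × ℤ) : ℝ :=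
  (∫ z in cell q, f z) / side q.1 ^ 3

/-- The mean zero part of `f` on a cell. -/
noncomputable def cellBad (f : ℝ × ℝ → ℝ) (q : ℤ × ℤ × ℤ) : ℝ × ℝ → ℝ :=
  (cell q).indicator fun z => f z - cellMean f q

lemma abs_cellMean_le {f : ℝ × ℝ → ℝ} {q : ℤ × ℤ × ℤ} {α : ℝ} (hα : 0 ≤ α)
    (h : ∫⁻ z in cell q, ‖f z‖ₑ ≤ ENNReal.ofReal α * volume (cell q)) : |cellMean f q| ≤ α := by
  have hs := side_pos q.1
  have h1 := (enorm_integral_le_lintegral_enorm f).trans h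
  rw [volume_cell, ← ENNReal.ofReal_mul hα, ← ofReal_norm,
    ENNReal.ofReal_le_ofReal_iff (by positivity), Real.norm_eq_abs] at h1
  rw [cellMean, abs_div, abs_of_pos (by positivity : 0 < side q.1 ^ 3), div_le_iff₀ (by positivity)]
  exact h1

lemma measurable_cellBad {f : ℝ × ℝ → ℝ} (hf : Measurable f) (q : ℤ × ℤ × ℤ) :
    Measurable (cellBad f q) :=
  (hf.sub_const _).indicator (measurableSet_cell q)

lemma abs_cellBad_le {f : ℝ × ℝ → ℝ} {B : ℝ} (hB : ∀ z, |f z| ≤ B) (q : ℤ × ℤ × ℤ) (z : ℝ × ℝ) :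
    |cellBad f q z| ≤ B + |cellMean f q| := by
  have := (abs_nonneg _).trans (hB z)
  unfold cellBad Set.indicator
  split_ifs
  · exact (abs_sub _ _).trans (by gcongr; exact hB z)
  · simp; positivity

lemma integrable_cellBad {f : ℝ × ℝ → ℝ} (hf : Integrable f) (q : ℤ × ℤ × ℤ) :
    Integrable (cellBad f q) := by
  rw [cellBad, integrable_indicator_iff (measurableSet_cell q)]
  exact hf.integrableOn.sub (integrableOn_const (volume_cell_ne_top q))

lemma integral_cellBad {f : ℝ × ℝ → ℝ} (hf : Integrable f) (q : ℤ × ℤ × ℤ) :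
    ∫ z, cellBad f q z = 0 := by
  have hs := side_pos q.1
  rw [cellBad, integral_indicator (measurableSet_cell q),
    integral_sub hf.integrableOn (integrableOn_const (volume_cell_ne_top q)), setIntegral_const,
    measureReal_def, volume_cell, ENNReal.toReal_ofReal (by positivity), cellMean]
  rw [smul_eq_mul]
  field_simp
  simp

lemma lintegral_cellBad_le (f : ℝ × ℝ → ℝ) (q : ℤ × ℤ × ℤ) :
    ∫⁻ z, ‖cellBad f q z‖ₑ ≤ 2 * ∫⁻ z in cell q, ‖f z‖ₑ := by
  have hs := side_pos q.1
  have h1 : ‖cellMean f q‖ₑ * volume (cell q) ≤ ∫⁻ z in cell q, ‖f z‖ₑ := by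
    refine le_trans (le_of_eq ?_) (enorm_integral_le_lintegral_enorm f)
    rw [volume_cell, ← ofReal_norm, ← ofReal_norm, ← ENNReal.ofReal_mul (norm_nonneg _), cellMean,
      norm_div, Real.norm_of_nonneg (by positivity : 0 ≤ side q.1 ^ 3)]
    congr 1
    field_simp
  calc ∫⁻ z, ‖cellBad f q z‖ₑ = ∫⁻ z in cell q, ‖f z - cellMean f q‖ₑ := by
        rw [← lintegral_indicator (measurableSet_cell q)]
        refine lintegral_congr fun z => ?_
        unfold cellBad Set.indicator
        split_ifs <;> simp
    _ ≤ ∫⁻ z in cell q, (‖f z‖ₑ + ‖cellMean f q‖ₑ) := lintegral_mono fun z => enorm_sub_le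
    _ = (∫⁻ z in cell q, ‖f z‖ₑ) + ‖cellMean f q‖ₑ * volume (cell q) := by
        rw [lintegral_add_right _ measurable_const, setLIntegral_const]
    _ ≤ _ := by rw [two_mul]; gcongr

theorem IsCZKernel.volume_corr_gt_le {K : ℝ × ℝ → ℝ} {A : ℝ≥0∞} (hK : IsCZKernel K A)
    {f : ℝ × ℝ → ℝ} (hf : IsTest f) {α : ℝ} (hα : 0 < α) :
    volume {z | 2 * α < |corr K f z|}
      ≤ ENNReal.ofReal (4 / α ^ 2) * (∫⁻ z in {z | |f z| ≤ 2 * α}, ‖f z‖ₑ ^ (2 : ℝ))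
        + (264 + 16 * A) * (ENNReal.ofReal (2 / α) * ∫⁻ z in {z | α / 2 < |f z|}, ‖f z‖ₑ) := by
  obtain ⟨S, hdisj, hup, hlow, hoff⟩ := exists_selected_cells hf hα
  obtain ⟨Bf, hBf0, hBf⟩ := hf.exists_bound
  have hfm := hf.continuous.measurable
  have hfi : Integrable f := hf.continuous.integrable_of_hasCompactSupport hf.hasCompactSupport
  set V : ℝ≥0∞ := ∑ q ∈ S, volume (cell q) with hV
  set g : ℝ × ℝ → ℝ := fun z => f z - ∑ q ∈ S, cellBad f q z with hg
  have hgm : Measurable g :=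
    hfm.sub (Finset.measurable_sum _ fun q _ => measurable_cellBad hfm q)
  have hmean : ∀ q ∈ S, |cellMean f q| ≤ 8 * α := fun q hq =>
    abs_cellMean_le (by positivity) (hup q hq)
  have hgin : ∀ q ∈ S, ∀ z ∈ cell q, g z = cellMean f q := by
    intro q hq z hz
    have : ∑ q' ∈ S, cellBad f q' z = cellBad f q z := by
      refine Finset.sum_eq_single q (fun q' hq' hne => ?_) (fun h => absurd hq h)
      have hd := hdisj hq' hq hne
      exact Set.indicator_of_notMem (fun h => (Set.disjoint_left.1 hd h hz)) _
    simp only [hg, this]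
    rw [cellBad, Set.indicator_of_mem hz]
    ring
  have hgoff : ∀ z, (∀ q ∈ S, z ∉ cell q) → g z = f z := by
    intro z hz
    have : ∑ q' ∈ S, cellBad f q' z = 0 :=
      Finset.sum_eq_zero fun q hq => Set.indicator_of_notMem (hz q hq) _
    simp only [hg, this, sub_zero]
  have hVle : V ≤ ENNReal.ofReal (2 / α) * ∫⁻ z in {z | α / 2 < |f z|}, ‖f z‖ₑ := by
    have hms : MeasurableSet {z | α / 2 < |f z|} := measurableSet_lt measurable_const (by fun_prop)
    have h1 : ∀ q ∈ S, volume (cell q) ≤ ENNReal.ofReal (2 / α) *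
        ∫⁻ z in cell q, {z | α / 2 < |f z|}.indicator (fun z => ‖f z‖ₑ) z := by
      intro q hq
      set I := ∫⁻ z in cell q, {z | α / 2 < |f z|}.indicator (fun z => ‖f z‖ₑ) z
      have h2 : ∫⁻ z in cell q, ‖f z‖ₑ ≤ I + ENNReal.ofReal (α / 2) * volume (cell q) := by
        rw [← setLIntegral_const, ← lintegral_add_right _ measurable_const]
        refine lintegral_mono fun z => ?_
        by_cases hz : α / 2 < |f z|
        · rw [Set.indicator_of_mem (by exact hz)]; exact le_self_add
        · rw [Set.indicator_of_notMem (by exact hz), zero_add, ← ofReal_norm]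
          exact ENNReal.ofReal_le_ofReal (not_lt.1 hz)
      have h3 := (hlow q hq).trans h2
      have h4 : ENNReal.ofReal α * volume (cell q) = ENNReal.ofReal (α / 2) * volume (cell q)
          + ENNReal.ofReal (α / 2) * volume (cell q) := by
        rw [← add_mul, ← ENNReal.ofReal_add (by positivity) (by positivity), add_halves]
      rw [h4] at h3
      have h5 := (ENNReal.add_le_add_iff_right
        (ENNReal.mul_ne_top ofReal_ne_top (volume_cell_ne_top q))).1 h3
      calc volume (cell q) = ENNReal.ofReal (2 / α) * (ENNReal.ofReal (α / 2) * volume (cell q)) := by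
            rw [← mul_assoc, ← ENNReal.ofReal_mul (by positivity),
              show 2 / α * (α / 2) = 1 by field_simp, ENNReal.ofReal_one, one_mul]
        _ ≤ _ := by gcongr
    calc V ≤ ∑ q ∈ S, ENNReal.ofReal (2 / α) *
          ∫⁻ z in cell q, {z | α / 2 < |f z|}.indicator (fun z => ‖f z‖ₑ) z := Finset.sum_le_sum h1
      _ = ENNReal.ofReal (2 / α) * ∫⁻ z in ⋃ q ∈ S, cell q,
          {z | α / 2 < |f z|}.indicator (fun z => ‖f z‖ₑ) z := by
          rw [lintegral_biUnion_finset hdisj (fun q _ => measurableSet_cell q), Finset.mul_sum]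
      _ ≤ _ := by
          rw [← lintegral_indicator hms]
          gcongr
          exact Measure.restrict_le_self
  have hgsq : ∫⁻ z, ‖g z‖ₑ ^ (2 : ℝ) ≤
      (∫⁻ z in {z | |f z| ≤ 2 * α}, ‖f z‖ₑ ^ (2 : ℝ)) + ENNReal.ofReal (64 * α ^ 2) * V := by
    have hms : MeasurableSet {z | |f z| ≤ 2 * α} := measurableSet_le (by fun_prop) measurable_const
    have h1 : ENNReal.ofReal (64 * α ^ 2) * V =
        ∫⁻ z, ∑ q ∈ S, (cell q).indicator (fun _ => ENNReal.ofReal (64 * α ^ 2)) z := by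
      rw [lintegral_finsetSum _ fun q _ => measurable_const.indicator (measurableSet_cell q), hV,
        Finset.mul_sum]
      refine Finset.sum_congr rfl fun q _ => ?_
      rw [lintegral_indicator (measurableSet_cell q), setLIntegral_const]
    rw [h1, ← lintegral_indicator hms, ← lintegral_add_left]
    · refine lintegral_mono fun z => ?_
      by_cases hz : ∀ q ∈ S, z ∉ cell q
      · rw [hgoff z hz, Set.indicator_of_mem (by exact hoff z hz)]
        exact le_self_add
      · push Not at hz
        obtain ⟨q, hq, hzq⟩ := hz
        rw [hgin q hq z hzq]
        refine le_trans ?_ le_add_self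
        refine le_trans ?_ (Finset.single_le_sum (f := fun q =>
          (cell q).indicator (fun _ => ENNReal.ofReal (64 * α ^ 2)) z) (fun _ _ => zero_le) hq)
        simp only [Set.indicator_of_mem hzq]
        rw [← ofReal_norm, Real.norm_eq_abs,
            ENNReal.ofReal_rpow_of_nonneg (abs_nonneg _) (by norm_num)]
        apply ENNReal.ofReal_le_ofReal
        rw [Real.rpow_two]
        nlinarith [hmean q hq, abs_nonneg (cellMean f q)]
    · exact (hfm.enorm.pow_const _).indicator hms
  have hgood : volume {z | α < |corr K g z|} ≤
      ENNReal.ofReal (4 / α ^ 2) * (∫⁻ z in {z | |f z| ≤ 2 * α}, ‖f z‖ₑ ^ (2 : ℝ)) + 256 * V := by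
    have h1 := eLpNorm_corr_le_of_dense one_le_two hK.measurable hK.integrable 2 two_ne_zero
      ofNat_ne_top (fun h hh hh' => hK.eLpNorm_two_le h ⟨hh, hh'⟩) hgm
    rw [eLpNorm_le_mul_iff two_pos] at h1
    have h2 := mul_meas_ge_le_lintegral (μ := volume)
      ((measurable_corr hK.measurable hgm).enorm.pow_const (2 : ℝ)) (ENNReal.ofReal (α ^ 2))
    have h3 : volume {z | α < |corr K g z|} ≤
        volume {z | ENNReal.ofReal (α ^ 2) ≤ ‖corr K g z‖ₑ ^ (2 : ℝ)} := by
      refine measure_mono fun z hz => ?_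
      simp only [Set.mem_ofPred_eq] at hz ⊢
      rw [← ofReal_norm, Real.norm_eq_abs,
          ENNReal.ofReal_rpow_of_nonneg (abs_nonneg _) (by norm_num)]
      apply ENNReal.ofReal_le_ofReal
      rw [Real.rpow_two]
      nlinarith
    have h4 : (2 : ℝ≥0∞) ^ (2 : ℝ) = ENNReal.ofReal 4 := by
      rw [ENNReal.rpow_two, ENNReal.ofReal_ofNat]; norm_num
    calc volume {z | α < |corr K g z|}
        = ENNReal.ofReal (1 / α ^ 2) * (ENNReal.ofReal (α ^ 2) * volume {z | α < |corr K g z|}) := by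
          rw [← mul_assoc, ← ENNReal.ofReal_mul (by positivity),
            show 1 / α ^ 2 * α ^ 2 = 1 by field_simp, ENNReal.ofReal_one, one_mul]
      _ ≤ ENNReal.ofReal (1 / α ^ 2) * (ENNReal.ofReal 4 *
            ((∫⁻ z in {z | |f z| ≤ 2 * α}, ‖f z‖ₑ ^ (2 : ℝ)) +
                ENNReal.ofReal (64 * α ^ 2) * V)) := by
          rw [← h4]
          exact mul_le_mul_right ((mul_le_mul_right h3 _).trans
            (h2.trans (h1.trans (mul_le_mul_right hgsq _)))) _
      _ = _ := by
          rw [← mul_assoc, ← ENNReal.ofReal_mul (by positivity), mul_add, ← mul_assoc,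
            ← ENNReal.ofReal_mul (by positivity),
            show 1 / α ^ 2 * 4 * (64 * α ^ 2) = 256 by field_simp; norm_num,
            show 1 / α ^ 2 * 4 = 4 / α ^ 2 by ring, ENNReal.ofReal_ofNat]
  have hbad : volume {z | α < |∑ q ∈ S, corr K (cellBad f q) z|} ≤ (8 + 16 * A) * V := by
    set U : Set (ℝ × ℝ) := ⋃ q ∈ S, bigCell q
    have hUm : MeasurableSet U := Finset.measurableSet_biUnion S fun q _ => measurableSet_bigCell q
    have hU : volume U ≤ 8 * V := by
      refine (measure_biUnion_finset_le S _).trans ?_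
      rw [hV, Finset.mul_sum]
      exact Finset.sum_le_sum fun q _ => (volume_bigCell q).le
    have hcm : ∀ q, Measurable fun z => ‖corr K (cellBad f q) z‖ₑ := fun q =>
      (measurable_corr hK.measurable (measurable_cellBad hfm q)).enorm
    have h1 : ∫⁻ z in Uᶜ, ‖∑ q ∈ S, corr K (cellBad f q) z‖ₑ ≤ ENNReal.ofReal (16 * α) * A * V := by
      calc ∫⁻ z in Uᶜ, ‖∑ q ∈ S, corr K (cellBad f q) z‖ₑ
          ≤ ∫⁻ z in Uᶜ, ∑ q ∈ S, ‖corr K (cellBad f q) z‖ₑ :=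
            lintegral_mono fun z => enorm_sum_le _ _
        _ = ∑ q ∈ S, ∫⁻ z in Uᶜ, ‖corr K (cellBad f q) z‖ₑ :=
            lintegral_finsetSum _ fun q _ => hcm q
        _ ≤ ∑ q ∈ S, ENNReal.ofReal (16 * α) * A * volume (cell q) := by
            refine Finset.sum_le_sum fun q hq => ?_
            calc ∫⁻ z in Uᶜ, ‖corr K (cellBad f q) z‖ₑ
                ≤ ∫⁻ z in (bigCell q)ᶜ, ‖corr K (cellBad f q) z‖ₑ := by
                  refine lintegral_mono_set (Set.compl_subset_compl.2 ?_)
                  exact Set.subset_biUnion_of_mem (u := bigCell) hq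
              _ ≤ A * ∫⁻ z, ‖cellBad f q z‖ₑ :=
                  hK.lintegral_corr_compl_le q (measurable_cellBad hfm q) (abs_cellBad_le hBf q)
                    (fun z hz => Set.indicator_of_notMem hz _) (integral_cellBad hfi q)
                    (integrable_cellBad hfi q)
              _ ≤ A * (2 * (ENNReal.ofReal (8 * α) * volume (cell q))) := by
                  gcongr
                  exact (lintegral_cellBad_le f q).trans (by gcongr; exact hup q hq)
              _ = _ := by
                  rw [show 16 * α = 2 * (8 * α) by ring, ENNReal.ofReal_mul two_pos.le,
                    ENNReal.ofReal_ofNat]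
                  ring
        _ = _ := by rw [hV, Finset.mul_sum]
    have h2 := mul_meas_ge_le_lintegral (μ := volume.restrict Uᶜ)
      (f := fun z => ‖∑ q ∈ S, corr K (cellBad f q) z‖ₑ)
      (Measurable.enorm (Finset.measurable_sum _ fun q _ =>
        measurable_corr hK.measurable (measurable_cellBad hfm q))) (ENNReal.ofReal α)
    have h3 := h2.trans h1
    have h4 : volume.restrict Uᶜ {z | α < |∑ q ∈ S, corr K (cellBad f q) z|} ≤ 16 * A * V := by
      calc volume.restrict Uᶜ {z | α < |∑ q ∈ S, corr K (cellBad f q) z|}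
          ≤ volume.restrict Uᶜ {z | ENNReal.ofReal α ≤ ‖∑ q ∈ S, corr K (cellBad f q) z‖ₑ} := by
            refine measure_mono fun z hz => ?_
            simp only [Set.mem_ofPred_eq] at hz ⊢
            rw [← ofReal_norm]
            exact ENNReal.ofReal_le_ofReal hz.le
        _ = ENNReal.ofReal (1 / α) * (ENNReal.ofReal α * volume.restrict Uᶜ
              {z | ENNReal.ofReal α ≤ ‖∑ q ∈ S, corr K (cellBad f q) z‖ₑ}) := by
            rw [← mul_assoc, ← ENNReal.ofReal_mul (by positivity),
              show 1 / α * α = 1 by field_simp, ENNReal.ofReal_one, one_mul]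
        _ ≤ ENNReal.ofReal (1 / α) * (ENNReal.ofReal (16 * α) * A * V) := by gcongr
        _ = _ := by
            rw [← mul_assoc, ← mul_assoc, ← ENNReal.ofReal_mul (by positivity),
              show 1 / α * (16 * α) = 16 by field_simp, ENNReal.ofReal_ofNat]
    calc volume {z | α < |∑ q ∈ S, corr K (cellBad f q) z|}
        ≤ volume (U ∪ ({z | α < |∑ q ∈ S, corr K (cellBad f q) z|} ∩ Uᶜ)) := by
          refine measure_mono fun z hz => ?_
          by_cases hzU : z ∈ U
          · exact Or.inl hzU
          · exact Or.inr ⟨hz, hzU⟩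
      _ ≤ 8 * V + 16 * A * V := by
          refine (measure_union_le _ _).trans (add_le_add hU ?_)
          rwa [Measure.restrict_apply' hUm.compl] at h4
      _ = _ := by ring
  have hdec : ∀ z, corr K f z = corr K g z + ∑ q ∈ S, corr K (cellBad f q) z := by
    intro z
    have hib : ∀ q ∈ S, Integrable fun w => K w * cellBad f q (z + w) := fun q _ =>
      integrable_kernel_mul hK.integrable (measurable_cellBad hfm q) (abs_cellBad_le hBf q) z
    have hif := integrable_kernel_mul hK.integrable hfm hBf z
    unfold corr
    rw [← integral_finsetSum _ hib, ← integral_add]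
    · refine integral_congr_ae (Filter.Eventually.of_forall fun w => ?_)
      simp only [hg, mul_sub, Finset.mul_sum]
      ring
    · refine (hif.sub (integrable_finsetSum _ hib)).congr (Filter.Eventually.of_forall fun w => ?_)
      simp only [hg, mul_sub, Finset.mul_sum, Pi.sub_apply]
    · exact integrable_finsetSum _ hib
  calc volume {z | 2 * α < |corr K f z|}
      ≤ volume ({z | α < |corr K g z|} ∪ {z | α < |∑ q ∈ S, corr K (cellBad f q) z|}) := by
        refine measure_mono fun z hz => ?_
        simp only [Set.mem_ofPred_eq, Set.mem_union] at hz ⊢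
        by_contra! hcon
        rw [hdec z] at hz
        have := abs_add_le (corr K g z) (∑ q ∈ S, corr K (cellBad f q) z)
        linarith [hcon.1, hcon.2]
    _ ≤ _ := measure_union_le _ _
    _ ≤ _ := add_le_add hgood hbad
    _ = ENNReal.ofReal (4 / α ^ 2) * (∫⁻ z in {z | |f z| ≤ 2 * α}, ‖f z‖ₑ ^ (2 : ℝ))
        + (264 + 16 * A) * V := by ring
    _ ≤ _ := add_le_add le_rfl (mul_le_mul_right hVle _)

lemma lintegral_Ioi_rpow {a s : ℝ} (ha : 0 < a) (hs : s < -1) :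
    ∫⁻ t in Set.Ioi a, ENNReal.ofReal (t ^ s) = ENNReal.ofReal (-a ^ (s + 1) / (s + 1)) := by
  rw [← integral_Ioi_rpow_of_lt hs ha,
    ofReal_integral_eq_lintegral_ofReal (integrableOn_Ioi_rpow_of_lt hs ha)]
  filter_upwards [ae_restrict_mem measurableSet_Ioi] with t ht
  exact Real.rpow_nonneg (ha.le.trans (le_of_lt ht)) _

lemma lintegral_Ioc_rpow {a s : ℝ} (ha : 0 ≤ a) (hs : -1 < s) :
    ∫⁻ t in Set.Ioc 0 a, ENNReal.ofReal (t ^ s) = ENNReal.ofReal (a ^ (s + 1) / (s + 1)) := by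
  have hi := (intervalIntegral.intervalIntegrable_rpow' (a := 0) (b := a) hs).1
  have h0 := integral_rpow (a := 0) (b := a) (Or.inl hs)
  rw [Real.zero_rpow (by linarith), sub_zero, intervalIntegral.integral_of_le ha] at h0
  rw [← h0, ofReal_integral_eq_lintegral_ofReal hi]
  filter_upwards [ae_restrict_mem measurableSet_Ioc] with t ht
  exact Real.rpow_nonneg ht.1.le _

lemma lintegral_high_le {a p : ℝ} (ha : 0 ≤ a) (hp : p < 2) :
    ∫⁻ t in Set.Ioi 0, {t | a ≤ t}.indicator (fun t => ENNReal.ofReal (16 * t ^ (p - 3))) t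
        * ENNReal.ofReal a ^ (2 : ℝ)
      ≤ ENNReal.ofReal (16 / (2 - p)) * ENNReal.ofReal a ^ p := by
  rcases ha.eq_or_lt with rfl | ha
  · simp
  have hm : MeasurableSet {t : ℝ | a ≤ t} := measurableSet_Ici
  rw [lintegral_mul_const _ (Measurable.indicator (by fun_prop) hm)]
  have h1 : ∫⁻ t in Set.Ioi 0, {t | a ≤ t}.indicator (fun t => ENNReal.ofReal (16 * t ^ (p - 3))) t
      ≤ ENNReal.ofReal (16 / (2 - p) * a ^ (p - 2)) := by
    calc _ ≤ ∫⁻ t, {t | a ≤ t}.indicator (fun t => ENNReal.ofReal (16 * t ^ (p - 3))) t :=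
          lintegral_mono' Measure.restrict_le_self le_rfl
      _ = ∫⁻ t in Set.Ioi a, ENNReal.ofReal (16 * t ^ (p - 3)) := by
          rw [lintegral_indicator hm]
          exact setLIntegral_congr Ioi_ae_eq_Ici.symm
      _ = ENNReal.ofReal 16 * ENNReal.ofReal (-a ^ (p - 3 + 1) / (p - 3 + 1)) := by
          rw [← lintegral_Ioi_rpow ha (by linarith), ← lintegral_const_mul _ (by fun_prop)]
          simp only [ENNReal.ofReal_mul (show (0 : ℝ) ≤ 16 by norm_num)]
      _ ≤ _ := by
          rw [← ENNReal.ofReal_mul (by norm_num)]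
          apply ENNReal.ofReal_le_ofReal
          have : 2 - p ≠ 0 := by linarith
          have h3 : p - 3 + 1 ≠ 0 := by linarith
          rw [show p - 3 + 1 = -(2 - p) by ring, neg_div_neg_eq, show -(2 - p) = p - 2 by ring]
          exact le_of_eq (by ring)
  refine (mul_le_mul_left h1 _).trans_eq ?_
  rw [ENNReal.ofReal_rpow_of_pos ha, ENNReal.ofReal_rpow_of_pos ha,
    ← ENNReal.ofReal_mul (by have : 0 < 2 - p := by linarith
                             positivity), ← ENNReal.ofReal_mul (by have : 0 < 2 - p := by linarith
                                                                   positivity),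
    mul_assoc, ← Real.rpow_add ha]
  congr 3; ring

lemma lintegral_low_le {a p : ℝ} (ha : 0 ≤ a) (hp : 1 < p) :
    ∫⁻ t in Set.Ioi 0, {t | t / 4 < a}.indicator (fun t => ENNReal.ofReal (4 * t ^ (p - 2))) t
        * ENNReal.ofReal a
      ≤ ENNReal.ofReal (4 ^ p / (p - 1)) * ENNReal.ofReal a ^ p := by
  rcases ha.eq_or_lt with rfl | ha
  · simp
  have hm : MeasurableSet {t : ℝ | t / 4 < a} := measurableSet_lt (by fun_prop) measurable_const
  rw [lintegral_mul_const _ (Measurable.indicator (by fun_prop) hm)]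
  have h1 : ∫⁻ t in Set.Ioi 0, {t | t / 4 < a}.indicator (fun t =>
      ENNReal.ofReal (4 * t ^ (p - 2))) t
      ≤ ENNReal.ofReal (4 * ((4 * a) ^ (p - 1) / (p - 1))) := by
    calc _ = ∫⁻ t in Set.Ioi 0 ∩ {t | t / 4 < a}, ENNReal.ofReal (4 * t ^ (p - 2)) := by
          rw [lintegral_indicator hm, Measure.restrict_restrict hm, Set.inter_comm]
      _ ≤ ∫⁻ t in Set.Ioc 0 (4 * a), ENNReal.ofReal (4 * t ^ (p - 2)) := by
          refine lintegral_mono_set fun t ht => ⟨ht.1, ?_⟩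
          have : t / 4 < a := ht.2
          linarith
      _ = ENNReal.ofReal 4 * ENNReal.ofReal ((4 * a) ^ (p - 2 + 1) / (p - 2 + 1)) := by
          rw [← lintegral_Ioc_rpow (by positivity) (by linarith),
              ← lintegral_const_mul _ (by fun_prop)]
          simp only [ENNReal.ofReal_mul (show (0 : ℝ) ≤ 4 by norm_num)]
      _ ≤ _ := by
          rw [← ENNReal.ofReal_mul (by norm_num), show p - 2 + 1 = p - 1 by ring]
  refine (mul_le_mul_left h1 _).trans_eq ?_
  have hp1 : 0 < p - 1 := by linarith
  rw [ENNReal.ofReal_rpow_of_pos ha, ← ENNReal.ofReal_mul (by positivity),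
    ← ENNReal.ofReal_mul (by positivity)]
  congr 1
  rw [Real.mul_rpow (by norm_num) ha.le]
  have e1 : (4 : ℝ) ^ p = 4 * 4 ^ (p - 1) := by
    rw [Real.rpow_sub_one (by norm_num)]; ring
  have e2 : a ^ p = a * a ^ (p - 1) := by
    rw [Real.rpow_sub_one ha.ne']; field_simp
  rw [e1, e2]; ring

/-- The `L^p` operator bound produced by the Marcinkiewicz argument, raised to the power `p`. -/
noncomputable def czConst (A : ℝ≥0∞) (p : ℝ) : ℝ≥0∞ :=
  ENNReal.ofReal p * (ENNReal.ofReal (16 / (2 - p)) +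
      (264 + 16 * A) * ENNReal.ofReal (4 ^ p / (p - 1)))

theorem IsCZKernel.lintegral_corr_rpow_le {K : ℝ × ℝ → ℝ} {A : ℝ≥0∞} (hK : IsCZKernel K A)
    {p : ℝ} (hp1 : 1 < p) (hp2 : p < 2) {f : ℝ × ℝ → ℝ} (hf : IsTest f) :
    ∫⁻ z, ‖corr K f z‖ₑ ^ p ≤ czConst A p * ∫⁻ z, ‖f z‖ₑ ^ p := by
  have hp0 : 0 < p := by linarith
  have hfm := hf.continuous.measurable
  have hT := measurable_corr hK.measurable hfm
  have hcake : ∫⁻ z, ‖corr K f z‖ₑ ^ p = ENNReal.ofReal p * ∫⁻ t in Set.Ioi 0,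
      volume {z | t < |corr K f z|} * ENNReal.ofReal (t ^ (p - 1)) := by
    rw [← lintegral_rpow_eq_lintegral_meas_lt_mul volume
      (Filter.Eventually.of_forall fun z => abs_nonneg (corr K f z)) hT.abs.aemeasurable hp0]
    refine lintegral_congr fun z => ?_
    rw [← ofReal_norm, Real.norm_eq_abs, ENNReal.ofReal_rpow_of_nonneg (abs_nonneg _) hp0.le]
  set C : ℝ≥0∞ := 264 + 16 * A
  set F₁ : ℝ → ℝ × ℝ → ℝ≥0∞ := fun t z =>
    {t | |f z| ≤ t}.indicator (fun t => ENNReal.ofReal (16 * t ^ (p - 3))) t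
      * ENNReal.ofReal |f z| ^ (2 : ℝ)
  set F₂ : ℝ → ℝ × ℝ → ℝ≥0∞ := fun t z =>
    {t | t / 4 < |f z|}.indicator (fun t => ENNReal.ofReal (4 * t ^ (p - 2))) t
      * ENNReal.ofReal |f z|
  have hm1 : Measurable (Function.uncurry F₁) := by
    have : MeasurableSet {x : ℝ × ℝ × ℝ | |f x.2| ≤ x.1} :=
        measurableSet_le (by fun_prop) (by fun_prop)
    have h2 : Measurable ({x : ℝ × ℝ × ℝ | |f x.2| ≤ x.1}.indicator
        fun x => ENNReal.ofReal (16 * x.1 ^ (p - 3))) := Measurable.indicator (by fun_prop) this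
    exact h2.mul (by fun_prop)
  have hm2 : Measurable (Function.uncurry F₂) := by
    have : MeasurableSet {x : ℝ × ℝ × ℝ | x.1 / 4 < |f x.2|} :=
      measurableSet_lt (by fun_prop) (by fun_prop)
    have h2 : Measurable ({x : ℝ × ℝ × ℝ | x.1 / 4 < |f x.2|}.indicator
        fun x => ENNReal.ofReal (4 * x.1 ^ (p - 2))) := Measurable.indicator (by fun_prop) this
    exact h2.mul (by fun_prop)
  have hweak : ∀ t ∈ Set.Ioi (0 : ℝ), volume {z | t < |corr K f z|} * ENNReal.ofReal (t ^ (p - 1))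
      ≤ (∫⁻ z, F₁ t z) + C * ∫⁻ z, F₂ t z := by
    intro t ht
    have ht0 : (0 : ℝ) < t := ht
    have h := hK.volume_corr_gt_le hf (half_pos ht0)
    rw [show 2 * (t / 2) = t by ring, show t / 2 / 2 = t / 4 by ring,
      show 4 / (t / 2) ^ 2 = 16 / t ^ 2 by field_simp; norm_num,
      show 2 / (t / 2) = 4 / t by field_simp; norm_num] at h
    refine (mul_le_mul_left h _).trans_eq ?_
    have hs1 : MeasurableSet {z | |f z| ≤ t} := measurableSet_le (by fun_prop) measurable_const
    have hs2 : MeasurableSet {z | t / 4 < |f z|} := measurableSet_lt measurable_const (by fun_prop)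
    have e1 : ∫⁻ z, F₁ t z = ENNReal.ofReal (16 / t ^ 2 * t ^ (p - 1)) *
        ∫⁻ z in {z | |f z| ≤ t}, ‖f z‖ₑ ^ (2 : ℝ) := by
      rw [← lintegral_indicator hs1, ← lintegral_const_mul _ (Measurable.indicator (by fun_prop) hs1)]
      refine lintegral_congr fun z => ?_
      simp only [F₁, Set.indicator, Set.mem_ofPred_eq]
      split_ifs
      · rw [← ofReal_norm, Real.norm_eq_abs]
        congr 2
        rw [show p - 3 = p - 1 - (2 : ℕ) by push_cast; ring, Real.rpow_sub_natCast ht0.ne']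
        ring
      · simp
    have e2 : ∫⁻ z, F₂ t z = ENNReal.ofReal (4 / t * t ^ (p - 1)) *
        ∫⁻ z in {z | t / 4 < |f z|}, ‖f z‖ₑ := by
      rw [← lintegral_indicator hs2, ← lintegral_const_mul _ (Measurable.indicator (by fun_prop) hs2)]
      refine lintegral_congr fun z => ?_
      simp only [F₂, Set.indicator, Set.mem_ofPred_eq]
      split_ifs
      · rw [← ofReal_norm, Real.norm_eq_abs]
        congr 2
        rw [show p - 2 = p - 1 - (1 : ℕ) by push_cast; ring, Real.rpow_sub_natCast ht0.ne']
        ring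
      · simp
    rw [e1, e2, ENNReal.ofReal_mul (by positivity), ENNReal.ofReal_mul (by positivity)]
    ring
  rw [hcake, czConst, mul_assoc]
  refine mul_le_mul_right ?_ _
  calc ∫⁻ t in Set.Ioi 0, volume {z | t < |corr K f z|} * ENNReal.ofReal (t ^ (p - 1))
      ≤ ∫⁻ t in Set.Ioi 0, ((∫⁻ z, F₁ t z) + C * ∫⁻ z, F₂ t z) :=
        setLIntegral_mono' measurableSet_Ioi hweak
    _ = (∫⁻ t in Set.Ioi 0, ∫⁻ z, F₁ t z) + C * ∫⁻ t in Set.Ioi 0, ∫⁻ z, F₂ t z := by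
        have h1 : Measurable fun t => ∫⁻ z, F₁ t z := hm1.lintegral_prod_right'
        have h2 : Measurable fun t => ∫⁻ z, F₂ t z := hm2.lintegral_prod_right'
        rw [lintegral_add_left h1, lintegral_const_mul _ h2]
    _ = (∫⁻ z, ∫⁻ t in Set.Ioi 0, F₁ t z) + C * ∫⁻ z, ∫⁻ t in Set.Ioi 0, F₂ t z := by
        rw [lintegral_lintegral_swap hm1.aemeasurable, lintegral_lintegral_swap hm2.aemeasurable]
    _ ≤ (∫⁻ z, ENNReal.ofReal (16 / (2 - p)) * ‖f z‖ₑ ^ p)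
          + C * ∫⁻ z, ENNReal.ofReal (4 ^ p / (p - 1)) * ‖f z‖ₑ ^ p := by
        refine add_le_add (lintegral_mono fun z =>
            ?_) (mul_le_mul_right (lintegral_mono fun z => ?_) _)
        · rw [← ofReal_norm, Real.norm_eq_abs]
          exact lintegral_high_le (abs_nonneg _) hp2
        · rw [← ofReal_norm, Real.norm_eq_abs]
          exact lintegral_low_le (abs_nonneg _) hp1
    _ = _ := by
        rw [lintegral_const_mul _ (by fun_prop), lintegral_const_mul _ (by fun_prop)]
        ring

lemma isCZKernel_trunc_heat2 {ε R : ℝ} (hε : 0 < ε) (hεR : ε ≤ R) :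
    IsCZKernel (trunc ε R heat2) (ENNReal.ofReal (8766 * Real.pi)) where
  measurable := measurable_trunc ε R measurable_heat2
  integrable := integrable_trunc_heat2 hε R
  eLpNorm_two_le _ hf := eLpNorm_corr_heat2_two_le hε hεR hf
  lintegral_sub_le _ _ _ hℓ hτ hτ' hθ hθ' := lintegral_trunc_heat2_sub_le hε hℓ hτ hτ' hθ hθ'

lemma czConst_ne_top {A : ℝ≥0∞} (hA : A ≠ ∞) (p : ℝ) : czConst A p ≠ ∞ := by
  unfold czConst
  finiteness

lemma exists_bound_corr_heat2_of_lt_two {p : ℝ} (hp1 : 1 < p) (hp2 : p < 2) :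
    ∃ C : ℝ, 0 < C ∧ ∀ ε R : ℝ, 0 < ε → ε ≤ R → ∀ f : ℝ × ℝ → ℝ, Measurable f →
      eLpNorm (corr (trunc ε R heat2) f) (ENNReal.ofReal p) volume
        ≤ ENNReal.ofReal C * eLpNorm f (ENNReal.ofReal p) volume := by
  have hp0 : 0 < p := by linarith
  set B := czConst (ENNReal.ofReal (8766 * Real.pi)) p
  have hB : B ≠ ∞ := czConst_ne_top ofReal_ne_top p
  have hB' : B ^ (1 / p) ≠ ∞ := ENNReal.rpow_ne_top_of_nonneg (by positivity) hB
  refine ⟨(B ^ (1 / p)).toReal + 1, by positivity, fun ε R hε hεR f hf => ?_⟩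
  have hK := isCZKernel_trunc_heat2 hε hεR
  refine eLpNorm_corr_le_of_dense hp1.le hK.measurable hK.integrable _
    (by simp; positivity) ofReal_ne_top (fun g hg hg' => ?_) hf
  rw [eLpNorm_le_mul_iff hp0]
  refine (hK.lintegral_corr_rpow_le hp1 hp2 ⟨hg, hg'⟩).trans (mul_le_mul_left ?_ _)
  calc B = (B ^ (1 / p)) ^ p := by
        rw [← ENNReal.rpow_mul, one_div_mul_cancel hp0.ne', ENNReal.rpow_one]
    _ ≤ _ := by
        gcongr
        rw [ENNReal.le_ofReal_iff_toReal_le hB' (by positivity)]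
        linarith

lemma exists_bound_corr_heat2_two :
    ∃ C : ℝ, 0 < C ∧ ∀ ε R : ℝ, 0 < ε → ε ≤ R → ∀ f : ℝ × ℝ → ℝ, Measurable f →
      eLpNorm (corr (trunc ε R heat2) f) (ENNReal.ofReal 2) volume
        ≤ ENNReal.ofReal C * eLpNorm f (ENNReal.ofReal 2) volume := by
  refine ⟨2, two_pos, fun ε R hε hεR f hf => ?_⟩
  have hK := isCZKernel_trunc_heat2 hε hεR
  refine eLpNorm_corr_le_of_dense one_le_two hK.measurable hK.integrable _
    (by simp) ofReal_ne_top (fun g hg hg' => ?_) hf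
  simpa using hK.eLpNorm_two_le g ⟨hg, hg'⟩

lemma integral_corr_mul_eq {p q : ℝ} (hpq : p.HolderConjugate q) {K f g : ℝ × ℝ → ℝ}
    (hK : Measurable K) (hKi : Integrable K) (hf : Measurable f) (hg : Measurable g)
    (hfp : MemLp f (ENNReal.ofReal p) volume) (hgq : MemLp g (ENNReal.ofReal q) volume) :
    ∫ z, corr K f z * g z = ∫ z, f z * corr (fun w => K (-w)) g z := by
  let H : (ℝ × ℝ) × (ℝ × ℝ) → ℝ := fun x => K x.2 * f (x.1 + x.2) * g x.1
  have hHm : Measurable H := by fun_prop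
  have hfin : ∀ {r : ℝ} {h : ℝ × ℝ → ℝ}, 0 < r → MemLp h (ENNReal.ofReal r) volume →
      ∫⁻ z, ‖h z‖ₑ ^ r ≠ ∞ := by
    intro r h hr hh
    have := hh.2.ne
    rw [eLpNorm_eq_rpow _ hr] at this
    intro hcon
    rw [hcon, ENNReal.top_rpow_of_pos (by positivity)] at this
    exact this rfl
  have hHi : Integrable H (volume.prod volume) := by
    refine ⟨hHm.aestronglyMeasurable, ?_⟩
    rw [HasFiniteIntegral, lintegral_prod _ hHm.enorm.aemeasurable]
    have hm : Measurable fun z : ℝ × ℝ => ∫⁻ w, ‖K w‖ₑ * ‖f (z + w)‖ₑ := by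
      have : Measurable fun x : (ℝ × ℝ) × (ℝ × ℝ) => ‖K x.2‖ₑ * ‖f (x.1 + x.2)‖ₑ := by fun_prop
      exact this.lintegral_prod_right'
    have e : ∀ z, ∫⁻ w, ‖H (z, w)‖ₑ = (∫⁻ w, ‖K w‖ₑ * ‖f (z + w)‖ₑ) * ‖g z‖ₑ := by
      intro z
      rw [← lintegral_mul_const _ (by fun_prop)]
      simp only [H, enorm_mul]
    simp_rw [e]
    refine (ENNReal.lintegral_mul_le_Lp_mul_Lq volume hpq hm.aemeasurable
      hg.enorm.aemeasurable).trans_lt ?_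
    refine ENNReal.mul_lt_top ?_ ?_
    · refine ENNReal.rpow_lt_top_of_nonneg (by have := hpq.pos; positivity) ?_
      refine ne_top_of_le_ne_top ?_ (lintegral_abs_corr_rpow_le hpq.lt.le hK hf)
      exact ENNReal.mul_ne_top (ENNReal.rpow_ne_top_of_nonneg hpq.nonneg hKi.2.ne)
        (hfin hpq.pos hfp)
    · exact ENNReal.rpow_lt_top_of_nonneg (by have := hpq.symm.pos; positivity)
        (hfin hpq.symm.pos hgq)
  have hmp := measurePreserving_sub_prod (volume : Measure (ℝ × ℝ)) (volume : Measure (ℝ × ℝ))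
  let G : (ℝ × ℝ) × (ℝ × ℝ) → ℝ := fun x => K x.2 * f x.1 * g (x.1 - x.2)
  have hGH : G = fun x => H (x.1 - x.2, x.2) := by
    ext x; simp only [G, H, sub_add_cancel]
  have hGi : Integrable G (volume.prod volume) := by
    rw [hGH]
    exact hmp.integrable_comp_of_integrable hHi
  calc ∫ z, corr K f z * g z = ∫ z, ∫ w, H (z, w) := by
        refine integral_congr_ae (Filter.Eventually.of_forall fun z => ?_)
        simp only [H, integral_mul_const, corr]
    _ = ∫ w, ∫ z, H (z, w) := integral_integral_swap hHi
    _ = ∫ w, ∫ z, G (z, w) := by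
        refine integral_congr_ae (Filter.Eventually.of_forall fun w => ?_)
        simp only [hGH]
        exact (integral_sub_right_eq_self (fun z => H (z, w)) w).symm
    _ = ∫ z, ∫ w, G (z, w) := (integral_integral_swap hGi).symm
    _ = _ := by
        refine integral_congr_ae (Filter.Eventually.of_forall fun z => ?_)
        simp only [G, corr]
        rw [← integral_const_mul, ← integral_neg_eq_self]
        refine integral_congr_ae (Filter.Eventually.of_forall fun w => ?_)
        simp only [sub_neg_eq_add]
        ring

lemma corr_neg (K g : ℝ × ℝ → ℝ) (z : ℝ × ℝ) :
    corr (fun w => K (-w)) g z = corr K (fun z => g (-z)) (-z) := by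
  unfold corr
  rw [← integral_neg_eq_self]
  refine integral_congr_ae (Filter.Eventually.of_forall fun w => ?_)
  simp [add_comm]

lemma eLpNorm_comp_neg {p : ℝ≥0∞} {h : ℝ × ℝ → ℝ} (hh : Measurable h) :
    eLpNorm (fun z => h (-z)) p volume = eLpNorm h p volume :=
  eLpNorm_comp_measurePreserving (f := fun z : ℝ × ℝ => -z) hh.aestronglyMeasurable
    (Measure.measurePreserving_neg _)

lemma eLpNorm_corr_le_of_conjugate {p q : ℝ} (hpq : p.HolderConjugate q) {K f : ℝ × ℝ → ℝ}
    (hK : Measurable K) (hKi : Integrable K) {C : ℝ≥0∞}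
    (h : ∀ g : ℝ × ℝ → ℝ, Measurable g → eLpNorm (corr K g) (ENNReal.ofReal q) volume
      ≤ C * eLpNorm g (ENNReal.ofReal q) volume)
    (hf : IsTest f) :
    eLpNorm (corr K f) (ENNReal.ofReal p) volume ≤ C * eLpNorm f (ENNReal.ofReal p) volume := by
  have hp0 := hpq.pos
  have hq0 := hpq.symm.pos
  have hfm := hf.continuous.measurable
  set F := corr K f with hF
  have hFm : Measurable F := measurable_corr hK hfm
  have hFp : MemLp F (ENNReal.ofReal p) volume := memLp_corr hpq.lt.le hK hKi hfm (hf.memLp _)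
  set g : ℝ × ℝ → ℝ := fun z => |F z| ^ (p - 2) * F z with hg
  have hgm : Measurable g := by fun_prop
  set N := ∫⁻ z, ‖F z‖ₑ ^ p with hN
  have hFN : eLpNorm F (ENNReal.ofReal p) volume = N ^ (1 / p) := eLpNorm_eq_rpow _ hp0 F
  have hNtop : N ≠ ∞ := by
    have := hFp.2.ne
    rw [hFN] at this
    intro hcon
    rw [hcon, ENNReal.top_rpow_of_pos (by positivity)] at this
    exact this rfl
  have hFg : ∀ z, F z * g z = |F z| ^ p := by
    intro z
    by_cases h0 : F z = 0
    · simp [hg, h0, Real.zero_rpow hp0.ne']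
    · have h1 : 0 < |F z| := abs_pos.2 h0
      have e : |F z| ^ p = |F z| ^ (p - 2) * |F z| ^ 2 := by
        rw [← Real.rpow_natCast, ← Real.rpow_add h1]; congr 1; push_cast; ring
      rw [e, sq_abs]; simp only [hg]; ring
  have hgF : ∀ z, ‖g z‖ₑ ^ q = ‖F z‖ₑ ^ p := by
    intro z
    rw [← ofReal_norm, ← ofReal_norm, ENNReal.ofReal_rpow_of_nonneg (norm_nonneg _) hq0.le,
      ENNReal.ofReal_rpow_of_nonneg (norm_nonneg _) hp0.le, Real.norm_eq_abs, Real.norm_eq_abs]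
    congr 1
    by_cases h0 : F z = 0
    · simp [hg, h0, Real.zero_rpow hp0.ne', Real.zero_rpow hq0.ne']
    · have h1 : 0 < |F z| := abs_pos.2 h0
      simp only [hg]
      rw [abs_mul, abs_of_pos (Real.rpow_pos_of_pos h1 _)]
      have e : |F z| ^ (p - 2) * |F z| = |F z| ^ (p - 1) := by
        conv_lhs => rw [← Real.rpow_one |F z|, ← Real.rpow_mul (abs_nonneg _), ← Real.rpow_add h1]
        congr 1; ring
      rw [e, ← Real.rpow_mul h1.le]
      congr 1
      exact hpq.sub_one_mul_conj
  have hgN : eLpNorm g (ENNReal.ofReal q) volume = N ^ (1 / q) := by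
    rw [eLpNorm_eq_rpow _ hq0]; simp_rw [hgF]; rfl
  have hgq : MemLp g (ENNReal.ofReal q) volume := by
    refine ⟨hgm.aestronglyMeasurable, ?_⟩
    rw [hgN]
    exact ENNReal.rpow_lt_top_of_nonneg (by positivity) hNtop
  have hdual := integral_corr_mul_eq hpq hK hKi hfm hgm (hf.memLp _) hgq
  set G := corr (fun w => K (-w)) g with hG
  have hGm : Measurable G := measurable_corr (by fun_prop) hgm
  have hGle : eLpNorm G (ENNReal.ofReal q) volume ≤ C * N ^ (1 / q) := by
    have e : G = fun z => corr K (fun z => g (-z)) (-z) := by ext z; exact corr_neg K g z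
    have hgm' : Measurable fun z => g (-z) := by fun_prop
    rw [e, eLpNorm_comp_neg (measurable_corr hK hgm'), ← hgN, ← eLpNorm_comp_neg hgm]
    exact h _ hgm'
  have hNle : N ≤ C * eLpNorm f (ENNReal.ofReal p) volume * N ^ (1 / q) := by
    have e1 : N = ENNReal.ofReal (∫ z, F z * g z) := by
      have hi : Integrable fun z => |F z| ^ p := by
        have := hFp.integrable_norm_rpow (by simpa using hp0) ofReal_ne_top
        simpa only [ENNReal.toReal_ofReal hp0.le, Real.norm_eq_abs] using this
      simp_rw [hFg]
      rw [ofReal_integral_eq_lintegral_ofReal hi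
        (Filter.Eventually.of_forall fun z => by positivity)]
      refine lintegral_congr fun z => ?_
      rw [← ofReal_norm, Real.norm_eq_abs, ENNReal.ofReal_rpow_of_nonneg (abs_nonneg _) hp0.le]
    calc N = ENNReal.ofReal (∫ z, f z * G z) := by rw [e1, hdual]
      _ ≤ ‖∫ z, f z * G z‖ₑ := by
          rw [← ofReal_norm]; exact ENNReal.ofReal_le_ofReal (le_abs_self _)
      _ ≤ ∫⁻ z, ‖f z * G z‖ₑ := enorm_integral_le_lintegral_enorm _
      _ = ∫⁻ z, ((fun z => ‖f z‖ₑ) * fun z => ‖G z‖ₑ) z := by simp only [enorm_mul, Pi.mul_apply]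
      _ ≤ _ := ENNReal.lintegral_mul_le_Lp_mul_Lq volume hpq hfm.enorm.aemeasurable
          hGm.enorm.aemeasurable
      _ = eLpNorm f (ENNReal.ofReal p) volume * eLpNorm G (ENNReal.ofReal q) volume := by
          rw [eLpNorm_eq_rpow _ hp0, eLpNorm_eq_rpow _ hq0]
      _ ≤ eLpNorm f (ENNReal.ofReal p) volume * (C * N ^ (1 / q)) := by gcongr
      _ = _ := by ring
  rw [hFN]
  by_cases hN0 : N = 0
  · rw [hN0, ENNReal.zero_rpow_of_pos (by positivity)]; exact zero_le
  · have hq1 : N ^ (1 / q) ≠ 0 := by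
      simp [ENNReal.rpow_eq_zero_iff, hN0, hNtop]
    have hq2 : N ^ (1 / q) ≠ ∞ := ENNReal.rpow_ne_top_of_nonneg (by positivity) hNtop
    have e : N = N ^ (1 / p) * N ^ (1 / q) := by
      rw [← ENNReal.rpow_add _ _ hN0 hNtop, one_div, one_div, hpq.inv_add_inv_eq_one,
        ENNReal.rpow_one]
    rw [e] at hNle
    refine (ENNReal.mul_le_mul_iff_left hq1 hq2).1 (le_of_eq_of_le ?_ (hNle.trans_eq ?_))
    · rw [← e]
    · rw [← e]

/-- The truncated heat singular integral is bounded on every `L^p`, uniformly in the truncation. -/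
theorem exists_bound_corr_heat2 {p : ℝ} (hp : 1 < p) :
    ∃ C : ℝ, 0 < C ∧ ∀ ε R : ℝ, 0 < ε → ε ≤ R → ∀ f : ℝ × ℝ → ℝ, Measurable f →
      eLpNorm (corr (trunc ε R heat2) f) (ENNReal.ofReal p) volume
        ≤ ENNReal.ofReal C * eLpNorm f (ENNReal.ofReal p) volume := by
  rcases lt_trichotomy p 2 with h | rfl | h
  · exact exists_bound_corr_heat2_of_lt_two hp h
  · exact exists_bound_corr_heat2_two
  · have hpq := Real.HolderConjugate.conjExponent hp
    set q := Real.conjExponent p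
    have hq2 : q < 2 := by
      have h1 := hpq.inv_add_inv_eq_one
      have h2 : p⁻¹ < 2⁻¹ := inv_strictAnti₀ two_pos h
      exact (inv_lt_inv₀ two_pos hpq.symm.pos).1 (by linarith)
    obtain ⟨C, hC, hb⟩ := exists_bound_corr_heat2_of_lt_two hpq.symm.lt hq2
    refine ⟨C, hC, fun ε R hε hεR f hf => ?_⟩
    have hK := isCZKernel_trunc_heat2 hε hεR
    exact eLpNorm_corr_le_of_dense hp.le hK.measurable hK.integrable _ (by simpa using hC)
      ofReal_ne_top (fun g hg hg' => eLpNorm_corr_le_of_conjugate hpq hK.measurable hK.integrable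
        (hb ε R hε hεR) ⟨hg, hg'⟩) hf

lemma lintegral_comp_mul_right {a : ℝ} (ha : a ≠ 0) {H : ℝ → ℝ≥0∞} (hH : Measurable H) :
    ∫⁻ s, H s = ENNReal.ofReal |a| * ∫⁻ r, H (r * a) := by
  conv_lhs => rw [← Real.smul_map_volume_mul_right ha]
  rw [lintegral_smul_measure, lintegral_map hH (by fun_prop), smul_eq_mul]

lemma lintegral_pi_eq_lines {n : ℕ} (i : Fin (n + 1)) {v : Fin (n + 1) → ℝ} (hv : v i ≠ 0)
    {H : (Fin (n + 1) → ℝ) → ℝ≥0∞} (hH : Measurable H) :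
    ∫⁻ x, H x = ENNReal.ofReal |v i| *
      ∫⁻ r : ℝ, ∫⁻ x' : Fin n → ℝ, H (i.insertNth (α := fun _ => ℝ) 0 x' + r • v) := by
  have h1 := (volume_preserving_piFinSuccAbove (fun _ : Fin (n + 1) => ℝ) i).symm.lintegral_comp hH
  rw [← h1, Measure.volume_eq_prod, lintegral_prod _ (by fun_prop)]
  have hm : Measurable fun s : ℝ => ∫⁻ x' : Fin n → ℝ,
      H ((MeasurableEquiv.piFinSuccAbove (fun _ => ℝ) i).symm (s, x')) := by
    have : Measurable fun y : ℝ × (Fin n → ℝ) =>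
      H ((MeasurableEquiv.piFinSuccAbove (fun _ => ℝ) i).symm y) := by fun_prop
    exact this.lintegral_prod_right'
  rw [lintegral_comp_mul_right hv hm]
  congr 1
  refine lintegral_congr fun r => ?_
  rw [← lintegral_add_right_eq_self _ (r • fun j => v (i.succAbove j))]
  refine lintegral_congr fun x' => ?_
  congr 1
  change i.insertNth (α := fun _ => ℝ) (r * v i) (x' + r • fun j => v (i.succAbove j)) = _
  ext j
  refine i.succAboveCases ?_ (fun k => ?_) j
  · simp
  · simp

section Paths
variable {d : ℕ}

lemma lintegral_shear {X : ℝ → Fin d → ℝ} (hX : Measurable X) {H : ℝ × (Fin d → ℝ) → ℝ≥0∞}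
    (hH : Measurable H) : ∫⁻ z : ℝ × (Fin d → ℝ), H (z.1, z.2 + X z.1) = ∫⁻ z, H z := by
  rw [Measure.volume_eq_prod, lintegral_prod _ (by fun_prop), lintegral_prod _ (by fun_prop)]
  refine lintegral_congr fun t => ?_
  exact lintegral_add_right_eq_self (fun x => H (t, x)) (X t)

/-- A planar kernel acting along the direction `v` and a moving frame `X`. -/
noncomputable def pathCorr (K : ℝ × ℝ → ℝ) (v : Fin d → ℝ) (X : ℝ → Fin d → ℝ)
    (F : ℝ × (Fin d → ℝ) → ℝ) (z : ℝ × (Fin d → ℝ)) : ℝ :=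
  ∫ w : ℝ × ℝ, K w * F (z.1 + w.1, z.2 + w.2 • v + (X (z.1 + w.1) - X z.1))

lemma measurable_pathCorr {K : ℝ × ℝ → ℝ} (hK : Measurable K) (v : Fin d → ℝ)
    {X : ℝ → Fin d → ℝ} (hX : Measurable X) {F : ℝ × (Fin d → ℝ) → ℝ} (hF : Measurable F) :
    Measurable (pathCorr K v X F) := by
  have : StronglyMeasurable fun q : (ℝ × (Fin d → ℝ)) × (ℝ × ℝ) =>
      K q.2 * F (q.1.1 + q.2.1, q.1.2 + q.2.2 • v + (X (q.1.1 + q.2.1) - X q.1.1)) :=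
    Measurable.stronglyMeasurable (by fun_prop)
  exact this.integral_prod_right.measurable

lemma lintegral_pathCorr_zero_le {p : ℝ} (hp : 0 < p) {K : ℝ × ℝ → ℝ} (hK : Measurable K) {C : ℝ≥0∞}
    (hC : C ≠ ∞)
    (h : ∀ g : ℝ × ℝ → ℝ, Measurable g → eLpNorm (corr K g) (ENNReal.ofReal p) volume
      ≤ C * eLpNorm g (ENNReal.ofReal p) volume)
    {v : Fin d → ℝ} (hv : v ≠ 0) {F : ℝ × (Fin d → ℝ) → ℝ} (hF : Measurable F) :
    ∫⁻ z, ‖pathCorr K v 0 F z‖ₑ ^ p ≤ C ^ p * ∫⁻ z, ‖F z‖ₑ ^ p := by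
  obtain ⟨i, hi⟩ : ∃ i, v i ≠ 0 := by
    by_contra! hcon; exact hv (funext hcon)
  obtain ⟨n, rfl⟩ : ∃ n, d = n + 1 := ⟨d - 1, by have := i.pos; omega⟩
  have key : ∀ {H : ℝ × (Fin (n + 1) → ℝ) → ℝ≥0∞}, Measurable H → ∫⁻ z, H z = ENNReal.ofReal |v i| *
      ∫⁻ x' : Fin n → ℝ, ∫⁻ y : ℝ × ℝ, H (y.1, i.insertNth (α := fun _ => ℝ) 0 x' + y.2 • v) := by
    intro H hH
    have hins : Measurable fun x' : Fin n → ℝ => i.insertNth (α := fun _ => ℝ) 0 x' := by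
      have := (MeasurableEquiv.piFinSuccAbove (fun _ : Fin (n + 1) => ℝ) i).symm.measurable
      exact this.comp (measurable_const.prodMk measurable_id)
    have hJ : Measurable fun q : (ℝ × ℝ) × (Fin n → ℝ) =>
        H (q.1.1, i.insertNth (α := fun _ => ℝ) 0 q.2 + q.1.2 • v) := by fun_prop
    rw [lintegral_lintegral_swap (f := fun (x' : Fin n → ℝ) (y : ℝ × ℝ) =>
      H (y.1, i.insertNth (α := fun _ => ℝ) 0 x' + y.2 • v)) (by
        exact (hJ.comp measurable_swap).aemeasurable)]
    rw [Measure.volume_eq_prod ℝ ℝ, lintegral_prod _ hJ.lintegral_prod_right'.aemeasurable,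
      Measure.volume_eq_prod, lintegral_prod _ hH.aemeasurable,
      ← lintegral_const_mul _ (Measurable.lintegral_prod_right' (f := fun y : ℝ × ℝ => ∫⁻ x',
        H (y.1, i.insertNth (α := fun _ => ℝ) 0 x' + y.2 • v)) hJ.lintegral_prod_right')]
    refine lintegral_congr fun t => ?_
    exact lintegral_pi_eq_lines i hi (H := fun x => H (t, x)) (by fun_prop)
  rw [key ((measurable_pathCorr hK v (X := 0) measurable_const hF).enorm.pow_const p),
    key (hF.enorm.pow_const p), ← mul_assoc, mul_comm (C ^ p), mul_assoc]
  refine mul_le_mul_right ?_ _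
  rw [← lintegral_const_mul']
  · refine lintegral_mono fun x' => ?_
    have := h (fun y => F (y.1, i.insertNth (α := fun _ => ℝ) 0 x' + y.2 • v)) (by fun_prop)
    rw [eLpNorm_le_mul_iff hp] at this
    refine le_of_eq_of_le ?_ this
    refine lintegral_congr fun y => ?_
    congr 2
    simp only [pathCorr, corr]
    refine integral_congr_ae (Filter.Eventually.of_forall fun w => ?_)
    simp [add_smul, add_assoc]
  · exact ENNReal.rpow_ne_top_of_nonneg hp.le hC

theorem eLpNorm_pathCorr_le {p : ℝ} (hp : 0 < p) {K : ℝ × ℝ → ℝ} (hK : Measurable K) {C : ℝ≥0∞}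
    (hC : C ≠ ∞)
    (h : ∀ g : ℝ × ℝ → ℝ, Measurable g → eLpNorm (corr K g) (ENNReal.ofReal p) volume
      ≤ C * eLpNorm g (ENNReal.ofReal p) volume)
    {v : Fin d → ℝ} (hv : v ≠ 0) {X : ℝ → Fin d → ℝ} (hX : Measurable X)
    {F : ℝ × (Fin d → ℝ) → ℝ} (hF : Measurable F) :
    eLpNorm (pathCorr K v X F) (ENNReal.ofReal p) volume
      ≤ C * eLpNorm F (ENNReal.ofReal p) volume := by
  rw [eLpNorm_le_mul_iff hp]
  have hG : Measurable fun z : ℝ × (Fin d → ℝ) => F (z.1, z.2 + X z.1) := by fun_prop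
  have h1 := lintegral_pathCorr_zero_le hp hK hC h hv hG
  rw [lintegral_shear hX (H := fun z => ‖F z‖ₑ ^ p) (by fun_prop)] at h1
  refine le_of_eq_of_le ?_ h1
  rw [← lintegral_shear hX ((measurable_pathCorr hK v hX hF).enorm.pow_const p)]
  refine lintegral_congr fun z => ?_
  congr 2
  simp only [pathCorr]
  refine integral_congr_ae (Filter.Eventually.of_forall fun w => ?_)
  simp only [Pi.zero_apply, sub_zero, add_zero]
  congr 3
  abel

end Paths

section Chaining
variable {V : Type*} [NormedAddCommGroup V] [MeasurableSpace V] [BorelSpace V]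

lemma intervalIntegrable_of_bounded {g : ℝ → ℝ} (hg : Measurable g) {B : ℝ}
    (hB : ∀ r, |g r| ≤ B) (a b : ℝ) : IntervalIntegrable g volume a b := by
  refine (intervalIntegrable_const (c := B)).mono_fun hg.aestronglyMeasurable ?_
  refine Filter.Eventually.of_forall fun r => ?_
  exact (hB r).trans (le_abs_self B)

lemma abs_expect_le_of_forall {ι : Type*} [Fintype ι] [Nonempty ι] {f : ι → ℝ} {B : ℝ}
    (h : ∀ i, |f i| ≤ B) : |𝔼 i, f i| ≤ B :=
  (Finset.abs_expect_le _ _).trans (Finset.expect_le Finset.univ_nonempty fun i _ => h i)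

lemma integral_along_jump {G : ℝ → ℝ × V → ℝ} (hG : Measurable fun q : ℝ × ℝ × V => G q.1 q.2)
    {H₀ : ℝ} (hGb : ∀ s z, |G s z| ≤ H₀) {X : ℝ → V} (hX : Measurable X) (Y x : V)
    (s₀ t t₁ L : ℝ) (ht : t ≤ t₁) (hL : 0 ≤ L) :
    ∫ r in (0 : ℝ)..(t₁ - t) + L, G (s₀ + r) (t + r, x + if t + r < t₁ then 0 else Y + X (t + r)) =
      (∫ r in (0 : ℝ)..t₁ - t, G (s₀ + r) (t + r, x)) +
        ∫ r in (0 : ℝ)..L, G (s₀ + (t₁ - t) + r) (t₁ + r, (x + Y) + X (t₁ + r)) := by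
  have hX' : Measurable fun τ => if τ < t₁ then (0 : V) else Y + X τ :=
    Measurable.ite measurableSet_Iio measurable_const (hX.const_add Y)
  have hm : Measurable fun r => G (s₀ + r) (t + r, x + if t + r < t₁ then 0 else Y +
      X (t + r)) := by
    have h2 : Measurable fun r => x + if t + r < t₁ then (0 : V) else Y + X (t + r) :=
      (hX'.comp (measurable_const_add t)).const_add x
    exact hG.comp ((measurable_const_add s₀).prodMk ((measurable_const_add t).prodMk h2))
  have hi := fun a b => intervalIntegrable_of_bounded hm (fun r => hGb _ _) a b
  rw [← intervalIntegral.integral_add_adjacent_intervals (hi 0 (t₁ - t)) (hi _ _)]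
  congr 1
  · refine intervalIntegral.integral_congr_ae ?_
    have : ∀ᵐ r : ℝ, r ≠ t₁ - t := by simp [ae_iff]
    filter_upwards [this] with r hr hr'
    rw [Set.uIoc_of_le (by linarith)] at hr'
    have : r < t₁ - t := lt_of_le_of_ne hr'.2 hr
    rw [if_pos (by linarith), add_zero]
  · have := intervalIntegral.integral_comp_add_right (a := 0) (b := L) (fun r => 
      G (s₀ + r) (t + r, x + if t + r < t₁ then 0 else Y + X (t + r))) (t₁ - t)
    rw [zero_add, add_comm L] at this
    rw [← this]
    refine intervalIntegral.integral_congr fun r hr => ?_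
    rw [Set.uIcc_of_le hL] at hr
    have h1 : t + (r + (t₁ - t)) = t₁ + r := by ring
    simp only [h1]
    rw [if_neg (by linarith [hr.1]), ← add_assoc x, show s₀ + (r + (t₁ - t)) = s₀ + (t₁ - t) +
        r by ring]

theorem exists_random_paths {G H : ℝ → ℝ × V → ℝ} {w : ℝ × V → ℝ}
    (hG : Measurable fun q : ℝ × ℝ × V => G q.1 q.2) {H₀ : ℝ} (hGb : ∀ s z, |G s z| ≤ H₀)
    {T h E E' : ℝ} (hh : 0 < h) (hE : 0 ≤ E) (hE' : 0 ≤ E')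
    (hHT : ∀ s x, H s (T, x) = 0) (hwT : ∀ x, w (T, x) = 0)
    (hstep : ∀ t, ∃ (ι : Type) (_ : Fintype ι) (_ : Nonempty ι) (Y : ι → V),
      (∀ s x, 0 < s → |(𝔼 i, H (s + h) (t + h, x + Y i)) - H s (t, x) -
        ∫ r in (0 : ℝ)..h, G (s + r) (t + r, x)| ≤ E) ∧
      (∀ s x i, 0 < s → s ≤ h → |H s (t + h, x + Y i) - w (t + h - s, x)| ≤ E')) (n : ℕ) :
    ∃ (Ω : Type) (_ : Fintype Ω) (_ : Nonempty Ω) (X : Ω → ℝ → V),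
      (∀ ω, Measurable (X ω)) ∧ (∀ ω τ, τ < T - n * h + h → X ω τ = 0) ∧
      (∀ s x, 0 < s → |(𝔼 ω, ∫ r in (0 : ℝ)..n * h,
        G (s + r) (T - n * h + r, x + X ω (T - n * h + r))) + H s (T - n * h, x)| ≤ n * E) ∧
      (∀ t x, T - n * h ≤ t → t ≤ T → |(𝔼 ω, ∫ r in (0 : ℝ)..T - t,
        G r (t + r, x + (X ω (t + r) - X ω t))) + w (t, x)| ≤ n * E + (E' + h * H₀)) := by
  have hH₀ : 0 ≤ H₀ := (abs_nonneg _).trans (hGb 0 0)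
  induction n with
  | zero =>
    refine ⟨Unit, inferInstance, inferInstance, fun _ _ => 0, fun _ => measurable_const,
      fun _ _ _ => rfl, fun s x _ => ?_, fun t x h1 h2 => ?_⟩
    · simp [hHT]
    · have : t = T := by
        simp only [Nat.cast_zero, zero_mul, sub_zero] at h1; linarith
      subst this
      simp only [sub_self, intervalIntegral.integral_same, Finset.expect_const_zero, hwT,
        add_zero, abs_zero, Nat.cast_zero, zero_mul, zero_add]
      positivity
  | succ n ih =>
    obtain ⟨Ω, _, _, X, hX, hX0, hA, hB⟩ := ih
    obtain ⟨ι, _, _, Y, hY1, hY2⟩ := hstep (T - (n + 1 : ℕ) * h)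
    set t₁ : ℝ := T - n * h with ht₁
    set t₀ : ℝ := T - (n + 1 : ℕ) * h with ht₀
    have h01 : t₀ + h = t₁ := by rw [ht₀, ht₁]; push_cast; ring
    rw [h01] at hY1 hY2
    have hnh : 0 ≤ n * h := by positivity
    have key : ∀ s₀ t x, 0 ≤ s₀ → t₀ ≤ t → t < t₁ →
        𝔼 q : ι × Ω, ∫ r in (0 : ℝ)..(t₁ - t) + n * h,
          G (s₀ + r) (t + r, x + if t + r < t₁ then 0 else Y q.1 + X q.2 (t + r)) =
        (∫ r in (0 : ℝ)..t₁ - t, G (s₀ + r) (t + r, x)) +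
          𝔼 i, 𝔼 ω, ∫ r in (0 : ℝ)..n * h,
            G (s₀ + (t₁ - t) + r) (t₁ + r, (x + Y i) + X ω (t₁ + r)) := by
      intro s₀ t x hs h1 h2
      simp_rw [fun q : ι × Ω => integral_along_jump hG hGb (hX q.2) (Y q.1) x s₀ t t₁ (n * h) h2.le hnh]
      rw [Finset.expect_add_distrib, Fintype.expect_const, ← Finset.univ_product_univ,
        Finset.expect_product]
    refine ⟨ι × Ω, inferInstance, inferInstance, fun q τ => if τ < t₁ then 0 else Y q.1 + X q.2 τ,
      fun q => Measurable.ite measurableSet_Iio measurable_const ((hX q.2).const_add _),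
      fun q τ hτ => if_pos (by linarith), fun s x hs => ?_, fun t x h1 h2 => ?_⟩
    · have k := key s t₀ x hs.le le_rfl (by linarith)
      rw [show t₁ - t₀ = h by linarith] at k
      rw [show ((n + 1 : ℕ) : ℝ) * h = h + n * h by push_cast; ring, k]
      have e1 := abs_expect_le_of_forall (fun i => hA (s + h) (x + Y i) (by linarith))
      rw [Finset.expect_add_distrib] at e1
      have e2 := hY1 s x hs
      rw [abs_le] at *
      push_cast
      constructor <;> linarith [e1.1, e1.2, e2.1, e2.2]
    · push_cast
      by_cases hlt : t < t₁
      · have k := key 0 t x le_rfl h1 hlt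
        rw [show t₁ - t + n * h = T - t by rw [ht₁]; ring] at k
        simp only [zero_add] at k
        simp only [if_pos hlt, sub_zero]
        rw [k]
        have e1 := abs_expect_le_of_forall (fun i => hA (t₁ - t) (x + Y i) (by linarith))
        rw [Finset.expect_add_distrib] at e1
        have e2 := abs_expect_le_of_forall
          (fun i => hY2 (t₁ - t) x i (by linarith) (by linarith))
        rw [Finset.expect_sub_distrib, Fintype.expect_const, show t₁ - (t₁ - t) = t by ring] at e2
        have e3 : |∫ r in (0 : ℝ)..t₁ - t, G r (t + r, x)| ≤ h * H₀ := by
          have := intervalIntegral.norm_integral_le_of_norm_le_const (a := 0) (b := t₁ - t)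
            (C := H₀) (f := fun r => G r (t + r, x)) (fun r _ => hGb _ _)
          rw [Real.norm_eq_abs, sub_zero, abs_of_nonneg (show 0 ≤ t₁ - t by linarith)] at this
          refine this.trans ?_
          rw [mul_comm]
          exact mul_le_mul_of_nonneg_right (by linarith) hH₀
        rw [abs_le] at *
        constructor <;> linarith [e1.1, e1.2, e2.1, e2.2, e3.1, e3.2]
      · push Not at hlt
        have k := hB t x hlt h2
        have : 𝔼 q : ι × Ω, ∫ r in (0 : ℝ)..T - t, G r (t + r, x +
            ((if t + r < t₁ then 0 else Y q.1 + X q.2 (t + r)) -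
              if t < t₁ then 0 else Y q.1 + X q.2 t)) =
            𝔼 ω, ∫ r in (0 : ℝ)..T - t, G r (t + r, x + (X ω (t + r) - X ω t)) := by
          rw [← Finset.univ_product_univ, Finset.expect_product]
          rw [← Fintype.expect_const (ι := ι) (𝔼 ω, ∫ r in (0 : ℝ)..T - t, G r (t + r, x + (X ω (t + r) - X ω t)))]
          refine Finset.expect_congr rfl fun i _ => Finset.expect_congr rfl fun ω _ => ?_
          refine intervalIntegral.integral_congr fun r hr => ?_
          rw [Set.uIcc_of_le (by linarith)] at hr
          simp only
          rw [if_neg (by linarith [hr.1]), if_neg (by linarith), add_sub_add_left_eq_sub]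
        rw [this]
        linarith

end Chaining

section Taylor
variable {E : Type*} [NormedAddCommGroup E] [NormedSpace ℝ E]

lemma abs_sub_zero_le_of_hasDerivAt {F F' : ℝ → ℝ} {C : ℝ} (hF : ∀ τ, HasDerivAt F (F' τ) τ)
    (hC : ∀ τ ∈ Set.Icc (0 : ℝ) 1, |F' τ| ≤ C) {τ : ℝ} (hτ : τ ∈ Set.Icc (0 : ℝ) 1) :
    |F τ - F 0| ≤ C := by
  have h := (convex_Icc (0 : ℝ) 1).norm_image_sub_le_of_norm_hasDerivWithin_le
    (fun x _ => (hF x).hasDerivWithinAt) hC (Set.left_mem_Icc.2 zero_le_one) hτ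
  have hC0 : 0 ≤ C := (abs_nonneg _).trans (hC 0 (Set.left_mem_Icc.2 zero_le_one))
  rw [Real.norm_eq_abs, Real.norm_eq_abs, sub_zero, abs_of_nonneg hτ.1] at h
  nlinarith [hτ.2]

lemma abs_second_difference_sub_le {φ : E → ℝ} (hφ : IsTest φ) (e : E) {B : ℝ}
    (hB : ∀ z, |D e (D e (D e φ)) z| ≤ B) (z : E) :
    |φ (z + e) + φ (z - e) - 2 * φ z - D e (D e φ) z| ≤ 2 * B := by
  have hneg : ∀ {ψ : E → ℝ}, IsTest ψ → ∀ τ : ℝ,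
      HasDerivAt (fun τ : ℝ => ψ (z + (-τ) • e)) (-(D e ψ (z + (-τ) • e))) τ := by
    intro ψ hψ τ
    have := (hψ.hasDerivAt_line z e (-τ)).comp τ (hasDerivAt_neg τ)
    simpa [Function.comp_def] using this
  have d0 : ∀ τ, HasDerivAt (fun τ : ℝ => φ (z + τ • e) + φ (z + (-τ) • e) - 2 * φ z
      - τ ^ 2 * D e (D e φ) z) (D e φ (z + τ • e) - D e φ (z + (-τ) • e)
      - 2 * τ * D e (D e φ) z) τ := by
    intro τ
    have := (((hφ.hasDerivAt_line z e τ).add (hneg hφ τ)).sub_const (2 * φ z)).sub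
      ((hasDerivAt_pow 2 τ).mul_const (D e (D e φ) z))
    refine this.congr_deriv ?_
    push_cast; ring
  have d1 : ∀ τ, HasDerivAt (fun τ : ℝ => D e φ (z + τ • e) - D e φ (z + (-τ) • e)
      - 2 * τ * D e (D e φ) z) (D e (D e φ) (z + τ • e) + D e (D e φ) (z + (-τ) • e)
      - 2 * D e (D e φ) z) τ := by
    intro τ
    have := ((((hφ.D e).hasDerivAt_line z e τ).sub (hneg (hφ.D e) τ))).sub
      (((hasDerivAt_id τ).const_mul 2).mul_const (D e (D e φ) z))
    refine this.congr_deriv ?_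
    simp only [mul_one]; ring
  have d2 : ∀ τ, HasDerivAt (fun τ : ℝ => D e (D e φ) (z + τ • e) + D e (D e φ) (z + (-τ) • e)
      - 2 * D e (D e φ) z) (D e (D e (D e φ)) (z + τ • e) - D e (D e (D e φ)) (z +
          (-τ) • e)) τ := by
    intro τ
    have := ((((hφ.D e).D e).hasDerivAt_line z e τ).add (hneg ((hφ.D e).D e) τ)).sub_const
      (2 * D e (D e φ) z)
    exact this.congr_deriv (by ring)
  have b2 : ∀ τ ∈ Set.Icc (0 : ℝ) 1, |D e (D e φ) (z + τ • e) + D e (D e φ) (z + (-τ) • e)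
      - 2 * D e (D e φ) z| ≤ 2 * B := by
    intro τ hτ
    have := abs_sub_zero_le_of_hasDerivAt (C := 2 * B) d2 (fun τ _ => ?_) hτ
    · simpa [← two_mul] using this
    · exact (abs_sub _ _).trans (by linarith [hB (z + τ • e), hB (z + (-τ) • e)])
  have b1 : ∀ τ ∈ Set.Icc (0 : ℝ) 1, |D e φ (z + τ • e) - D e φ (z + (-τ) • e)
      - 2 * τ * D e (D e φ) z| ≤ 2 * B := by
    intro τ hτ
    simpa using abs_sub_zero_le_of_hasDerivAt d1 b2 hτ
  have b0 := abs_sub_zero_le_of_hasDerivAt d0 b1 (Set.right_mem_Icc.2 zero_le_one)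
  simpa [← two_mul, ← sub_eq_add_neg] using b0

lemma exists_D_bound {φ : E → ℝ} (hφ : IsTest φ) :
    ∃ B : ℝ, 0 ≤ B ∧ ∀ e z, |D e φ z| ≤ B * ‖e‖ := by
  obtain ⟨B, hB⟩ := (hφ.contDiff.continuous_fderiv (by simp)).bounded_above_of_compact_support
    (hφ.hasCompactSupport.fderiv (𝕜 := ℝ))
  exact ⟨B, (norm_nonneg _).trans (hB 0), fun e z => (fderiv ℝ φ z).le_of_opNorm_le (hB z) e⟩

end Taylor

section Jumps
variable {d : ℕ}

/-- The `i`-th spatial coordinate direction. -/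
def spaceDir (i : Fin d) : ℝ × (Fin d → ℝ) := (0, Pi.single i 1)

lemma D_space (φ : ℝ × (Fin d → ℝ) → ℝ) (y : Fin d → ℝ) (z : ℝ × (Fin d → ℝ)) :
    D (0, y) φ z = ∑ i, y i * D (spaceDir i) φ z := by
  have : ((0 : ℝ), y) = ∑ i, y i • spaceDir i := by
    ext k
    · simp [spaceDir, Prod.fst_sum]
    · simp [spaceDir, Prod.snd_sum, Finset.sum_apply, Pi.single_apply]
  simp only [D]
  rw [this, map_sum]
  simp

lemma D_sum_mul {E : Type*} [NormedAddCommGroup E] [NormedSpace ℝ E] {ι : Type*} (s : Finset ι)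
    (a : ι → ℝ) {ψ : ι → E → ℝ} (hψ : ∀ i, IsTest (ψ i)) (e z : E) :
    D e (fun z => ∑ i ∈ s, a i * ψ i z) z = ∑ i ∈ s, a i * D e (ψ i) z := by
  have : HasFDerivAt (fun z => ∑ i ∈ s, a i * ψ i z) (∑ i ∈ s, a i • fderiv ℝ (ψ i) z) z :=
    HasFDerivAt.fun_sum fun i _ => ((hψ i).differentiable z).hasFDerivAt.const_mul (a i)
  simp only [D]
  rw [this.fderiv]
  simp

lemma D_space_D_space {φ : ℝ × (Fin d → ℝ) → ℝ} (hφ : IsTest φ) (y y' : Fin d → ℝ)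
    (z : ℝ × (Fin d → ℝ)) : D (0, y) (D (0, y') φ) z =
      ∑ i, ∑ j, y i * y' j * D (spaceDir i) (D (spaceDir j) φ) z := by
  rw [D_space]
  refine Finset.sum_congr rfl fun i _ => ?_
  rw [show D (0, y') φ = fun z => ∑ j, y' j * D (spaceDir j) φ z from funext (D_space φ y'),
    D_sum_mul _ _ fun j => hφ.D _, Finset.mul_sum]
  simp only [mul_assoc]

lemma exists_third_bound {φ : ℝ × (Fin d → ℝ) → ℝ} (hφ : IsTest φ) :
    ∃ B : ℝ, 0 ≤ B ∧ ∀ (y : Fin d → ℝ) z,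
      |D (0, y) (D (0, y) (D (0, y) φ)) z| ≤ B * ‖y‖ ^ 3 := by
  choose B hB0 hB using fun i j : Fin d =>
    exists_D_bound ((hφ.D (spaceDir j)).D (spaceDir i))
  refine ⟨∑ i, ∑ j, B i j, Finset.sum_nonneg fun i _ => Finset.sum_nonneg fun j _ => hB0 i j,
    fun y z => ?_⟩
  have h1 : D (0, y) (D (0, y) φ) = fun z => ∑ q : Fin d × Fin d, (y q.1 * y q.2) *
      D (spaceDir q.1) (D (spaceDir q.2) φ) z := by
    ext z
    rw [D_space_D_space hφ, Fintype.sum_prod_type]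
  rw [h1, D_sum_mul _ _ fun q => ((hφ.D _).D _), Fintype.sum_prod_type, Finset.sum_mul]
  refine (Finset.abs_sum_le_sum_abs _ _).trans (Finset.sum_le_sum fun i _ => ?_)
  rw [Finset.sum_mul]
  refine (Finset.abs_sum_le_sum_abs _ _).trans (Finset.sum_le_sum fun j _ => ?_)
  have h2 := hB i j (0, y) z
  rw [show ‖((0 : ℝ), y)‖ = ‖y‖ by simp [Prod.norm_mk]] at h2
  rw [abs_mul, abs_mul]
  have hi : |y i| ≤ ‖y‖ := norm_le_pi_norm y i
  have hj : |y j| ≤ ‖y‖ := norm_le_pi_norm y j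
  calc |y i| * |y j| * _ ≤ ‖y‖ * ‖y‖ * (B i j * ‖y‖) := by gcongr
    _ = _ := by ring

open scoped MatrixOrder in
lemma exists_gram {A : Matrix (Fin d) (Fin d) ℝ} (hs : A.IsSymm)
    (h : ∀ ξ : Fin d → ℝ, 0 ≤ ∑ i, ∑ j, A i j * ξ i * ξ j) :
    ∃ B : Matrix (Fin d) (Fin d) ℝ, ∀ i j, A i j = ∑ r, B r i * B r j := by
  have hA : A.PosSemidef := by
    refine .of_dotProduct_mulVec_nonneg ?_ fun x => ?_
    · rw [Matrix.IsHermitian, Matrix.conjTranspose_eq_transpose_of_trivial]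
      exact hs
    have hx : star x ⬝ᵥ A.mulVec x = ∑ i, ∑ j, A i j * x i * x j := by
      simp only [dotProduct, Matrix.mulVec, Finset.mul_sum, Pi.star_apply, star_trivial]
      refine Finset.sum_congr rfl fun i _ => Finset.sum_congr rfl fun j _ => ?_
      ring
    rw [hx]
    exact h x
  obtain ⟨B, hB⟩ := CStarAlgebra.nonneg_iff_eq_star_mul_self.1 hA.nonneg
  refine ⟨B, fun i j => ?_⟩
  rw [hB, Matrix.mul_apply]
  simp

lemma exists_jumps [NeZero d] {A : Matrix (Fin d) (Fin d) ℝ} (hs : A.IsSymm)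
    (h : ∀ ξ : Fin d → ℝ, 0 ≤ ∑ i, ∑ j, A i j * ξ i * ξ j) {m : ℝ} (hm : ∀ i, A i i ≤ m) :
    ∃ Y : Fin d × Bool → Fin d → ℝ, (∀ q, ‖Y q‖ ≤ √(2 * d * m)) ∧
      ∀ φ : ℝ × (Fin d → ℝ) → ℝ, IsTest φ → ∀ B : ℝ, 0 ≤ B →
        (∀ (y : Fin d → ℝ) z, |D (0, y) (D (0, y) (D (0, y) φ)) z| ≤ B * ‖y‖ ^ 3) →
        ∀ z, |(𝔼 q, φ (z + (0, Y q))) - φ z - ∑ i, ∑ j, A i j *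
          D (spaceDir i) (D (spaceDir j) φ) z| ≤ B * √(2 * d * m) ^ 3 := by
  obtain ⟨b, hb⟩ := exists_gram hs h
  have hd : (0 : ℝ) < d := by exact_mod_cast Nat.pos_of_ne_zero (NeZero.ne d)
  set e : Fin d → Fin d → ℝ := fun r => √(2 * d) • b r with he
  have hen : ∀ r, ‖e r‖ ≤ √(2 * d * m) := by
    intro r
    refine (pi_norm_le_iff_of_nonneg (Real.sqrt_nonneg _)).2 fun i => ?_
    have h1 : b r i ^ 2 ≤ m := by
      refine le_trans ?_ (hm i)
      rw [hb, sq]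
      exact Finset.single_le_sum (f := fun r => b r i * b r i) (fun r _ => mul_self_nonneg _)
        (Finset.mem_univ r)
    rw [he, Real.norm_eq_abs]
    refine Real.abs_le_sqrt ?_
    simp only [Pi.smul_apply, smul_eq_mul, mul_pow]
    rw [Real.sq_sqrt (by positivity)]
    gcongr
  refine ⟨fun q => if q.2 then e q.1 else -e q.1, fun q => ?_, fun φ hφ B hB0 hB z => ?_⟩
  · dsimp only
    split_ifs
    · exact hen _
    · rw [norm_neg]; exact hen _
  have h1 : ∀ r, |φ (z + (0, e r)) + φ (z - (0, e r)) - 2 * φ z -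
      D (0, e r) (D (0, e r) φ) z| ≤ 2 * (B * √(2 * d * m) ^ 3) := fun r => by
    refine abs_second_difference_sub_le hφ (0, e r) (fun z => (hB (e r) z).trans ?_) z
    have := hen r
    gcongr
  have h2 : 𝔼 q : Fin d × Bool, φ (z + (0, if q.2 then e q.1 else -e q.1)) =
      𝔼 r, (φ (z + (0, e r)) + φ (z - (0, e r))) / 2 := by
    rw [← Finset.univ_product_univ, Finset.expect_product]
    refine Finset.expect_congr rfl fun r _ => ?_
    rw [Fintype.expect_eq_sum_div_card]
    simp [sub_eq_add_neg]
  have h3 : ∑ i, ∑ j, A i j * D (spaceDir i) (D (spaceDir j) φ) z =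
      𝔼 r, D (0, e r) (D (0, e r) φ) z / 2 := by
    have h4 : ∀ r, D (0, e r) (D (0, e r) φ) z / 2 =
        d * ∑ i, ∑ j, b r i * b r j * D (spaceDir i) (D (spaceDir j) φ) z := by
      intro r
      rw [D_space_D_space hφ, Finset.mul_sum, Finset.sum_div]
      refine Finset.sum_congr rfl fun i _ => ?_
      rw [Finset.mul_sum, Finset.sum_div]
      refine Finset.sum_congr rfl fun j _ => ?_
      have h5 := Real.mul_self_sqrt (show (0 : ℝ) ≤ 2 * d by positivity)
      simp only [he, Pi.smul_apply, smul_eq_mul]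
      linear_combination b r i * b r j * D (spaceDir i) (D (spaceDir j) φ) z / 2 * h5
    simp_rw [h4]
    rw [Fintype.expect_eq_sum_div_card, Fintype.card_fin, ← Finset.mul_sum,
      mul_div_cancel_left₀ _ hd.ne']
    conv_rhs => rw [Finset.sum_comm]
    refine Finset.sum_congr rfl fun i _ => ?_
    conv_rhs => rw [Finset.sum_comm]
    refine Finset.sum_congr rfl fun j _ => ?_
    rw [hb, Finset.sum_mul]
  rw [h2, h3, ← Fintype.expect_const (ι := Fin d) (φ z), ← Finset.expect_sub_distrib,
    ← Finset.expect_sub_distrib]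
  refine abs_expect_le_of_forall fun r => ?_
  have := h1 r
  rw [abs_le] at *
  constructor <;> linarith [this.1, this.2]

end Jumps

section HeatAvg
variable {E : Type*} [NormedAddCommGroup E] [NormedSpace ℝ E]

lemma heat_eq_zero {s : ℝ} (hs : s ≤ 0) (y : ℝ) : heat s y = 0 := by
  unfold heat
  rw [Real.sqrt_eq_zero_of_nonpos (by nlinarith [Real.pi_pos])]
  exact div_zero _

lemma heatAvg_eq_zero {s : ℝ} (hs : s ≤ 0) (b : E) (φ : E → ℝ) (P : E) : heatAvg b s φ P = 0 := by
  simp [heatAvg, heat_eq_zero hs]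

lemma abs_heatAvg_le' (s : ℝ) (b : E) {φ : E → ℝ} {B : ℝ} (hB : ∀ z, |φ z| ≤ B) (P : E) :
    |heatAvg b s φ P| ≤ B := by
  rcases le_or_gt s 0 with hs | hs
  · rw [heatAvg_eq_zero hs, abs_zero]
    exact (abs_nonneg _).trans (hB 0)
  · exact abs_heatAvg_le hs b hB P

lemma measurable_heatAvg_uncurry [MeasurableSpace E] [BorelSpace E] [SecondCountableTopology E] (b : E)
    {φ : E → ℝ} (hφ : Continuous φ) : Measurable fun q : ℝ × E => heatAvg b q.1 φ q.2 := by
  have h1 : Measurable fun q : (ℝ × E) × ℝ => heat q.1.1 q.2 * φ (q.1.2 + q.2 • b) := by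
    refine Measurable.mul ?_ ?_
    · exact measurable_heat.comp (by fun_prop : Measurable fun q : (ℝ × E) × ℝ => (q.1.1, q.2))
    · have : Continuous fun q : (ℝ × E) × ℝ => φ (q.1.2 + q.2 • b) := by fun_prop
      exact this.measurable
  exact (StronglyMeasurable.integral_prod_right (f := fun (q : ℝ × E) (y : ℝ) =>
    heat q.1 y * φ (q.2 + y • b)) h1.stronglyMeasurable).measurable

lemma heatAvg_comp_add (b : E) (s : ℝ) (φ : E → ℝ) (e P : E) :
    heatAvg b s (fun z => φ (z + e)) P = heatAvg b s φ (P + e) := by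
  simp only [heatAvg, add_right_comm]

lemma heatAvg_flow_sub_eq {s h : ℝ} (hs : 0 < s) (hh : 0 ≤ h) (a b : E) {φ : E → ℝ}
    (hφ : IsTest φ) (P : E) : heatAvg b (s + h) φ (P + h • a) - heatAvg b s φ P =
      ∫ r in (0 : ℝ)..h, heatAvg b (s + r) (fun z => D b (D b φ) z + D a φ z) (P + r • a) := by
  have h1 := heatAvg_sub_eq hs (by linarith : s ≤ s + h) a b hφ (P - s • a)
  rw [show P - s • a + (s + h) • a = P + h • a by rw [add_smul]; abel,
    show P - s • a + s • a = P by abel] at h1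
  rw [h1]
  have h2 := intervalIntegral.integral_comp_add_left (a := 0) (b := h) (fun r =>
    heatAvg b r (fun z => D b (D b φ) z + D a φ z) (P - s • a + r • a)) s
  rw [add_zero] at h2
  rw [← h2]
  refine intervalIntegral.integral_congr fun r _ => ?_
  rw [show P - s • a + (s + r) • a = P + r • a by rw [add_smul]; abel]

lemma abs_heatAvg_flow_sub_le {s h : ℝ} (hs : 0 < s) (hh : 0 ≤ h) (a b : E) {φ : E → ℝ}
    (hφ : IsTest φ) {B : ℝ} (hB : ∀ z, |D b (D b φ) z + D a φ z| ≤ B) (P : E) :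
    |heatAvg b (s + h) φ (P + h • a) - heatAvg b s φ P| ≤ B * h := by
  rw [heatAvg_flow_sub_eq hs hh a b hφ]
  have := intervalIntegral.norm_integral_le_of_norm_le_const (a := 0) (b := h) (C := B)
    (f := fun r => heatAvg b (s + r) (fun z => D b (D b φ) z + D a φ z) (P + r • a))
    (fun r _ => abs_heatAvg_le' _ _ hB _)
  rwa [sub_zero, abs_of_nonneg hh] at this

lemma abs_mul_heat_le {s : ℝ} (hs : 0 < s) (y : ℝ) : |y| * heat s y ≤ 4 * √s * heat (2 * s) y := by
  have h1 : heat s y = √2 * Real.exp (-(y ^ 2 / (8 * s))) * heat (2 * s) y := by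
    unfold heat
    rw [show 4 * Real.pi * (2 * s) = 2 * (4 * Real.pi * s) by ring,
      Real.sqrt_mul (by norm_num : (0 : ℝ) ≤ 2)]
    have : -(y ^ 2 / (4 * s)) = -(y ^ 2 / (8 * s)) + -(y ^ 2 / (4 * (2 * s))) := by
      field_simp; ring
    rw [this, Real.exp_add]
    have h2 : √(2 : ℝ) ≠ 0 := by positivity
    have h3 : √(4 * Real.pi * s) ≠ 0 := by positivity
    generalize √(4 * Real.pi * s) = q at *
    field_simp
  rw [h1, ← mul_assoc]
  refine mul_le_mul_of_nonneg_right ?_ (heat_nonneg _ _)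
  set z := y ^ 2 / (8 * s) with hz
  have hz0 : 0 ≤ z := by positivity
  have h2 : |y| * √2 = 4 * √s * √z := by
    rw [← Real.sqrt_sq_eq_abs, ← Real.sqrt_mul (sq_nonneg y), mul_assoc, ← Real.sqrt_mul hs.le,
      show (4 : ℝ) = √16 by rw [show (16 : ℝ) = 4 ^ 2 by norm_num, Real.sqrt_sq (by norm_num)],
      ← Real.sqrt_mul (by norm_num), hz]
    congr 1
    field_simp; ring
  rw [← mul_assoc, h2]
  have h3 : √z * Real.exp (-z) ≤ 1 := by
    rw [Real.exp_neg, ← div_eq_mul_inv, div_le_one (Real.exp_pos z)]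
    have := Real.add_one_le_exp z
    nlinarith [Real.sq_sqrt hz0, sq_nonneg (√z - 1)]
  calc 4 * √s * √z * Real.exp (-z) = 4 * √s * (√z * Real.exp (-z)) := by ring
    _ ≤ 4 * √s * 1 := by gcongr
    _ = 4 * √s := mul_one _

lemma abs_heatAvg_sub_le {s : ℝ} (hs : 0 < s) (b : E) {φ : E → ℝ} (hφ : IsTest φ) {L : ℝ}
    (hL : ∀ z z', |φ z - φ z'| ≤ L * ‖z - z'‖) (P : E) :
    |heatAvg b s φ P - φ P| ≤ L * ‖b‖ * (4 * √s) := by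
  obtain ⟨B, -, hB⟩ := hφ.exists_bound
  have hc := hφ.continuous
  have h1 : heatAvg b s φ P - φ P = ∫ y, heat s y * (φ (P + y • b) - φ P) := by
    simp_rw [mul_sub]
    rw [integral_sub (integrable_heat_mul hs (by fun_prop) fun y => hB _)
      ((integrable_heat hs).mul_const _), integral_mul_const, integral_heat hs, one_mul, heatAvg]
  rw [h1]
  have h2 : 0 < 2 * s := by linarith
  have h3 := norm_integral_le_of_norm_le (f := fun y => heat s y * (φ (P + y • b) - φ P))
    ((integrable_heat h2).const_mul (L * ‖b‖ * (4 * √s))) (Filter.Eventually.of_forall fun y => ?_)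
  · rwa [integral_const_mul, integral_heat h2, mul_one] at h3
  · have h4 := hL (P + y • b) P
    rw [add_sub_cancel_left, norm_smul, Real.norm_eq_abs] at h4
    have hLb : 0 ≤ L * ‖b‖ := by
      have := hL (P + b) P
      rw [add_sub_cancel_left] at this
      exact (abs_nonneg _).trans this
    rw [Real.norm_eq_abs, abs_mul, abs_of_nonneg (heat_nonneg s y)]
    calc heat s y * |φ (P + y • b) - φ P| ≤ heat s y * (L * (|y| * ‖b‖)) :=
          mul_le_mul_of_nonneg_left h4 (heat_nonneg s y)
      _ = L * ‖b‖ * (|y| * heat s y) := by ring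
      _ ≤ L * ‖b‖ * (4 * √s * heat (2 * s) y) :=
          mul_le_mul_of_nonneg_left (abs_mul_heat_le hs y) hLb
      _ = _ := by ring

lemma abs_sum_heatAvg_le {s : ℝ} (hs : 0 < s) (b : E) {κ : Type*} [Fintype κ] (c : κ → ℝ)
    {ψ : κ → E → ℝ} (hψ : ∀ k, IsTest (ψ k)) {B : ℝ} (hB : ∀ z, |∑ k, c k * ψ k z| ≤ B) (P : E) :
    |∑ k, c k * heatAvg b s (ψ k) P| ≤ B := by
  have : ∑ k, c k * heatAvg b s (ψ k) P = heatAvg b s (fun z => ∑ k, c k * ψ k z) P := by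
    simp only [heatAvg, Finset.mul_sum]
    rw [integral_finsetSum]
    · refine Finset.sum_congr rfl fun k _ => ?_
      rw [← integral_const_mul]
      exact integral_congr_ae (Filter.Eventually.of_forall fun y => by simp only; ring)
    · intro k _
      obtain ⟨B', -, hB'⟩ := ((hψ k).const_mul (c k)).exists_bound
      have := (hψ k).continuous
      exact integrable_heat_mul hs (g := fun y => c k * ψ k (P + y • b)) (by fun_prop)
        fun y => hB' _
  rw [this]
  exact abs_heatAvg_le hs b hB P

end HeatAvg

section Step
variable {d : ℕ}

/-- The heat semigroup along `(0, v)` at time `s` applied to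
`∂ᵥ² w + ∂ₜ w + ∑ Aᵢⱼ ∂ᵢ∂ⱼ w`, the matrix `A` being frozen at the time of evaluation. -/
noncomputable def flowGen (v : Fin d → ℝ) (A : ℝ → Matrix (Fin d) (Fin d) ℝ)
    (w : ℝ × (Fin d → ℝ) → ℝ) (s : ℝ) (z : ℝ × (Fin d → ℝ)) : ℝ :=
  heatAvg (0, v) s (fun z => D (0, v) (D (0, v) w) z + D (1, 0) w z) z +
    ∑ i, ∑ j, A z.1 i j * heatAvg (0, v) s (D (spaceDir i) (D (spaceDir j) w)) z

lemma measurable_flowGen (v : Fin d → ℝ) {A : ℝ → Matrix (Fin d) (Fin d) ℝ}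
    (hA : ∀ i j, Measurable fun t => A t i j) {w : ℝ × (Fin d → ℝ) → ℝ} (hw : IsTest w) :
    Measurable fun q : ℝ × ℝ × (Fin d → ℝ) => flowGen v A w q.1 q.2 := by
  refine (measurable_heatAvg_uncurry _ (((hw.D _).D _).add (hw.D _)).continuous).add ?_
  refine Finset.measurable_fun_sum _ fun i _ => Finset.measurable_fun_sum _ fun j _ => ?_
  have h1 : Measurable fun q : ℝ × ℝ × (Fin d → ℝ) => A q.2.1 i j :=
    (hA i j).comp (by fun_prop : Measurable fun q : ℝ × ℝ × (Fin d → ℝ) => q.2.1)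
  exact h1.mul (measurable_heatAvg_uncurry _ ((hw.D _).D _).continuous)

lemma exists_flowGen_bound (v : Fin d → ℝ) {A : ℝ → Matrix (Fin d) (Fin d) ℝ} {M : ℝ}
    (hM : ∀ t i j, |A t i j| ≤ M) {w : ℝ × (Fin d → ℝ) → ℝ} (hw : IsTest w) :
    ∃ H₀, 0 ≤ H₀ ∧ ∀ s z, |flowGen v A w s z| ≤ H₀ := by
  obtain ⟨B, hB0, hB⟩ := (((hw.D (0, v)).D (0, v)).add (hw.D (1, 0))).exists_bound
  choose B' hB'0 hB' using fun i j : Fin d => ((hw.D (spaceDir j)).D (spaceDir i)).exists_bound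
  refine ⟨B + ∑ i, ∑ j, |M| * B' i j, ?_, fun s z => ?_⟩
  · have : ∀ i j, 0 ≤ |M| * B' i j := fun i j => mul_nonneg (abs_nonneg _) (hB'0 i j)
    exact add_nonneg hB0 (Finset.sum_nonneg fun i _ => Finset.sum_nonneg fun j _ => this i j)
  · refine (abs_add_le _ _).trans (add_le_add (abs_heatAvg_le' _ _ hB _) ?_)
    refine (Finset.abs_sum_le_sum_abs _ _).trans (Finset.sum_le_sum fun i _ => ?_)
    refine (Finset.abs_sum_le_sum_abs _ _).trans (Finset.sum_le_sum fun j _ => ?_)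
    rw [abs_mul]
    exact mul_le_mul ((hM _ _ _).trans (le_abs_self M)) (abs_heatAvg_le' _ _ (hB' i j) _)
      (abs_nonneg _) (abs_nonneg _)

lemma intervalIntegrable_fun_sum {ι : Type*} (S : Finset ι) {f : ι → ℝ → ℝ} {a b : ℝ}
    (h : ∀ i ∈ S, IntervalIntegrable (f i) volume a b) :
    IntervalIntegrable (fun x => ∑ i ∈ S, f i x) volume a b := by
  simpa only [Finset.sum_fn] using IntervalIntegrable.sum S h

lemma exists_jumps_of_path [NeZero d] {A : ℝ → Matrix (Fin d) (Fin d) ℝ}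
    (hA : ∀ i j, Measurable fun t => A t i j) {M : ℝ} (hM : ∀ t i j, |A t i j| ≤ M)
    (hs : ∀ t, (A t).IsSymm)
    (hpos : ∀ t (ξ : Fin d → ℝ), 0 ≤ ∑ i, ∑ j, A t i j * ξ i * ξ j) {h : ℝ} (hh : 0 ≤ h) (t : ℝ) :
    ∃ Y : Fin d × Bool → Fin d → ℝ, (∀ q, ‖Y q‖ ≤ √(2 * d * (M * h))) ∧
      ∀ φ : ℝ × (Fin d → ℝ) → ℝ, IsTest φ → ∀ B : ℝ, 0 ≤ B →
        (∀ (y : Fin d → ℝ) z, |D (0, y) (D (0, y) (D (0, y) φ)) z| ≤ B * ‖y‖ ^ 3) →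
        ∀ z, |(𝔼 q, φ (z + (0, Y q))) - φ z - ∑ i, ∑ j, (∫ r in (0 : ℝ)..h, A (t + r) i j) *
          D (spaceDir i) (D (spaceDir j) φ) z| ≤ B * √(2 * d * (M * h)) ^ 3 := by
  have hm : ∀ i j, Measurable fun r => A (t + r) i j := fun i j =>
    (hA i j).comp (measurable_const_add t)
  have hAint : ∀ i j, IntervalIntegrable (fun r => A (t + r) i j) volume 0 h := fun i j =>
    intervalIntegrable_of_bounded (hm i j) (fun r => hM _ i j) _ _
  refine exists_jumps (A := Matrix.of fun i j => ∫ r in (0 : ℝ)..h, A (t + r) i j) ?_ ?_ ?_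
  · ext i j
    simp only [Matrix.transpose_apply, Matrix.of_apply, fun t => (hs t).apply i j]
  · intro ξ
    have : ∑ i, ∑ j, (∫ r in (0 : ℝ)..h, A (t + r) i j) * ξ i * ξ j =
        ∫ r in (0 : ℝ)..h, ∑ i, ∑ j, A (t + r) i j * ξ i * ξ j := by
      rw [intervalIntegral.integral_finsetSum]
      · refine Finset.sum_congr rfl fun i _ => ?_
        rw [intervalIntegral.integral_finsetSum]
        · refine Finset.sum_congr rfl fun j _ => ?_
          rw [intervalIntegral.integral_mul_const, intervalIntegral.integral_mul_const]
        · exact fun j _ => ((hAint i j).mul_const _).mul_const _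
      · exact fun i _ => intervalIntegrable_fun_sum _ fun j _ =>
          ((hAint i j).mul_const _).mul_const _
    simp only [Matrix.of_apply]
    rw [this]
    exact intervalIntegral.integral_nonneg hh fun r _ => hpos _ ξ
  · intro i
    have := intervalIntegral.norm_integral_le_of_norm_le_const (a := 0) (b := h) (C := M)
      (f := fun r => A (t + r) i i) (fun r _ => hM _ _ _)
    rw [sub_zero, abs_of_nonneg hh] at this
    exact (le_abs_self _).trans this

theorem exists_step [NeZero d] (v : Fin d → ℝ) {A : ℝ → Matrix (Fin d) (Fin d) ℝ}
    (hA : ∀ i j, Measurable fun t => A t i j) {M : ℝ} (hM : ∀ t i j, |A t i j| ≤ M)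
    (hs : ∀ t, (A t).IsSymm)
    (hpos : ∀ t (ξ : Fin d → ℝ), 0 ≤ ∑ i, ∑ j, A t i j * ξ i * ξ j)
    {w : ℝ × (Fin d → ℝ) → ℝ} (hw : IsTest w) :
    ∃ C : ℝ, 0 ≤ C ∧ ∀ h : ℝ, 0 < h → h ≤ 1 → ∀ t : ℝ, ∃ (ι : Type) (_ : Fintype ι)
      (_ : Nonempty ι) (Y : ι → Fin d → ℝ),
      (∀ s x, 0 < s → |(𝔼 i, heatAvg (0, v) (s + h) w (t + h, x + Y i)) -
        heatAvg (0, v) s w (t, x) - ∫ r in (0 : ℝ)..h, flowGen v A w (s + r) (t + r, x)| ≤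
          C * (h * √h)) ∧
      (∀ s x i, 0 < s → s ≤ h →
        |heatAvg (0, v) s w (t + h, x + Y i) - w (t + h - s, x)| ≤ C * √h) := by
  have hM0 : 0 ≤ M := (abs_nonneg _).trans (hM 0 0 0)
  obtain ⟨B, hB0, hB⟩ := exists_third_bound hw
  obtain ⟨L, hL⟩ : ∃ L : NNReal, LipschitzWith L w :=
    ContDiff.lipschitzWith_of_hasCompactSupport (𝕂 := ℝ) (n := 1) hw.hasCompactSupport
      (hw.contDiff.of_le (by simp)) (by simp)
  have hL' : ∀ z z', |w z - w z'| ≤ L * ‖z - z'‖ := fun z z' => by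
    simpa [dist_eq_norm, Real.norm_eq_abs] using hL.dist_le_mul z z'
  have hψ : ∀ i j : Fin d, IsTest (D (spaceDir i) (D (spaceDir j) w)) := fun i j =>
    (hw.D _).D _
  choose R hR0 hR using fun i j : Fin d =>
    ((((hψ i j).D (0, v)).D (0, v)).add ((hψ i j).D (1, 0))).exists_bound
  set m : ℝ := √(2 * d * M) with hm
  have hm0 : 0 ≤ m := Real.sqrt_nonneg _
  have hRs : 0 ≤ ∑ i, ∑ j, M * R i j :=
    Finset.sum_nonneg fun i _ => Finset.sum_nonneg fun j _ => mul_nonneg hM0 (hR0 i j)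
  have hLv : 0 ≤ (L : ℝ) * ‖((0 : ℝ), v)‖ := by positivity
  have hsq : ∀ h : ℝ, √(2 * d * (M * h)) = m * √h := fun h => by
    rw [hm, ← Real.sqrt_mul (by positivity), mul_assoc]
    congr 1; ring
  refine ⟨(B * m ^ 3 + ∑ i, ∑ j, M * R i j) + (L * ‖((0 : ℝ), v)‖ * 4 + L * (1 + m)), by positivity,
    fun h hh hh1 t => ?_⟩
  have hrt : 0 ≤ √h := Real.sqrt_nonneg h
  have hrt1 : √h ≤ 1 := by rw [← Real.sqrt_one]; exact Real.sqrt_le_sqrt hh1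
  have hrtsq : √h * √h = h := Real.mul_self_sqrt hh.le
  have hhle : h ≤ √h := by nlinarith
  obtain ⟨Y, hY, hYφ⟩ := exists_jumps_of_path hA hM hs hpos hh.le t
  refine ⟨Fin d × Bool, inferInstance, inferInstance, Y, fun s x h_s => ?_, fun s x i h_s hsh => ?_⟩
  · set b : ℝ × (Fin d → ℝ) := (0, v) with hb
    set Ab : Fin d → Fin d → ℝ := fun i j => ∫ r in (0 : ℝ)..h, A (t + r) i j with hAb
    have e1 : |(𝔼 i, heatAvg b (s + h) w (t + h, x + Y i)) - heatAvg b (s + h) w (t + h, x) -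
        ∑ i, ∑ j, Ab i j * heatAvg b (s + h) (D (spaceDir i) (D (spaceDir j) w)) (t + h, x)| ≤
        B * (m * √h) ^ 3 := by
      have := abs_sum_heatAvg_le (s := s + h) (by linarith) b
        (κ := (Fin d × Bool) ⊕ (Unit ⊕ (Fin d × Fin d)))
        (Sum.elim (fun _ => ((Fintype.card (Fin d × Bool) : ℝ))⁻¹)
          (Sum.elim (fun _ => -1) (fun q => -Ab q.1 q.2)))
        (ψ := Sum.elim (fun i z => w (z + (0, Y i)))
          (Sum.elim (fun _ => w) (fun q => D (spaceDir q.1) (D (spaceDir q.2) w))))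
        (by rintro (i | i | q)
            · exact hw.comp_add _
            · exact hw
            · exact hψ _ _) (B := B * (m * √h) ^ 3) (fun z => ?_) (t + h, x)
      · refine le_trans (le_of_eq ?_) this
        rw [Fintype.sum_sum_type, Fintype.sum_sum_type]
        simp only [Sum.elim_inl, Sum.elim_inr, heatAvg_comp_add,
            Fintype.sum_prod_type (α₁ := Fin d) (α₂ := Fin d),
          neg_mul, Finset.sum_neg_distrib, Finset.univ_unique, Finset.sum_const,
              Finset.card_singleton, one_smul, one_mul]
        rw [Fintype.expect_eq_sum_div_card, ← Finset.mul_sum]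
        simp only [Prod.mk_add_mk, add_zero]
        congr 1; ring
      · refine le_trans (le_of_eq ?_) ((hYφ w hw B hB0 hB z).trans_eq (by rw [hsq]))
        rw [Fintype.sum_sum_type, Fintype.sum_sum_type]
        simp only [Sum.elim_inl, Sum.elim_inr, Fintype.sum_prod_type (α₁ := Fin d) (α₂ := Fin d),
          neg_mul, Finset.sum_neg_distrib, Finset.univ_unique, Finset.sum_const,
              Finset.card_singleton, one_smul, one_mul]
        rw [Fintype.expect_eq_sum_div_card, ← Finset.mul_sum]
        congr 1; ring
    have e2 : heatAvg b (s + h) w (t + h, x) - heatAvg b s w (t, x) =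
        ∫ r in (0 : ℝ)..h, heatAvg b (s + r) (fun z => D b (D b w) z + D (1, 0) w z) (t + r,
            x) := by
      have := heatAvg_flow_sub_eq h_s hh.le (1, 0) b hw (t, x)
      simpa [Prod.smul_mk] using this
    have hmeas : ∀ {φ : ℝ × (Fin d → ℝ) → ℝ}, IsTest φ →
        Measurable fun r => heatAvg b (s + r) φ (t + r, x) := fun hφ =>
      (measurable_heatAvg_uncurry b hφ.continuous).comp (by fun_prop :
        Measurable fun r : ℝ => (s + r, ((t + r, x) : ℝ × (Fin d → ℝ))))
    have hAm : ∀ i j, Measurable fun r => A (t + r) i j := fun i j =>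
      (hA i j).comp (measurable_const_add t)
    have hI : ∀ i j, IntervalIntegrable (fun r => A (t + r) i j *
        heatAvg b (s + r) (D (spaceDir i) (D (spaceDir j) w)) (t + r, x)) volume 0 h := by
      intro i j
      obtain ⟨B', -, hB'⟩ := (hψ i j).exists_bound
      refine intervalIntegrable_of_bounded (B := M * B') ((hAm i j).mul (hmeas (hψ i j)))
        (fun r => ?_) _ _
      rw [Pi.mul_apply, abs_mul]
      exact mul_le_mul (hM _ _ _) (abs_heatAvg_le' _ _ hB' _) (abs_nonneg _) hM0
    have e3 : ∫ r in (0 : ℝ)..h, flowGen v A w (s + r) (t + r, x) =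
        (∫ r in (0 : ℝ)..h, heatAvg b (s + r) (fun z => D b (D b w) z + D (1, 0) w z) (t + r, x)) +
        ∑ i, ∑ j, ∫ r in (0 : ℝ)..h, A (t + r) i j *
          heatAvg b (s + r) (D (spaceDir i) (D (spaceDir j) w)) (t + r, x) := by
      simp only [flowGen]
      have ht1 := ((hw.D b).D b).add (hw.D ((1 : ℝ), (0 : Fin d → ℝ)))
      obtain ⟨B', -, hB'⟩ := ht1.exists_bound
      rw [intervalIntegral.integral_add, intervalIntegral.integral_finsetSum]
      · congr 1
        refine Finset.sum_congr rfl fun i _ => ?_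
        rw [intervalIntegral.integral_finsetSum]
        exact fun j _ => hI i j
      · exact fun i _ => intervalIntegrable_fun_sum _ fun j _ => hI i j
      · exact intervalIntegrable_of_bounded (hmeas ht1) (fun r => abs_heatAvg_le' _ _ hB' _) _ _
      · exact intervalIntegrable_fun_sum _ fun i _ => intervalIntegrable_fun_sum _ fun j _ => hI i j
    have e4 : |∑ i, ∑ j, Ab i j * heatAvg b (s + h) (D (spaceDir i) (D (spaceDir j) w)) (t + h, x) -
        ∑ i, ∑ j, ∫ r in (0 : ℝ)..h, A (t + r) i j *
          heatAvg b (s + r) (D (spaceDir i) (D (spaceDir j) w)) (t + r, x)| ≤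
        (∑ i, ∑ j, M * R i j) * (h * h) := by
      rw [← Finset.sum_sub_distrib, Finset.sum_mul]
      refine (Finset.abs_sum_le_sum_abs _ _).trans (Finset.sum_le_sum fun i _ => ?_)
      rw [← Finset.sum_sub_distrib, Finset.sum_mul]
      refine (Finset.abs_sum_le_sum_abs _ _).trans (Finset.sum_le_sum fun j _ => ?_)
      rw [hAb]
      simp only
      rw [← intervalIntegral.integral_mul_const, ← intervalIntegral.integral_sub _ (hI i j)]
      · have := intervalIntegral.norm_integral_le_of_norm_le_const (a := 0) (b := h)
          (C := M * (R i j * h)) (f := fun r => A (t + r) i j *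
            heatAvg b (s + h) (D (spaceDir i) (D (spaceDir j) w)) (t + h, x) - A (t + r) i j *
            heatAvg b (s + r) (D (spaceDir i) (D (spaceDir j) w)) (t + r, x)) (fun r hr => ?_)
        · rw [sub_zero, abs_of_nonneg hh.le] at this
          refine this.trans_eq (by ring)
        · rw [Set.uIoc_of_le hh.le] at hr
          rw [← mul_sub, Real.norm_eq_abs, abs_mul]
          refine mul_le_mul (hM _ _ _) ?_ (abs_nonneg _) hM0
          have := abs_heatAvg_flow_sub_le (s := s + r) (h := h - r) (by linarith [hr.1])
            (by linarith [hr.2]) (1, 0) b (hψ i j) (hR i j) (t + r, x)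
          rw [show s + r + (h - r) = s + h by ring,
            show ((t + r, x) : ℝ × (Fin d → ℝ)) + (h - r) • (1, 0) = (t + h, x) by
              simp [Prod.smul_mk]] at this
          refine this.trans ?_
          have := hR0 i j
          gcongr
          linarith [hr.1]
      · exact (intervalIntegrable_of_bounded (hAm i j) (fun r => hM _ _ _) _ _).mul_const _
    rw [e3, ← e2]
    have e5 : B * (m * √h) ^ 3 = B * m ^ 3 * (h * √h) := by
      rw [mul_pow, show √h ^ 3 = (√h * √h) * √h by ring, hrtsq]; ring
    have e6 : (∑ i, ∑ j, M * R i j) * (h * h) ≤ (∑ i, ∑ j, M * R i j) * (h * √h) := by gcongr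
    have e7 : 0 ≤ (L * ‖b‖ * 4 + L * (1 + m)) * (h * √h) := by positivity
    rw [abs_le] at *
    rw [e5] at e1
    rw [add_mul, add_mul (B * m ^ 3)]
    constructor <;> linarith [e1.1, e1.2, e4.1, e4.2]
  · have e1 := abs_heatAvg_sub_le h_s (0, v) hw hL' (t + h, x + Y i)
    have e2 := hL' (t + h, x + Y i) (t + h - s, x)
    have e3 : ‖((t + h, x + Y i) : ℝ × (Fin d → ℝ)) - (t + h - s, x)‖ ≤ √h + m * √h := by
      rw [Prod.mk_sub_mk, Prod.norm_mk, add_sub_cancel_left, show t + h - (t + h - s) = s by ring]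
      refine max_le ?_ ?_
      · rw [Real.norm_of_nonneg h_s.le]
        nlinarith
      · have := hY i
        rw [hsq] at this
        linarith
    have e4 : √s ≤ √h := Real.sqrt_le_sqrt hsh
    have e5 : (L : ℝ) * ‖((0 : ℝ), v)‖ * (4 * √s) ≤ L * ‖((0 : ℝ), v)‖ * (4 * √h) := by gcongr
    have e6 : (L : ℝ) * ‖((t + h, x + Y i) : ℝ × (Fin d → ℝ)) - (t + h - s, x)‖ ≤
      L * (√h + m * √h) := by gcongr
    have e7 : 0 ≤ (B * m ^ 3 + ∑ i, ∑ j, M * R i j) * √h := by positivity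
    rw [abs_le] at *
    have e8 : (L * ‖((0 : ℝ), v)‖ * 4 + L * (1 + m)) * √h =
      L * ‖((0 : ℝ), v)‖ * (4 * √h) + L * (√h + m * √h) := by ring
    rw [add_mul, e8]
    constructor <;> linarith [e1.1, e1.2, e2.1, e2.2]

end Step

section Approx
variable {d : ℕ}

/-- The operator `∂ₜ + ∂ᵥ² + ∑ Aᵢⱼ ∂ᵢ∂ⱼ`. -/
noncomputable def flowOp (v : Fin d → ℝ) (A : ℝ → Matrix (Fin d) (Fin d) ℝ)
    (u : ℝ × (Fin d → ℝ) → ℝ) (z : ℝ × (Fin d → ℝ)) : ℝ :=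
  D (1, 0) u z + D (0, v) (D (0, v) u) z +
    ∑ i, ∑ j, A z.1 i j * D (spaceDir i) (D (spaceDir j) u) z

lemma measurable_flowOp (v : Fin d → ℝ) {A : ℝ → Matrix (Fin d) (Fin d) ℝ}
    (hA : ∀ i j, Measurable fun t => A t i j) {u : ℝ × (Fin d → ℝ) → ℝ} (hu : IsTest u) :
    Measurable (flowOp v A u) := by
  refine ((hu.D _).continuous.measurable.add ((hu.D _).D _).continuous.measurable).add ?_
  refine Finset.measurable_fun_sum _ fun i _ => Finset.measurable_fun_sum _ fun j _ => ?_
  exact ((hA i j).comp measurable_fst).mul ((hu.D _).D _).continuous.measurable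

lemma exists_flowOp_bound (v : Fin d → ℝ) {A : ℝ → Matrix (Fin d) (Fin d) ℝ} {M : ℝ}
    (hM : ∀ t i j, |A t i j| ≤ M) {u : ℝ × (Fin d → ℝ) → ℝ} (hu : IsTest u) :
    ∃ B, ∀ z, |flowOp v A u z| ≤ B := by
  obtain ⟨B, -, hB⟩ := ((hu.D (1, 0)).add ((hu.D (0, v)).D (0, v))).exists_bound
  choose B' _ hB' using fun i j : Fin d => ((hu.D (spaceDir j)).D (spaceDir i)).exists_bound
  refine ⟨B + ∑ i, ∑ j, |M| * B' i j, fun z => ?_⟩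
  refine (abs_add_le _ _).trans (add_le_add (hB z) ?_)
  refine (Finset.abs_sum_le_sum_abs _ _).trans (Finset.sum_le_sum fun i _ => ?_)
  refine (Finset.abs_sum_le_sum_abs _ _).trans (Finset.sum_le_sum fun j _ => ?_)
  rw [abs_mul]
  exact mul_le_mul ((hM _ _ _).trans (le_abs_self M)) (hB' i j _) (abs_nonneg _) (abs_nonneg _)

lemma D_eq_zero_of_notMem {E : Type*} [NormedAddCommGroup E] [NormedSpace ℝ E] {φ : E → ℝ} (e : E)
    {z : E} (hz : z ∉ tsupport φ) : D e φ z = 0 :=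
  image_eq_zero_of_notMem_tsupport fun h => hz (tsupport_fderiv_apply_subset ℝ e h)

lemma tsupport_D_subset {E : Type*} [NormedAddCommGroup E] [NormedSpace ℝ E] (φ : E → ℝ) (e : E) :
    tsupport (D e φ) ⊆ tsupport φ :=
  tsupport_fderiv_apply_subset ℝ e

lemma heatAvg_flow_eq_zero (v : Fin d → ℝ) (s : ℝ) {φ : ℝ × (Fin d → ℝ) → ℝ}
    {z : ℝ × (Fin d → ℝ)} (h : ∀ x, φ (z.1, x) = 0) : heatAvg (0, v) s φ z = 0 := by
  have : ∀ y : ℝ, φ (z + y • (0, v)) = 0 := fun y => by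
    have : z + y • ((0 : ℝ), v) = (z.1, z.2 + y • v) := by ext <;> simp
    rw [this, h]
  simp only [heatAvg, this, mul_zero, integral_zero]

lemma flowGen_eq_zero (v : Fin d → ℝ) (A : ℝ → Matrix (Fin d) (Fin d) ℝ)
    {w : ℝ × (Fin d → ℝ) → ℝ} (s : ℝ) {z : ℝ × (Fin d → ℝ)}
    (h : ∀ x, (z.1, x) ∉ tsupport w) : flowGen v A w s z = 0 := by
  have h2 : ∀ a b x, D a (D b w) (z.1, x) = 0 := fun a b x =>
    D_eq_zero_of_notMem a fun hx => h x (tsupport_D_subset w b hx)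
  unfold flowGen
  rw [heatAvg_flow_eq_zero v s fun x => by rw [h2, D_eq_zero_of_notMem _ (h x), add_zero]]
  simp only [heatAvg_flow_eq_zero v s fun x => h2 _ _ x, mul_zero, Finset.sum_const_zero, add_zero]

lemma flowGen_eq_integral (v : Fin d → ℝ) (A : ℝ → Matrix (Fin d) (Fin d) ℝ)
    {u : ℝ × (Fin d → ℝ) → ℝ} (hu : IsTest u) {s : ℝ} (hs : 0 < s) (z : ℝ × (Fin d → ℝ)) :
    flowGen v A (D (0, v) (D (0, v) u)) s z =
      ∫ y, heat2 s y * flowOp v A u (z + y • (0, v)) := by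
  have hi : ∀ {φ : ℝ × (Fin d → ℝ) → ℝ}, IsTest φ →
      Integrable fun y : ℝ => heat2 s y * φ (z + y • (0, v)) := by
    intro φ hφ
    obtain ⟨B, -, hB⟩ := hφ.exists_bound
    have := hφ.continuous
    exact (integrable_heat2 hs).mul_bdd (c := B) (Continuous.aestronglyMeasurable (by fun_prop))
      (Filter.Eventually.of_forall fun y => hB _)
  have h0 : IsTest fun z => D (1, 0) u z + D (0, v) (D (0, v) u) z :=
    (hu.D _).add ((hu.D _).D _)
  have hij : ∀ i j : Fin d, IsTest (D (spaceDir i) (D (spaceDir j) u)) := fun i j => (hu.D _).D _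
  have e : ∀ y : ℝ, heat2 s y * flowOp v A u (z + y • (0, v)) =
      heat2 s y * (D (1, 0) u (z + y • (0, v)) + D (0, v) (D (0, v) u) (z + y • (0, v))) +
        ∑ i, ∑ j, A z.1 i j *
          (heat2 s y * D (spaceDir i) (D (spaceDir j) u) (z + y • (0, v))) := by
    intro y
    unfold flowOp
    rw [mul_add, Finset.mul_sum]
    congr 1
    refine Finset.sum_congr rfl fun i _ => ?_
    rw [Finset.mul_sum]
    refine Finset.sum_congr rfl fun j _ => ?_
    rw [mul_left_comm]
    simp
  have hij' : ∀ i j : Fin d, Integrable fun y : ℝ => A z.1 i j *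
      (heat2 s y * D (spaceDir i) (D (spaceDir j) u) (z + y • (0, v))) := fun i j =>
    (hi (hij i j)).const_mul _
  have hi' : ∀ i : Fin d, Integrable fun y : ℝ => ∑ j, A z.1 i j *
      (heat2 s y * D (spaceDir i) (D (spaceDir j) u) (z + y • (0, v))) := fun i =>
    integrable_finsetSum _ fun j _ => hij' i j
  have e2 := integral_add (hi h0) (integrable_finsetSum Finset.univ fun i _ => hi' i)
  rw [integral_finsetSum _ fun i _ => hi' i, integral_heat2_mul hs (0, v) h0] at e2
  refine Eq.trans ?_ ((integral_congr_ae (Filter.Eventually.of_forall e)).trans e2).symm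
  unfold flowGen
  congr 1
  · congr 1
    have hc : ∀ e, D e (D (0, v) (D (0, v) u)) = D (0, v) (D (0, v) (D e u)) := fun e => by
      rw [D_comm (hu.D _) e, D_comm hu e]
    have hadd : ∀ {φ ψ : ℝ × (Fin d → ℝ) → ℝ} (e), IsTest φ → IsTest ψ →
        D e (fun z => φ z + ψ z) = fun z => D e φ z + D e ψ z := by
      intro φ ψ e hφ hψ
      ext z
      simp only [D]
      rw [fderiv_fun_add (hφ.differentiable z) (hψ.differentiable z)]
      rfl
    rw [hadd _ (hu.D _) ((hu.D _).D _), hadd _ ((hu.D _).D _) (((hu.D _).D _).D _), ← hc (1, 0)]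
    ext z
    rw [add_comm]
  · refine Finset.sum_congr rfl fun i _ => ?_
    rw [integral_finsetSum _ fun j _ => hij' i j]
    refine Finset.sum_congr rfl fun j _ => ?_
    rw [integral_const_mul, integral_heat2_mul hs (0, v) (hij i j)]
    congr 2
    rw [D_comm (hu.D _) (spaceDir j), D_comm hu (spaceDir j),
      D_comm ((hu.D _).D _) (spaceDir i), D_comm (hu.D _) (spaceDir i)]

lemma pathCorr_trunc_flowOp (v : Fin d → ℝ) {A : ℝ → Matrix (Fin d) (Fin d) ℝ}
    (hA : ∀ i j, Measurable fun t => A t i j) {M : ℝ} (hM : ∀ t i j, |A t i j| ≤ M)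
    {u : ℝ × (Fin d → ℝ) → ℝ} (hu : IsTest u) {ε R : ℝ} (hε : 0 < ε) (hεR : ε ≤ R)
    {X : ℝ → Fin d → ℝ} (hX : Measurable X) (t : ℝ) (x : Fin d → ℝ) :
    pathCorr (trunc ε R heat2) v X (flowOp v A u) (t, x) =
      ∫ s in ε..R, flowGen v A (D (0, v) (D (0, v) u)) s (t + s, x + (X (t + s) - X t)) := by
  obtain ⟨B, hB⟩ := exists_flowOp_bound v hM hu
  have hm := measurable_flowOp v hA hu
  have hi : Integrable fun w : ℝ × ℝ => trunc ε R heat2 w *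
      flowOp v A u (t + w.1, x + w.2 • v + (X (t + w.1) - X t)) :=
    (integrable_trunc_heat2 hε R).mul_bdd (c := B)
      (Measurable.aestronglyMeasurable (by fun_prop)) (Filter.Eventually.of_forall fun y => hB _)
  unfold pathCorr
  rw [Measure.volume_eq_prod] at hi ⊢
  rw [integral_prod _ hi, intervalIntegral.integral_of_le hεR,
      ← integral_indicator measurableSet_Ioc]
  congr 1
  ext s
  by_cases hs : s ∈ Set.Ioc ε R
  · rw [Set.indicator_of_mem hs, flowGen_eq_integral v A hu (hε.trans hs.1)]
    congr 1; ext y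
    simp only [trunc, hs, if_true]
    congr 2
    ext
    · simp
    · simp
      ring
  · rw [Set.indicator_of_notMem hs]
    simp [trunc, hs]

theorem exists_paths_approx [NeZero d] (v : Fin d → ℝ) {A : ℝ → Matrix (Fin d) (Fin d) ℝ}
    (hA : ∀ i j, Measurable fun t => A t i j) {M : ℝ} (hM : ∀ t i j, |A t i j| ≤ M)
    (hs : ∀ t, (A t).IsSymm)
    (hpos : ∀ t (ξ : Fin d → ℝ), 0 ≤ ∑ i, ∑ j, A t i j * ξ i * ξ j)
    {u : ℝ × (Fin d → ℝ) → ℝ} (hu : IsTest u) {T : ℝ} (hT0 : 0 < T)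
    (hT : ∀ z ∈ tsupport u, |z.1| < T) {δ : ℝ} (hδ : 0 < δ) :
    ∃ ε R : ℝ, 0 < ε ∧ ε ≤ R ∧ ∃ (Ω : Type) (_ : Fintype Ω) (_ : Nonempty Ω)
      (X : Ω → ℝ → Fin d → ℝ), (∀ ω, Measurable (X ω)) ∧ ∀ z : ℝ × (Fin d → ℝ), |z.1| ≤ T →
        |D (0, v) (D (0, v) u) z +
          𝔼 ω, pathCorr (trunc ε R heat2) v (X ω) (flowOp v A u) z| ≤ δ := by
  set w := D (0, v) (D (0, v) u) with hw_def
  have hw : IsTest w := (hu.D _).D _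
  have hsupp : ∀ t, T ≤ t → ∀ x, (t, x) ∉ tsupport w := fun t ht x hx =>
    absurd (hT _ (tsupport_D_subset _ _ (tsupport_D_subset _ _ hx)))
      (not_lt.2 (ht.trans (le_abs_self t)))
  have hw0 : ∀ t, T ≤ t → ∀ x, w (t, x) = 0 := fun t ht x =>
    image_eq_zero_of_notMem_tsupport (hsupp t ht x)
  have hG0 : ∀ s t, T ≤ t → ∀ x, flowGen v A w s (t, x) = 0 := fun s t ht x =>
    flowGen_eq_zero v A s fun x => hsupp t ht x
  obtain ⟨H₀, hH₀, hGb⟩ := exists_flowGen_bound v hM hw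
  have hGm := measurable_flowGen v hA hw
  obtain ⟨C, hC0, hC⟩ := exists_step v hA hM hs hpos hw
  obtain ⟨N, hN⟩ := exists_nat_ge (max (2 * T) (2 * T * ((2 * T * C + C + 2 * H₀) / δ) ^ 2))
  have hN1 : 2 * T ≤ N := (le_max_left _ _).trans hN
  have hN2 := (le_max_right _ _).trans hN
  have hNpos : (0 : ℝ) < N := by linarith
  set h : ℝ := 2 * T / N with h_def
  have hh : 0 < h := by positivity
  have hh1 : h ≤ 1 := (div_le_one hNpos).2 hN1
  have hNh : N * h = 2 * T := by rw [h_def]; field_simp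
  have hh2 : h ≤ 2 * T := by
    have : (1 : ℝ) ≤ N := Nat.one_le_cast.2 (Nat.one_le_iff_ne_zero.2 (by
      rintro rfl; simp at hNpos))
    nlinarith
  have hr : 0 < √h := Real.sqrt_pos.2 hh
  have hrr : √h * √h = h := Real.mul_self_sqrt hh.le
  have hhr : h ≤ √h := by
    have : √h ≤ 1 := Real.sqrt_le_one.2 hh1
    nlinarith
  have hfinal : (2 * T * C + C + 2 * H₀) * √h ≤ δ := by
    set K := 2 * T * C + C + 2 * H₀ with hK
    have hK0 : 0 ≤ K := by positivity
    refine abs_le_of_sq_le_sq' ?_ hδ.le |>.2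
    rw [mul_pow, Real.sq_sqrt hh.le, h_def, mul_div_assoc', div_le_iff₀ hNpos]
    rw [div_pow, mul_div_assoc', div_le_iff₀ (by positivity)] at hN2
    linarith
  obtain ⟨Ω, i1, i2, X, hXm, -, -, hX⟩ := exists_random_paths
    (G := flowGen v A w) (H := fun s z => heatAvg (0, v) s w z) (w := w) hGm hGb
    (T := T) (h := h) (E := C * (h * √h)) (E' := C * √h) hh (by positivity) (by positivity)
    (fun s x => heatAvg_flow_eq_zero v s fun x => hw0 T le_rfl x)
    (hw0 T le_rfl) (hC h hh hh1) N
  refine ⟨h, 2 * T, hh, hh2, Ω, i1, i2, X, hXm, fun z hz => ?_⟩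
  obtain ⟨t, x⟩ := z
  rw [abs_le] at hz
  simp only at hz
  have key := hX t x (by rw [hNh]; linarith) hz.2
  simp only [pathCorr_trunc_flowOp v hA hM hu hh hh2 (hXm _)]
  have hdiff : ∀ ω, |(∫ s in h..2 * T, flowGen v A w s (t + s, x + (X ω (t + s) - X ω t))) -
      ∫ r in (0 : ℝ)..T - t, flowGen v A w r (t + r, x + (X ω (t + r) - X ω t))| ≤ h * H₀ := by
    intro ω
    set g : ℝ → ℝ := fun s => flowGen v A w s (t + s, x + (X ω (t + s) - X ω t)) with hg
    have hXω := hXm ω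
    have hgm : Measurable g := hGm.comp
      (by fun_prop : Measurable fun s : ℝ => (s, t + s, x + (X ω (t + s) - X ω t)))
    have hgi : ∀ a b, IntervalIntegrable g volume a b := fun a b =>
      intervalIntegrable_of_bounded hgm (fun r => hGb _ _) a b
    have e1 := intervalIntegral.integral_add_adjacent_intervals (hgi 0 h) (hgi h (2 * T))
    have e2 := intervalIntegral.integral_add_adjacent_intervals (hgi 0 (T - t)) (hgi (T - t) (2 * T))
    have e3 : ∫ s in (T - t)..2 * T, g s = 0 := by
      rw [intervalIntegral.integral_congr (g := fun _ => (0 : ℝ)) fun s hs' => ?_]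
      · simp
      · rw [Set.uIcc_of_le (by linarith)] at hs'
        exact hG0 _ _ (by linarith [hs'.1]) _
    have e4 := intervalIntegral.norm_integral_le_of_norm_le_const (a := 0) (b := h) (C := H₀)
      (f := g) (fun r _ => hGb _ _)
    rw [sub_zero, abs_of_pos hh, Real.norm_eq_abs] at e4
    have : (∫ s in h..2 * T, g s) - ∫ r in (0 : ℝ)..T - t, g r = -∫ s in (0 : ℝ)..h, g s := by
      linarith
    rw [this, abs_neg]
    linarith
  have h2 := abs_expect_le_of_forall hdiff
  rw [Finset.expect_sub_distrib] at h2
  rw [abs_le] at key h2 ⊢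
  have h3 : N * (C * (h * √h)) = 2 * T * C * √h := by rw [← hNh]; ring
  have h4 : H₀ * h ≤ H₀ * √h := mul_le_mul_of_nonneg_left hhr hH₀
  constructor <;> nlinarith [key.1, key.2, h2.1, h2.2]

end Approx

lemma eLpNorm_expect_le {α Ω : Type*} [MeasurableSpace α] {μ : Measure α} [Fintype Ω] [Nonempty Ω]
    {q C : ℝ≥0∞} (hq : 1 ≤ q) {F : Ω → α → ℝ} (hF : ∀ ω, AEStronglyMeasurable (F ω) μ)
    (hC : ∀ ω, eLpNorm (F ω) q μ ≤ C) : eLpNorm (fun z => 𝔼 ω, F ω z) q μ ≤ C := by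
  have hn : (Fintype.card Ω : ℝ≥0∞) ≠ 0 := by simp
  have e : (fun z => 𝔼 ω, F ω z) = (Fintype.card Ω : ℝ)⁻¹ • ∑ ω, F ω := by
    ext z
    simp [Fintype.expect_eq_sum_div_card, div_eq_inv_mul]
  rw [e, eLpNorm_const_smul]
  calc ‖(Fintype.card Ω : ℝ)⁻¹‖ₑ * eLpNorm (∑ ω, F ω) q μ
      ≤ (Fintype.card Ω : ℝ≥0∞)⁻¹ * ∑ _ω : Ω, C := by
        gcongr
        · rw [enorm_inv (by simp)]
          simp
        · exact (eLpNorm_sum_le (fun ω _ => hF ω) hq).trans (Finset.sum_le_sum fun ω _ => hC ω)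
    _ = C := by
        rw [Finset.sum_const, Finset.card_univ, nsmul_eq_mul, ← mul_assoc,
          ENNReal.inv_mul_cancel hn (by simp), one_mul]

lemma eLpNorm_le_of_abs_add_le {α : Type*} [MeasurableSpace α] {μ : Measure α} {p : ℝ} (hp : 1 ≤ p)
    {S : Set α} (hS : MeasurableSet S) {δ : ℝ} (hδ : 0 ≤ δ) {w P : α → ℝ}
    (hP : AEStronglyMeasurable P μ) (hw : ∀ z, z ∉ S → w z = 0) (hwP : ∀ z ∈ S, |w z + P z| ≤ δ) :
    eLpNorm w (ENNReal.ofReal p) μ ≤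
      eLpNorm P (ENNReal.ofReal p) μ + ENNReal.ofReal δ * μ S ^ (1 / p) := by
  have hq : 1 ≤ ENNReal.ofReal p := by
    rw [← ENNReal.ofReal_one]
    exact ENNReal.ofReal_le_ofReal hp
  have hind : eLpNorm (S.indicator fun _ => δ) (ENNReal.ofReal p) μ =
      ENNReal.ofReal δ * μ S ^ (1 / p) := by
    rw [eLpNorm_indicator_const hS (by simp; linarith) ENNReal.ofReal_ne_top,
      ENNReal.toReal_ofReal (by linarith), Real.enorm_of_nonneg hδ]
  have hle : eLpNorm w (ENNReal.ofReal p) μ ≤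
      eLpNorm ((fun z => ‖P z‖) + S.indicator fun _ => δ) (ENNReal.ofReal p) μ := by
    refine eLpNorm_mono_real fun z => ?_
    by_cases hz : z ∈ S
    · have h1 := abs_sub (w z + P z) (P z)
      rw [add_sub_cancel_right] at h1
      rw [Pi.add_apply, Set.indicator_of_mem hz, Real.norm_eq_abs, Real.norm_eq_abs]
      linarith [hwP z hz]
    · rw [hw z hz, norm_zero]
      exact add_nonneg (norm_nonneg _) (Set.indicator_nonneg (fun _ _ => hδ) _)
  refine hle.trans ((eLpNorm_add_le hP.norm
    (measurable_const.indicator hS).aestronglyMeasurable hq).trans_eq ?_)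
  rw [hind, eLpNorm_norm]

/-- The `L^p` norm of `∂ᵥ² u` is controlled by `flowOp v A u`, uniformly in `v` and `A`. -/
theorem exists_bound_flowOp {p : ℝ} (hp : 1 < p) : ∃ C : ℝ, 0 < C ∧ ∀ (d : ℕ) [NeZero d]
    (v : Fin d → ℝ) (A : ℝ → Matrix (Fin d) (Fin d) ℝ) (M : ℝ),
    (∀ i j, Measurable fun t => A t i j) → (∀ t i j, |A t i j| ≤ M) → (∀ t, (A t).IsSymm) →
    (∀ t (ξ : Fin d → ℝ), 0 ≤ ∑ i, ∑ j, A t i j * ξ i * ξ j) →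
    ∀ u : ℝ × (Fin d → ℝ) → ℝ, IsTest u →
      eLpNorm (D (0, v) (D (0, v) u)) (ENNReal.ofReal p) volume ≤
        ENNReal.ofReal C * eLpNorm (flowOp v A u) (ENNReal.ofReal p) volume := by
  obtain ⟨C, hC0, hC⟩ := exists_bound_corr_heat2 hp
  refine ⟨C, hC0, fun d _ v A M hA hM hs hpos u hu => ?_⟩
  by_cases hv : v = 0
  · have : D ((0 : ℝ), v) (D ((0 : ℝ), v) u) = 0 := by
      ext z
      simp [D, hv, ← Prod.zero_eq_mk]
    rw [this, eLpNorm_zero]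
    exact zero_le
  obtain ⟨T, hT⟩ : ∃ T : ℝ, ∀ z ∈ tsupport u, |z.1| ≤ T := by
    obtain ⟨T, hT⟩ := hu.hasCompactSupport.isCompact.isBounded.exists_norm_le
    exact ⟨T, fun z hz => (norm_fst_le z).trans (hT z hz)⟩
  have hT' : ∀ z ∈ tsupport u, |z.1| < |T| + 1 := fun z hz =>
    (hT z hz).trans_lt ((le_abs_self T).trans_lt (lt_add_one _))
  have hq : 1 ≤ ENNReal.ofReal p := by
    rw [← ENNReal.ofReal_one]
    exact ENNReal.ofReal_le_ofReal hp.le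
  have hS : volume (tsupport u) < ∞ := hu.hasCompactSupport.isCompact.measure_lt_top
  set K : ℝ≥0∞ := volume (tsupport u) ^ (1 / p) with hK_def
  have hK : K ≠ ∞ := ENNReal.rpow_ne_top_of_nonneg (by positivity) hS.ne
  have key : ∀ δ : ℝ, 0 < δ → eLpNorm (D (0, v) (D (0, v) u)) (ENNReal.ofReal p) volume ≤
      ENNReal.ofReal C * eLpNorm (flowOp v A u) (ENNReal.ofReal p) volume +
        ENNReal.ofReal δ * K := by
    intro δ hδ
    obtain ⟨ε, R, hε, hεR, Ω, _, _, X, hX, hX'⟩ :=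
      exists_paths_approx v hA hM hs hpos hu (by positivity : 0 < |T| + 1) hT' hδ
    have hFm := measurable_flowOp v hA hu
    have hk : Measurable (trunc ε R heat2) := measurable_trunc ε R measurable_heat2
    have hm : ∀ ω, AEStronglyMeasurable (pathCorr (trunc ε R heat2) v (X ω) (flowOp v A u)) volume :=
      fun ω => (measurable_pathCorr hk v (hX ω) hFm).aestronglyMeasurable
    have h1 := eLpNorm_expect_le hq hm fun ω => eLpNorm_pathCorr_le (by linarith) hk
      ENNReal.ofReal_ne_top (hC ε R hε hεR) hv (hX ω) hFm
    have hm' := Finset.aestronglyMeasurable_fun_sum Finset.univ fun ω _ => hm ω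
    refine (eLpNorm_le_of_abs_add_le hp.le (isClosed_tsupport u).measurableSet hδ.le
      (P := fun z => 𝔼 ω, pathCorr (trunc ε R heat2) v (X ω) (flowOp v A u) z) ?_ ?_ ?_).trans
      (add_le_add h1 le_rfl)
    · simp only [Fintype.expect_eq_sum_div_card, div_eq_mul_inv]
      exact hm'.mul_const _
    · exact fun z hz => D_eq_zero_of_notMem _ fun h => hz (tsupport_D_subset _ _ h)
    · exact fun z hz => hX' z (hT' z hz).le
  refine ENNReal.le_of_forall_pos_le_add fun η hη _ => ?_
  have hη' : 0 < (η : ℝ) / (K.toReal + 1) := by positivity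
  refine (key _ hη').trans (add_le_add le_rfl ?_)
  have hKδ := ENNReal.ofReal_mul (q := K.toReal) hη'.le
  rw [ENNReal.ofReal_toReal hK] at hKδ
  rw [← hKδ, ← ENNReal.ofReal_coe_nnreal]
  refine ENNReal.ofReal_le_ofReal ?_
  rw [div_mul_eq_mul_div, div_le_iff₀ (by positivity)]
  nlinarith [η.2]

section Final
variable {d : ℕ}

lemma sum_vecMulVec_mul (v ξ : Fin d → ℝ) :
    ∑ i, ∑ j, v i * v j * ξ i * ξ j = (∑ i, v i * ξ i) ^ 2 := by
  rw [sq, Finset.sum_mul_sum]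
  refine Finset.sum_congr rfl fun i _ => Finset.sum_congr rfl fun j _ => ?_
  ring

/-- The `L^p` estimate for a second directional derivative which the diffusion dominates. -/
theorem exists_bound_second_derivative {p : ℝ} (hp : 1 < p) : ∃ C : ℝ, 0 < C ∧
    ∀ (d : ℕ) [NeZero d] (v : Fin d → ℝ) (c : ℝ → Matrix (Fin d) (Fin d) ℝ),
    (∀ i j, Measurable fun t => c t i j) →
    (∀ a b : ℝ, ∃ K : ℝ, ∀ t ∈ Set.Icc a b, ∀ i j, |c t i j| ≤ K) →
    (∀ t, (c t).IsSymm) →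
    (∀ t (ξ : Fin d → ℝ), (∑ i, v i * ξ i) ^ 2 ≤ ∑ i, ∑ j, c t i j * ξ i * ξ j) →
    ∀ u : ℝ × (Fin d → ℝ) → ℝ, IsTest u →
      eLpNorm (D (0, v) (D (0, v) u)) (ENNReal.ofReal p) volume ≤
        ENNReal.ofReal C * eLpNorm (fun z => D (1, 0) u z +
          ∑ i, ∑ j, c z.1 i j * D (spaceDir i) (D (spaceDir j) u) z)
          (ENNReal.ofReal p) volume := by
  obtain ⟨C, hC0, hC⟩ := exists_bound_flowOp hp
  refine ⟨C, hC0, fun d _ v c hc hb hs hpos u hu => ?_⟩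
  obtain ⟨T, hT⟩ : ∃ T : ℝ, ∀ z ∈ tsupport u, |z.1| ≤ T := by
    obtain ⟨T, hT⟩ := hu.hasCompactSupport.isCompact.isBounded.exists_norm_le
    exact ⟨T, fun z hz => (norm_fst_le z).trans (hT z hz)⟩
  obtain ⟨K, hK⟩ := hb (-T) T
  let A : ℝ → Matrix (Fin d) (Fin d) ℝ := fun t =>
    Matrix.of fun i j => if t ∈ Set.Icc (-T) T then c t i j - v i * v j else 0
  have hAdef : ∀ t i j, A t i j = if t ∈ Set.Icc (-T) T then c t i j - v i * v j else 0 :=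
    fun _ _ _ => rfl
  have hM : ∀ t i j, |A t i j| ≤ |K| + ‖v‖ * ‖v‖ := by
    intro t i j
    rw [hAdef]
    split_ifs with h
    · refine (abs_sub _ _).trans (add_le_add ((hK t h i j).trans (le_abs_self K)) ?_)
      rw [abs_mul]
      exact mul_le_mul (norm_le_pi_norm v i) (norm_le_pi_norm v j) (abs_nonneg _) (norm_nonneg _)
    · rw [abs_zero]
      positivity
  have key := hC d v A _ (fun i j => ?_) hM (fun t => ?_) (fun t ξ => ?_) u hu
  · refine key.trans_eq ?_
    congr 2
    ext z
    unfold flowOp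
    by_cases hz : z ∈ tsupport u
    · have hz' : z.1 ∈ Set.Icc (-T) T := abs_le.1 (hT z hz)
      rw [D_space_D_space hu, add_assoc, ← Finset.sum_add_distrib]
      congr 1
      refine Finset.sum_congr rfl fun i _ => ?_
      rw [← Finset.sum_add_distrib]
      refine Finset.sum_congr rfl fun j _ => ?_
      rw [hAdef, if_pos hz']
      ring
    · have h2 : ∀ a b, D a (D b u) z = 0 := fun a b =>
        D_eq_zero_of_notMem a fun h => hz (tsupport_D_subset u b h)
      simp [h2]
  · simp only [hAdef]
    exact Measurable.ite measurableSet_Icc ((hc i j).sub_const _) measurable_const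
  · ext i j
    simp only [Matrix.transpose_apply, hAdef, (hs t).apply i j, mul_comm (v i)]
  · simp only [hAdef]
    split_ifs with h
    · simp only [sub_mul, Finset.sum_sub_distrib, sum_vecMulVec_mul]
      exact sub_nonneg.2 (hpos t ξ)
    · simp

lemma D_polarization {u : ℝ × (Fin d → ℝ) → ℝ} (hu : IsTest u) (a : ℝ) (y y' : Fin d → ℝ)
    (z : ℝ × (Fin d → ℝ)) :
    D (0, a • (y + y')) (D (0, a • (y + y')) u) z - D (0, a • (y - y')) (D (0, a • (y - y')) u) z =
      4 * a ^ 2 * D (0, y) (D (0, y') u) z := by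
  have h : 4 * a ^ 2 * D (0, y) (D (0, y') u) z =
      2 * a ^ 2 * (D (0, y) (D (0, y') u) z + D (0, y') (D (0, y) u) z) := by
    rw [D_comm hu (0, y') (0, y)]
    ring
  rw [h]
  simp only [D_space_D_space hu, ← Finset.sum_sub_distrib, ← Finset.sum_add_distrib,
    Finset.mul_sum]
  refine Finset.sum_congr rfl fun i _ => Finset.sum_congr rfl fun j _ => ?_
  simp only [Pi.smul_apply, Pi.add_apply, Pi.sub_apply, smul_eq_mul]
  ring

lemma ptime_eq_D {u : ℝ × (Fin d → ℝ) → ℝ} (hu : IsTest u) : ptime u = D (1, 0) u := by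
  ext z
  have h1 : HasDerivAt (fun s : ℝ => (s, z.2)) ((1 : ℝ), (0 : Fin d → ℝ)) z.1 :=
    (hasDerivAt_id z.1).prodMk (hasDerivAt_const z.1 z.2)
  exact ((hu.differentiable (z.1, z.2)).hasFDerivAt.comp_hasDerivAt z.1 h1).deriv

lemma pspace_eq_D {u : ℝ × (Fin d → ℝ) → ℝ} (hu : IsTest u) (i : Fin d) :
    pspace i u = D (spaceDir i) u := by
  ext z
  have h1 := (hu.differentiable (z.1, z.2)).hasFDerivAt.comp z.2
    (hasFDerivAt_prodMk_right z.1 z.2)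
  have h2 := h1.fderiv
  unfold pspace
  change fderiv ℝ (u ∘ fun y => (z.1, y)) z.2 _ = _
  rw [h2]
  rfl

lemma pspace2_eq_D {u : ℝ × (Fin d → ℝ) → ℝ} (hu : IsTest u) (i j : Fin d) :
    pspace2 i j u = D (spaceDir i) (D (spaceDir j) u) := by
  rw [pspace2, pspace_eq_D hu, pspace_eq_D (hu.D _)]

lemma sq_le_of_dominates {p₀ : ℕ} {lam σ : ℝ} (hlam : 0 ≤ lam) (hσ : σ ^ 2 = 1)
    {i j : Fin d} (hi : (i : ℕ) < p₀) (hj : (j : ℕ) < p₀) (ξ : Fin d → ℝ) :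
    (√lam / 2 * (ξ i + σ * ξ j)) ^ 2 ≤
      lam * ∑ k : Fin d, if (k : ℕ) < p₀ then ξ k ^ 2 else 0 := by
  have h : ∀ i : Fin d, (i : ℕ) < p₀ →
      ξ i ^ 2 ≤ ∑ k : Fin d, if (k : ℕ) < p₀ then ξ k ^ 2 else 0 := by
    intro i hi
    have := Finset.single_le_sum (s := Finset.univ)
      (f := fun k : Fin d => if (k : ℕ) < p₀ then ξ k ^ 2 else 0)
      (fun k _ => by split_ifs <;> positivity) (Finset.mem_univ i)
    simpa [hi] using this
  have h1 : (ξ i + σ * ξ j) ^ 2 ≤ 2 * (ξ i ^ 2 + ξ j ^ 2) := by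
    have : (σ * ξ j) ^ 2 = ξ j ^ 2 := by rw [mul_pow, hσ, one_mul]
    nlinarith [sq_nonneg (ξ i - σ * ξ j)]
  rw [mul_pow, div_pow, Real.sq_sqrt hlam]
  nlinarith [h i hi, h j hj, mul_le_mul_of_nonneg_left h1 hlam,
    mul_le_mul_of_nonneg_left (h i hi) hlam, mul_le_mul_of_nonneg_left (h j hj) hlam]

end Final

end ParabolicLp

/-- Corollary: a-priori `L^p`-estimates, general parabolicity constant `λ`.
For `1 < p < ∞` and `1 ≤ p₀ ≤ d` there is a constant `M₀ = M₀(d,p,p₀) > 0` such that for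
every `λ > 0`, every Borel measurable, locally bounded `c : ℝ → ℝ^{d×d}` with `c(t)`
symmetric non-negative definite and `Σ_{i,j} c_{ij}(t) ξᵢ ξⱼ ≥ λ Σ_{j≤p₀} ξⱼ²`, every
`u ∈ C_0^∞(ℝ^{d+1})`, and all `i,j ∈ {1,…,p₀}`,
`‖∂²_{xᵢxⱼ} u‖_{L^p(ℝ^{d+1})} ≤ (M₀/λ) ‖∂ₜ u + L u‖_{L^p(ℝ^{d+1})}`. -/
theorem apriori_Lp_estimate_lambda
    (d p₀ : ℕ) (hd : 1 ≤ d) (hp₀ : 1 ≤ p₀) (hp₀d : p₀ ≤ d)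
    (p : ℝ) (hp : 1 < p) :
    ∃ M₀ : ℝ, 0 < M₀ ∧
      ∀ lam : ℝ, 0 < lam →
      ∀ c : ℝ → Matrix (Fin d) (Fin d) ℝ,
        (∀ i j, Measurable fun t => c t i j) →
        (∀ a b : ℝ, ∃ K : ℝ, ∀ t ∈ Set.Icc a b, ∀ i j, |c t i j| ≤ K) →
        (∀ t, (c t).IsSymm) →
        (∀ t (ξ : Fin d → ℝ), 0 ≤ ∑ i, ∑ j, c t i j * ξ i * ξ j) →
        (∀ t (ξ : Fin d → ℝ),
          lam * (∑ k : Fin d, if (k : ℕ) < p₀ then ξ k ^ 2 else 0)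
            ≤ ∑ i, ∑ j, c t i j * ξ i * ξ j) →
        ∀ u : ℝ × (Fin d → ℝ) → ℝ, ContDiff ℝ (⊤ : ℕ∞) u → HasCompactSupport u →
        ∀ i j : Fin d, (i : ℕ) < p₀ → (j : ℕ) < p₀ →
          eLpNorm (pspace2 i j u) (ENNReal.ofReal p) volume
            ≤ ENNReal.ofReal (M₀ / lam) *
              eLpNorm (fun z => ptime u z + ∑ i', ∑ j', c z.1 i' j' * pspace2 i' j' u z)
                (ENNReal.ofReal p) volume := by
  open ParabolicLp in
  obtain ⟨C, hC0, hC⟩ := exists_bound_second_derivative hp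
  refine ⟨2 * C, by positivity, ?_⟩
  intro lam hlam c hc hb hs _ hpos u hu1 hu2 i j hi hj
  have hu : IsTest u := ⟨hu1, hu2⟩
  have : NeZero d := ⟨by omega⟩
  simp only [pspace2_eq_D hu, ptime_eq_D hu]
  set f : ℝ × (Fin d → ℝ) → ℝ := fun z => D (1, 0) u z +
    ∑ i, ∑ j, c z.1 i j * D (spaceDir i) (D (spaceDir j) u) z
  have hv : ∀ σ : ℝ, σ ^ 2 = 1 → ∀ v : Fin d → ℝ,
      v = (√lam / 2) • (Pi.single i 1 + σ • Pi.single j 1) →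
      eLpNorm (D (0, v) (D (0, v) u)) (ENNReal.ofReal p) volume ≤
        ENNReal.ofReal C * eLpNorm f (ENNReal.ofReal p) volume := by
    intro σ hσ v hv
    refine hC d v c hc hb hs (fun t ξ => le_trans ?_ (hpos t ξ)) u hu
    have : ∑ k, v k * ξ k = √lam / 2 * (ξ i + σ * ξ j) := by
      simp [hv, Pi.single_apply, mul_add, add_mul, Finset.sum_add_distrib, mul_assoc]
    rw [this]
    exact sq_le_of_dominates hlam.le hσ hi hj ξ
  have h1 := hv 1 (by norm_num) ((√lam / 2) • (Pi.single i 1 + Pi.single j 1)) (by rw [one_smul])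
  have h2 := hv (-1) (by norm_num) ((√lam / 2) • (Pi.single i 1 - Pi.single j 1))
    (by rw [neg_one_smul, sub_eq_add_neg])
  set w₁ := D (0, (√lam / 2) • (Pi.single i 1 + Pi.single j 1))
    (D (0, (√lam / 2) • (Pi.single i 1 + Pi.single j 1)) u) with hw₁
  set w₂ := D (0, (√lam / 2) • (Pi.single i 1 - Pi.single j 1))
    (D (0, (√lam / 2) • (Pi.single i 1 - Pi.single j 1)) u) with hw₂
  have hrep : D (spaceDir i) (D (spaceDir j) u) = lam⁻¹ • (w₁ - w₂) := by
    ext z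
    have h := D_polarization hu (√lam / 2) (Pi.single i 1) (Pi.single j 1) z
    rw [div_pow, Real.sq_sqrt hlam.le] at h
    rw [Pi.smul_apply, Pi.sub_apply, hw₁, hw₂, h, smul_eq_mul]
    unfold spaceDir
    field_simp
    ring
  have hq : 1 ≤ ENNReal.ofReal p := by
    rw [← ENNReal.ofReal_one]
    exact ENNReal.ofReal_le_ofReal hp.le
  rw [hrep, eLpNorm_const_smul, Real.enorm_of_nonneg (by positivity)]
  have hsub := eLpNorm_sub_le (μ := volume) (((hu.D _).D _).continuous.aestronglyMeasurable (f := w₁))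
    (((hu.D _).D _).continuous.aestronglyMeasurable (f := w₂)) hq
  calc ENNReal.ofReal lam⁻¹ * eLpNorm (w₁ - w₂) (ENNReal.ofReal p) volume
      ≤ ENNReal.ofReal lam⁻¹ * (ENNReal.ofReal C * eLpNorm f (ENNReal.ofReal p) volume +
          ENNReal.ofReal C * eLpNorm f (ENNReal.ofReal p) volume) := by
        gcongr
        exact hsub.trans (add_le_add h1 h2)
    _ = ENNReal.ofReal (2 * C / lam) * eLpNorm f (ENNReal.ofReal p) volume := by
        rw [← two_mul, ← mul_assoc, ← mul_assoc, div_eq_inv_mul, ENNReal.ofReal_mul (by positivity),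
          ENNReal.ofReal_mul zero_le_two, ENNReal.ofReal_ofNat, mul_assoc (ENNReal.ofReal lam⁻¹)]
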